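/- arXiv:2103.09795 — 2 statements merged into one kernel-verified Lean document; each statement's English description precedes it below -/
import Mathlib

section
/- For every odd prime q, ε ∈ (0,1), and C₀ ≥ 1 there exists a constant C (depending only on q, ε, C₀) such that the following holds. Fix an integer A with 1/ε ≤ A ≤ 2/ε; let R = q^{2m} (m ∈ ℕ) be sufficiently large, let r ∈ 4ℕ satisfy q^{q^{A(r−4)}} ≤ R < q^{q^{Ar}}, set R_k := q^{kr}, and let N ∈ ℕ satisfy q^{Nr} ≤ R < q^{(N+1)r}. Let J ∈ {1,…,N}, let f : ℚ_q² → ℂ be Schwartz with Fourier support in Ξ_{1/R_J}, and let α > 0. Define U_α(f) := {x ∈ ℚ_q² : C₀^{-1} α ≤ max_{τ₁ ≠ τ₁'} |f_{τ₁}(x) f_{τ₁'}(x)|^{1/2} ≤ C₀ α and (∑_{τ₁} |f_{τ₁}(x)|⁶)^{1/6} ≤ C₀ (log R) q^{r/2} α}, where τ₁, τ₁' range over intervals of length q^{-r/2} in ℤ_q. Then α⁶ μ²(U_α(f)) ≤ C (log R)^{7+7ε/2} (∑_{τ_J} ‖f_{τ_J}‖_{L∞(ℚ_q²)}²)² (∑_{τ_J}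 ∫_{ℚ_q²} |f_{τ_J}|² dμ²), where τ_J ranges over intervals of length R_J^{-1/2} in ℤ_q. -/
open MeasureTheory

noncomputable instance (q : ℕ) [Fact q.Prime] : MeasurableSpace ℚ_[q] := borel _
instance (q : ℕ) [Fact q.Prime] : BorelSpace ℚ_[q] := ⟨rfl⟩

/-- The Fourier transform on `ℚ_q²` with respect to the additive character `χ`
and the Haar measure `μ`. -/
noncomputable def qpFourier (q : ℕ) [Fact q.Prime] (μ : Measure ℚ_[q]) [SigmaFinite μ]
    (χ : ℚ_[q] → ℂ) (F : ℚ_[q] × ℚ_[q] → ℂ) (ξη : ℚ_[q] × ℚ_[q]) : ℂ :=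
  ∫ x, F x * χ (-(ξη.1 * x.1 + ξη.2 * x.2)) ∂(μ.prod μ)

/-- The Fourier projection `F_τ` of `F` to the frequency strip `τ × ℚ_q`. -/
noncomputable def qpProj (q : ℕ) [Fact q.Prime] (μ : Measure ℚ_[q]) [SigmaFinite μ]
    (χ : ℚ_[q] → ℂ) (F : ℚ_[q] × ℚ_[q] → ℂ) (τ : Set ℚ_[q]) (x : ℚ_[q] × ℚ_[q]) : ℂ :=
  ∫ ξη in τ ×ˢ (Set.univ : Set ℚ_[q]),
    qpFourier q μ χ F ξη * χ (ξη.1 * x.1 + ξη.2 * x.2) ∂(μ.prod μ)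

/-- The interval `{ξ ∈ ℤ_q : |ξ - a| ≤ q^{-ℓ}}`; as `a` runs over `0, …, q^ℓ - 1` these
enumerate all intervals of length `q^{-ℓ}` inside `ℤ_q`. -/
def qpItv (q : ℕ) [Fact q.Prime] (ℓ a : ℕ) : Set ℚ_[q] :=
  {ξ : ℚ_[q] | ‖ξ - (a : ℚ_[q])‖ ≤ (q : ℝ) ^ (-(ℓ : ℤ))}

open scoped Classical in
/-- Indices `b < q^{ℓ'}` whose associated interval of length `q^{-ℓ'}` is contained in the
interval `qpItv q ℓ a` (equivalently, whose centre lies in it). -/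
noncomputable def qpSubItv (q : ℕ) [Fact q.Prime] (ℓ' ℓ a : ℕ) : Finset ℕ :=
  (Finset.range (q ^ ℓ')).filter (fun b => (b : ℚ_[q]) ∈ qpItv q ℓ a)

/-- `max_{τ' ≠ τ'' ⊂ τ} |f_{τ'}(x) f_{τ''}(x)|^{1/2}`, the maximum being over distinct
intervals of length `q^{-ℓ'}` contained in the interval `qpItv q ℓ a`. -/
noncomputable def qpMaxPair (q : ℕ) [Fact q.Prime] (μ : Measure ℚ_[q]) [SigmaFinite μ]
    (χ : ℚ_[q] → ℂ) (f : ℚ_[q] × ℚ_[q] → ℂ) (ℓ' ℓ a : ℕ) (x : ℚ_[q] × ℚ_[q]) : ℝ :=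
  ⨆ b ∈ qpSubItv q ℓ' ℓ a, ⨆ b' ∈ qpSubItv q ℓ' ℓ a, ⨆ _ : b ≠ b',
    Real.sqrt ‖qpProj q μ χ f (qpItv q ℓ' b) x * qpProj q μ χ f (qpItv q ℓ' b') x‖

section PartA
open Finset

section FiniteLevel

/-- the ball `{t : q^(M-n) ∣ t.1, t.2}` in `(ℤ/q^M)²` -/
noncomputable def zBall (q M n : ℕ) [NeZero (q ^ M)] : Finset (ZMod (q ^ M) × ZMod (q ^ M)) := by
  classical
  exact Finset.univ.filter (fun t => (q : ZMod (q ^ M)) ^ (M - n) ∣ t.1 ∧ (q : ZMod (q ^ M)) ^ (M - n) ∣ t.2)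

variable {q M : ℕ} [NeZero (q ^ M)]

lemma mem_zBall {n : ℕ} {t : ZMod (q ^ M) × ZMod (q ^ M)} :
    t ∈ zBall q M n ↔ (q : ZMod (q ^ M)) ^ (M - n) ∣ t.1 ∧ (q : ZMod (q ^ M)) ^ (M - n) ∣ t.2 := by
  classical
  unfold zBall
  simp

lemma zBall_card_pos (n : ℕ) : 0 < (zBall q M n).card :=
  Finset.card_pos.mpr ⟨0, by rw [mem_zBall]; simp⟩

lemma zBall_sum_shift {β : Type*} [AddCommMonoid β] {n : ℕ} {s : ZMod (q ^ M) × ZMod (q ^ M)}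
    (hs : s ∈ zBall q M n) (φ : ZMod (q ^ M) × ZMod (q ^ M) → β) :
    ∑ t ∈ zBall q M n, φ (t + s) = ∑ t ∈ zBall q M n, φ t := by
  rw [mem_zBall] at hs
  refine Finset.sum_bij' (fun t _ => t + s) (fun t _ => t - s) ?_ ?_ ?_ ?_ ?_
  · intro t ht
    rw [mem_zBall] at ht ⊢
    exact ⟨dvd_add ht.1 hs.1, dvd_add ht.2 hs.2⟩
  · intro t ht
    rw [mem_zBall] at ht ⊢
    exact ⟨dvd_sub ht.1 hs.1, dvd_sub ht.2 hs.2⟩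
  · intros; simp
  · intros; simp
  · intros; rfl

lemma zmod_pow_mul_ne_zero (hq : 0 < q) {n : ℕ} (hn : n ≤ M) {c : ℤ} (hc : ¬ (q : ℤ) ^ n ∣ c) :
    (c : ZMod (q ^ M)) * (q : ZMod (q ^ M)) ^ (M - n) ≠ 0 := by
  intro h0
  apply hc
  have h1 : ((c * (q : ℤ) ^ (M - n) : ℤ) : ZMod (q ^ M)) = 0 := by push_cast; exact h0
  rw [ZMod.intCast_zmod_eq_zero_iff_dvd] at h1
  have h2 : (q : ℤ) ^ n * (q : ℤ) ^ (M - n) ∣ c * (q : ℤ) ^ (M - n) := by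
    rw [← pow_add, Nat.add_sub_cancel' hn]; exact_mod_cast h1
  exact Int.dvd_of_mul_dvd_mul_right (by positivity) h2

variable (e : AddChar (ZMod (q ^ M)) ℂ)

lemma orth (hq : 0 < q) (he : ∀ c : ZMod (q ^ M), c ≠ 0 → ∃ w, e (c * w) ≠ 1) {n : ℕ} (hn : n ≤ M)
    (c d : ℤ) (hcd : ¬ ((q : ℤ) ^ n ∣ c ∧ (q : ℤ) ^ n ∣ d)) :
    ∑ t ∈ zBall q M n, e (c * t.1 + d * t.2) = 0 := by
  obtain ⟨s, hs, hes⟩ : ∃ s ∈ zBall q M n, e (c * s.1 + d * s.2) ≠ 1 := by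
    rw [not_and_or] at hcd
    rcases hcd with h | h
    · obtain ⟨w, hw⟩ := he _ (zmod_pow_mul_ne_zero hq hn h)
      refine ⟨((q : ZMod (q ^ M)) ^ (M - n) * w, 0), ?_, ?_⟩
      · rw [mem_zBall]; simp
      · simpa [mul_assoc] using hw
    · obtain ⟨w, hw⟩ := he _ (zmod_pow_mul_ne_zero hq hn h)
      refine ⟨(0, (q : ZMod (q ^ M)) ^ (M - n) * w), ?_, ?_⟩
      · rw [mem_zBall]; simp
      · simpa [mul_assoc] using hw
  have h1 := zBall_sum_shift hs (fun t => e (c * t.1 + d * t.2))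
  have h2 : ∑ t ∈ zBall q M n, e (c * (t + s).1 + d * (t + s).2)
      = (∑ t ∈ zBall q M n, e (c * t.1 + d * t.2)) * e (c * s.1 + d * s.2) := by
    rw [Finset.sum_mul]
    refine Finset.sum_congr rfl fun t _ => ?_
    rw [← AddChar.map_add_eq_mul]
    congr 1
    simp only [Prod.fst_add, Prod.snd_add]; ring
  rw [h2] at h1
  have h3 : (∑ t ∈ zBall q M n, e (c * t.1 + d * t.2)) * (e (c * s.1 + d * s.2) - 1) = 0 := by
    rw [mul_sub, h1]; simp
  rcases mul_eq_zero.mp h3 with h | h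
  · exact h
  · exact absurd (sub_eq_zero.mp h) hes

lemma schur (hq : 0 < q) (he : ∀ c : ZMod (q ^ M), c ≠ 0 → ∃ w, e (c * w) ≠ 1) {n : ℕ} (hn : n ≤ M)
    {ι : Type*} (I : Finset ι) (m p : ι → ℤ) (c : ι → ℂ) (K : ℕ)
    (hK : ∀ i ∈ I, ∀ T ⊆ I, (∀ j ∈ T, (q : ℤ) ^ n ∣ m i - m j ∧ (q : ℤ) ^ n ∣ p i - p j) → T.card ≤ K) :
    ∑ t ∈ zBall q M n, ‖∑ i ∈ I, c i * e (m i * t.1 + p i * t.2)‖ ^ 2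
      ≤ (zBall q M n).card * (K * ∑ i ∈ I, ‖c i‖ ^ 2) := by
  classical
  set B := zBall q M n with hB
  have hconj : ∀ z, (starRingEnd ℂ) (e z) = e (-z) := fun z => by
    rw [AddChar.map_neg_eq_conj]
  have hn1 : ∀ z, ‖e z‖ = 1 := fun z => AddChar.norm_apply e z
  have h1 : ((∑ t ∈ B, ‖∑ i ∈ I, c i * e (m i * t.1 + p i * t.2)‖ ^ 2 : ℝ) : ℂ)
      = ∑ i ∈ I, ∑ j ∈ I, c i * (starRingEnd ℂ) (c j) *
        ∑ t ∈ B, e (((m i - m j : ℤ) : ZMod (q ^ M)) * t.1 + ((p i - p j : ℤ) : ZMod (q ^ M)) * t.2) := by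
    push_cast
    simp_rw [← Complex.mul_conj', map_sum, Finset.sum_mul_sum, Finset.mul_sum]
    rw [Finset.sum_comm]
    refine Finset.sum_congr rfl fun i _ => ?_
    rw [Finset.sum_comm]
    refine Finset.sum_congr rfl fun j _ => Finset.sum_congr rfl fun t _ => ?_
    rw [map_mul, hconj]
    rw [show ((m i : ZMod (q ^ M)) - m j) * t.1 + ((p i : ZMod (q ^ M)) - p j) * t.2
      = (m i * t.1 + p i * t.2) + -(m j * t.1 + p j * t.2) by ring,
      AddChar.map_add_eq_mul e (m i * t.1 + p i * t.2) (-(m j * t.1 + p j * t.2))]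
    ring
  let R : ι → ι → Prop := fun i j => (q : ℤ) ^ n ∣ m i - m j ∧ (q : ℤ) ^ n ∣ p i - p j
  have hRs : ∀ i j, R i j → R j i := fun i j h => ⟨(dvd_sub_comm).mp h.1, (dvd_sub_comm).mp h.2⟩
  have h2 : ∀ i j, ‖c i * (starRingEnd ℂ) (c j) *
        ∑ t ∈ B, e (((m i - m j : ℤ) : ZMod (q ^ M)) * t.1 + ((p i - p j : ℤ) : ZMod (q ^ M)) * t.2)‖
      ≤ B.card * (if R i j then (‖c i‖ ^ 2 + ‖c j‖ ^ 2) / 2 else 0) := by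
    intro i j
    split_ifs with h
    · rw [norm_mul, norm_mul, RCLike.norm_conj]
      have : ‖∑ t ∈ B, e (((m i - m j : ℤ) : ZMod (q ^ M)) * t.1 + ((p i - p j : ℤ) : ZMod (q ^ M)) * t.2)‖ ≤ B.card := by
        refine (norm_sum_le _ _).trans ?_
        simp [hn1]
      have h3 : ‖c i‖ * ‖c j‖ ≤ (‖c i‖ ^ 2 + ‖c j‖ ^ 2) / 2 := by nlinarith [sq_nonneg (‖c i‖ - ‖c j‖)]
      rw [mul_comm (B.card : ℝ)]
      gcongr
    · rw [orth e hq he hn _ _ h]; simp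
  have h4 : (∑ t ∈ B, ‖∑ i ∈ I, c i * e (m i * t.1 + p i * t.2)‖ ^ 2 : ℝ)
      ≤ ∑ i ∈ I, ∑ j ∈ I, (B.card : ℝ) * (if R i j then (‖c i‖ ^ 2 + ‖c j‖ ^ 2) / 2 else 0) := by
    have h5 : (∑ t ∈ B, ‖∑ i ∈ I, c i * e (m i * t.1 + p i * t.2)‖ ^ 2 : ℝ)
      = ‖((∑ t ∈ B, ‖∑ i ∈ I, c i * e (m i * t.1 + p i * t.2)‖ ^ 2 : ℝ) : ℂ)‖ := by
      rw [Complex.norm_real, Real.norm_of_nonneg (by positivity)]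
    rw [h5, h1]
    refine (norm_sum_le _ _).trans (Finset.sum_le_sum fun i _ => ?_)
    exact (norm_sum_le _ _).trans (Finset.sum_le_sum fun j _ => h2 i j)
  refine h4.trans ?_
  have hA : ∀ i ∈ I, ∑ j ∈ I, (if R i j then ‖c i‖ ^ 2 else 0) ≤ K * ‖c i‖ ^ 2 := by
    intro i hi
    rw [← Finset.sum_filter, Finset.sum_const, nsmul_eq_mul]
    gcongr
    exact hK i hi _ (Finset.filter_subset _ _) (fun j hj => (Finset.mem_filter.mp hj).2)
  have hA1 : ∑ i ∈ I, ∑ j ∈ I, (if R i j then ‖c i‖ ^ 2 else 0) ≤ K * ∑ i ∈ I, ‖c i‖ ^ 2 := by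
    rw [Finset.mul_sum]; exact Finset.sum_le_sum hA
  have hA2 : ∑ i ∈ I, ∑ j ∈ I, (if R i j then ‖c j‖ ^ 2 else 0) ≤ K * ∑ i ∈ I, ‖c i‖ ^ 2 := by
    rw [Finset.sum_comm]
    refine le_trans (le_of_eq ?_) hA1
    refine Finset.sum_congr rfl fun i _ => Finset.sum_congr rfl fun j _ => ?_
    exact if_congr ⟨hRs _ _, hRs _ _⟩ rfl rfl
  have h6 : ∑ i ∈ I, ∑ j ∈ I, (B.card : ℝ) * (if R i j then (‖c i‖ ^ 2 + ‖c j‖ ^ 2) / 2 else 0)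
     = B.card * ((∑ i ∈ I, ∑ j ∈ I, (if R i j then ‖c i‖ ^ 2 else 0) +
        ∑ i ∈ I, ∑ j ∈ I, (if R i j then ‖c j‖ ^ 2 else 0)) / 2) := by
    simp_rw [← Finset.mul_sum]
    congr 1
    rw [← Finset.sum_add_distrib, Finset.sum_div]
    refine Finset.sum_congr rfl fun i _ => ?_
    rw [← Finset.sum_add_distrib, Finset.sum_div]
    refine Finset.sum_congr rfl fun j _ => ?_
    split_ifs <;> simp
  rw [h6]
  gcongr
  linarith

end FiniteLevel

end PartA

section PartB
open Finset

section FiniteLevel2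
variable {q M : ℕ} [NeZero (q ^ M)]

/-- modulated invariance of `Φ` along the dual box of the interval of length `q^(-n)` around `a` -/
def Equi (e : AddChar (ZMod (q ^ M)) ℂ) (n a : ℕ) (Φ : ZMod (q ^ M) × ZMod (q ^ M) → ℂ) : Prop :=
  ∀ x t : ZMod (q ^ M) × ZMod (q ^ M), (q : ZMod (q ^ M)) ^ (M - n) ∣ t.1 + 2 * a * t.2 →
    (q : ZMod (q ^ M)) ^ (M - 2 * n) ∣ t.2 → Φ (x + t) = e (a * t.1 + a ^ 2 * t.2) * Φ x

/-- pruning of a value -/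
noncomputable def prune (l : ℝ) (z : ℂ) : ℂ := if ‖z‖ ≤ l then z else 0

lemma norm_prune_le (l : ℝ) (z : ℂ) : ‖prune l z‖ ≤ ‖z‖ := by
  unfold prune; split_ifs <;> simp

lemma norm_prune_le' {l : ℝ} (hl : 0 ≤ l) (z : ℂ) : ‖prune l z‖ ≤ l := by
  unfold prune; split_ifs with h
  · exact h
  · simpa using hl

lemma norm_sub_prune_le {l : ℝ} (hl : 0 < l) (z : ℂ) : ‖z - prune l z‖ ≤ ‖z‖ ^ 2 / l := by
  unfold prune; split_ifs with h
  · simp; positivity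
  · rw [sub_zero, le_div_iff₀ hl]
    push Not at h
    nlinarith [norm_nonneg z]

variable {e : AddChar (ZMod (q ^ M)) ℂ}

lemma Equi.norm {n a : ℕ} {Φ : ZMod (q ^ M) × ZMod (q ^ M) → ℂ} (hΦ : Equi e n a Φ)
    {x t : ZMod (q ^ M) × ZMod (q ^ M)} (h1 : (q : ZMod (q ^ M)) ^ (M - n) ∣ t.1 + 2 * a * t.2)
    (h2 : (q : ZMod (q ^ M)) ^ (M - 2 * n) ∣ t.2) : ‖Φ (x + t)‖ = ‖Φ x‖ := by
  rw [hΦ x t h1 h2, norm_mul, AddChar.norm_apply, one_mul]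

lemma Equi.prune {n a : ℕ} {Φ : ZMod (q ^ M) × ZMod (q ^ M) → ℂ} (hΦ : Equi e n a Φ) (l : ℝ) :
    Equi e n a (fun x => prune l (Φ x)) := by
  intro x t h1 h2
  have h3 := hΦ.norm (x := x) h1 h2
  simp only [_root_.prune, h3]
  split_ifs
  · exact hΦ x t h1 h2
  · simp

lemma zmod_q_pow_zero {k : ℕ} (hk : M ≤ k) : (q : ZMod (q ^ M)) ^ k = 0 := by
  have : ((q ^ k : ℕ) : ZMod (q ^ M)) = 0 := by
    rw [ZMod.natCast_eq_zero_iff]; exact pow_dvd_pow _ hk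
  exact_mod_cast this

lemma Equi.coarsen {n n' a c : ℕ} {Φ : ZMod (q ^ M) × ZMod (q ^ M) → ℂ} (hn : n ≤ n') (hM : 2 * n ≤ M)
    (hΦ : Equi e n' (a + q ^ n * c) Φ) : Equi e n a Φ := by
  intro x t h1 h2
  obtain ⟨u, hu⟩ := h1
  obtain ⟨v, hv⟩ := h2
  have e1 : (q : ZMod (q ^ M)) ^ n * (q : ZMod (q ^ M)) ^ (M - 2 * n) = (q : ZMod (q ^ M)) ^ (M - n) := by
    rw [← pow_add]; congr 1; omega
  have e2 : (q : ZMod (q ^ M)) ^ n * (q : ZMod (q ^ M)) ^ (M - n) = 0 := by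
    rw [← pow_add]; exact zmod_q_pow_zero (by omega)
  rw [hΦ x t]
  · congr 2
    push_cast
    have : (a + (q : ZMod (q ^ M)) ^ n * c) * t.1 + (a + (q : ZMod (q ^ M)) ^ n * c) ^ 2 * t.2
        = a * t.1 + a ^ 2 * t.2 + (q : ZMod (q ^ M)) ^ n * c * (t.1 + 2 * a * t.2)
          + (q : ZMod (q ^ M)) ^ n * c ^ 2 * ((q : ZMod (q ^ M)) ^ n * t.2) := by ring
    rw [this, hu, hv, ← mul_assoc ((q : ZMod (q ^ M)) ^ n) _ v, e1]
    linear_combination (c * u + c ^ 2 * v) * e2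
  · refine (pow_dvd_pow _ (by omega : M - n' ≤ M - n)).trans ?_
    refine ⟨u + 2 * c * v, ?_⟩
    push_cast
    rw [← e1] at hu ⊢
    linear_combination hu + 2 * (q : ZMod (q ^ M)) ^ n * c * hv
  · exact (pow_dvd_pow _ (by omega : M - 2 * n' ≤ M - 2 * n)).trans ⟨v, hv⟩

lemma Equi.sum {ι : Type*} (I : Finset ι) {n a : ℕ} {Φ : ι → ZMod (q ^ M) × ZMod (q ^ M) → ℂ}
    (hΦ : ∀ i ∈ I, Equi e n a (Φ i)) : Equi e n a (fun x => ∑ i ∈ I, Φ i x) := by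
  intro x t h1 h2
  simp only
  rw [Finset.mul_sum]
  exact Finset.sum_congr rfl fun i hi => hΦ i hi x t h1 h2

lemma Equi.ball {n a : ℕ} {Φ : ZMod (q ^ M) × ZMod (q ^ M) → ℂ} (hΦ : Equi e n a Φ)
    {x t : ZMod (q ^ M) × ZMod (q ^ M)} (ht : t ∈ zBall q M n) :
    Φ (x + t) = e (a * t.1 + a ^ 2 * t.2) * Φ x := by
  rw [mem_zBall] at ht
  exact hΦ x t (dvd_add ht.1 (ht.2.mul_left _)) ((pow_dvd_pow _ (by omega)).trans ht.2)

lemma Equi.ball_norm {n a : ℕ} {Φ : ZMod (q ^ M) × ZMod (q ^ M) → ℂ} (hΦ : Equi e n a Φ)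
    {x t : ZMod (q ^ M) × ZMod (q ^ M)} (ht : t ∈ zBall q M n) :
    ‖Φ (x + t)‖ = ‖Φ x‖ := by
  rw [hΦ.ball ht, norm_mul, AddChar.norm_apply, one_mul]

lemma sum_range_split {β : Type*} [AddCommMonoid β] (A B : ℕ) (φ : ℕ → β) :
    ∑ a ∈ range A, ∑ c ∈ range B, φ (a + A * c) = ∑ b ∈ range (A * B), φ b := by
  rw [Finset.sum_comm]
  induction B with
  | zero => simp
  | succ B ih =>
    rw [Finset.sum_range_succ, ih, Nat.mul_succ, Finset.sum_range_add]
    congr 1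
    exact Finset.sum_congr rfl fun a _ => by rw [add_comm]

lemma nat_eq_of_int_dvd {N a b : ℕ} (ha : a < N) (hb : b < N) (h : (N : ℤ) ∣ (a : ℤ) - b) : a = b := by
  have : b ≡ a [MOD N] := (Nat.modEq_iff_dvd).mpr h
  exact (Nat.ModEq.eq_of_lt_of_lt this hb ha).symm

lemma low_lemma (hq : 0 < q) (he : ∀ c : ZMod (q ^ M), c ≠ 0 → ∃ w, e (c * w) ≠ 1) {n h : ℕ}
    (hM : n + h ≤ M) (P : ℕ → ZMod (q ^ M) × ZMod (q ^ M) → ℂ)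
    (hP : ∀ b < q ^ (n + h), Equi e (n + h) b (P b)) (x : ZMod (q ^ M) × ZMod (q ^ M)) :
    ∑ t ∈ zBall q M (n + h), ∑ a ∈ range (q ^ n), ‖∑ c ∈ range (q ^ h), P (a + q ^ n * c) (x + t)‖ ^ 2
      ≤ (zBall q M (n + h)).card * ∑ b ∈ range (q ^ (n + h)), ‖P b x‖ ^ 2 := by
  rw [Finset.sum_comm, pow_add, ← sum_range_split, Finset.mul_sum]
  refine Finset.sum_le_sum fun a ha => ?_
  rw [mem_range] at ha
  have hlt : ∀ c ∈ range (q ^ h), a + q ^ n * c < q ^ (n + h) := by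
    intro c hc
    rw [mem_range] at hc
    rw [pow_add]
    calc a + q ^ n * c < q ^ n + q ^ n * c := by omega
      _ = q ^ n * (c + 1) := by ring
      _ ≤ _ := Nat.mul_le_mul_left _ hc
  have := schur e hq he hM (range (q ^ h)) (fun c => ((a + q ^ n * c : ℕ) : ℤ))
    (fun c => ((a + q ^ n * c : ℕ) : ℤ) ^ 2) (fun c => P (a + q ^ n * c) x) 1 ?_
  · rw [Nat.cast_one, one_mul] at this
    refine le_trans (le_of_eq ?_) this
    refine Finset.sum_congr rfl fun t ht => ?_
    congr 2
    refine Finset.sum_congr rfl fun c hc => ?_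
    rw [(hP _ (hlt c hc)).ball ht, mul_comm]
    push_cast
    rfl
  · intro i hi T hT hTj
    have key : ∀ j ∈ T, i = j := by
      intro j hj
      have h1 := (hTj j hj).1
      refine nat_eq_of_int_dvd (mem_range.mp hi) (mem_range.mp (hT hj)) ?_
      push_cast at h1 ⊢
      have h2 : (q : ℤ) ^ n * (q : ℤ) ^ h ∣ (q : ℤ) ^ n * ((i : ℤ) - j) := by
        rw [← pow_add]; convert h1 using 1; ring
      exact Int.dvd_of_mul_dvd_mul_left (by positivity) h2
    rw [Finset.card_le_one]
    intro j hj j' hj'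
    rw [← key j hj, ← key j' hj']

lemma pow_dvd_of_mul {p : ℕ} (hp : p.Prime) {n h : ℕ} {x y : ℤ} (hxy : (p : ℤ) ^ (n + h) ∣ x * y)
    (hy : ¬ (p : ℤ) ^ h ∣ y) : (p : ℤ) ^ n ∣ x := by
  have hp' : Prime (p : ℤ) := Nat.prime_iff_prime_int.mp hp
  induction h generalizing y with
  | zero => simp at hy
  | succ h ih =>
    by_cases hpy : (p : ℤ) ∣ y
    · obtain ⟨z, rfl⟩ := hpy
      refine ih (y := z) ?_ ?_
      · have : (p : ℤ) * (p : ℤ) ^ (n + h) ∣ (p : ℤ) * (x * z) := by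
          rw [← pow_succ', mul_left_comm (p : ℤ) x z]; exact hxy
        exact (mul_dvd_mul_iff_left hp'.ne_zero).mp this
      · intro hz
        apply hy
        rw [pow_succ']
        exact mul_dvd_mul_left _ hz
    · have : (p : ℤ) ^ (n + (h + 1)) ∣ x := hp'.pow_dvd_of_dvd_mul_right _ hpy hxy
      exact (pow_dvd_pow _ (by omega)).trans this

lemma bil_count (hq : q.Prime) (hq2 : q ≠ 2) {n h b b' : ℕ} (hn : h ≤ n) (hb : b < q ^ h) (hb' : b' < q ^ h)
    (hbb : b ≠ b') (a a' d d' : ℤ) (ha : (q : ℤ) ^ h ∣ a - b) (hd : (q : ℤ) ^ h ∣ d - b)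
    (ha' : (q : ℤ) ^ h ∣ a' - b') (hd' : (q : ℤ) ^ h ∣ d' - b')
    (h1 : (q : ℤ) ^ n ∣ (a + a') - (d + d')) (h2 : (q : ℤ) ^ n ∣ (a ^ 2 + a' ^ 2) - (d ^ 2 + d' ^ 2)) :
    (q : ℤ) ^ (n - h) ∣ a - d := by
  apply pow_dvd_of_mul hq (h := h) (y := a + d - a' - d')
  · rw [Nat.sub_add_cancel hn]
    have : (a - d) * (a + d - a' - d') = ((a ^ 2 + a' ^ 2) - (d ^ 2 + d' ^ 2)) - ((a + a') - (d + d')) * (a' + d') := by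
      ring
    rw [this]
    exact dvd_sub h2 (h1.mul_right _)
  · intro hdv
    have h3 : (q : ℤ) ^ h ∣ 2 * ((b : ℤ) - b') := by
      have : 2 * ((b : ℤ) - b') = (a + d - a' - d') - (a - b) - (d - b) + (a' - b') + (d' - b') := by ring
      rw [this]
      exact dvd_add (dvd_add (dvd_sub (dvd_sub hdv ha) hd) ha') hd'
    have hco : IsCoprime ((q : ℤ) ^ h) 2 := by
      apply IsCoprime.pow_left
      have : Nat.Coprime q 2 := (Nat.coprime_primes hq Nat.prime_two).mpr hq2
      exact_mod_cast Nat.isCoprime_iff_coprime.mpr this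
    have h4 := hco.dvd_of_dvd_mul_left h3
    exact hbb (nat_eq_of_int_dvd hb hb' (by exact_mod_cast h4))

lemma bil_lemma (hq : q.Prime) (hq2 : q ≠ 2) (he : ∀ c : ZMod (q ^ M), c ≠ 0 → ∃ w, e (c * w) ≠ 1) {n h : ℕ}
    (hM : n ≤ M) (hn : h ≤ n) (Q : ℕ → ZMod (q ^ M) × ZMod (q ^ M) → ℂ)
    (hQ : ∀ a < q ^ n, Equi e n a (Q a)) (x : ZMod (q ^ M) × ZMod (q ^ M)) {b b' : ℕ}
    (hb : b < q ^ h) (hb' : b' < q ^ h) (hbb : b ≠ b') :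
    ∑ t ∈ zBall q M n, (‖∑ a ∈ range (q ^ n) with a % q ^ h = b, Q a (x + t)‖ *
        ‖∑ a ∈ range (q ^ n) with a % q ^ h = b', Q a (x + t)‖) ^ 2
      ≤ (zBall q M n).card * (q ^ h * ((∑ a ∈ range (q ^ n) with a % q ^ h = b, ‖Q a x‖ ^ 2) *
        (∑ a ∈ range (q ^ n) with a % q ^ h = b', ‖Q a x‖ ^ 2))) := by
  set I := {a ∈ range (q ^ n) | a % q ^ h = b} with hI
  set I' := {a ∈ range (q ^ n) | a % q ^ h = b'} with hI'
  have hmod : ∀ a : ℕ, (q : ℤ) ^ h ∣ a - (a % q ^ h : ℕ) := by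
    intro a
    have := Nat.mod_modEq a (q ^ h)
    have := (Nat.modEq_iff_dvd).mp this
    exact_mod_cast this
  have hqp : 0 < q := hq.pos
  have := schur e hqp he hM (I ×ˢ I') (fun i => ((i.1 : ℤ) + i.2))
    (fun i => ((i.1 : ℤ) ^ 2 + (i.2 : ℤ) ^ 2)) (fun i => Q i.1 x * Q i.2 x) (q ^ h) ?_
  · refine le_trans (le_of_eq ?_) (this.trans (le_of_eq ?_))
    · refine Finset.sum_congr rfl fun t ht => ?_
      rw [← norm_mul, Finset.sum_mul_sum, ← Finset.sum_product']
      congr 2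
      refine Finset.sum_congr rfl fun i hi => ?_
      rw [mem_product, hI, hI', mem_filter, mem_filter, mem_range, mem_range] at hi
      rw [(hQ _ hi.1.1).ball ht, (hQ _ hi.2.1).ball ht]
      push_cast
      rw [show ((i.1 : ZMod (q ^ M)) + i.2) * t.1 + ((i.1 : ZMod (q ^ M)) ^ 2 + (i.2 : ZMod (q ^ M)) ^ 2) * t.2
        = (i.1 * t.1 + (i.1 : ZMod (q ^ M)) ^ 2 * t.2) + (i.2 * t.1 + (i.2 : ZMod (q ^ M)) ^ 2 * t.2) by ring,
        AddChar.map_add_eq_mul e (i.1 * t.1 + (i.1 : ZMod (q ^ M)) ^ 2 * t.2) (i.2 * t.1 + (i.2 : ZMod (q ^ M)) ^ 2 * t.2)]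
      ring
    · rw [Finset.sum_mul_sum, ← Finset.sum_product']
      push_cast
      congr 2
      exact Finset.sum_congr rfl fun i _ => by rw [norm_mul, mul_pow]
  · intro i hi T hT hTj
    rw [mem_product, hI, hI', mem_filter, mem_filter, mem_range, mem_range] at hi
    have hTm : ∀ j ∈ T, (j.1 < q ^ n ∧ j.1 % q ^ h = b) ∧ (j.2 < q ^ n ∧ j.2 % q ^ h = b') := by
      intro j hj
      have := hT hj
      rwa [mem_product, hI, hI', mem_filter, mem_filter, mem_range, mem_range] at this
    have hdv : ∀ j ∈ T, (q : ℤ) ^ (n - h) ∣ (i.1 : ℤ) - j.1 := by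
      intro j hj
      have hj' := hTm j hj
      refine bil_count hq hq2 hn hb hb' hbb i.1 i.2 j.1 j.2 ?_ ?_ ?_ ?_ (hTj j hj).1 (hTj j hj).2
      · have := hmod i.1; rwa [hi.1.2] at this
      · have := hmod j.1; rwa [hj'.1.2] at this
      · have := hmod i.2; rwa [hi.2.2] at this
      · have := hmod j.2; rwa [hj'.2.2] at this
    rw [← Finset.card_range (q ^ h)]
    refine Finset.card_le_card_of_injOn (fun j => j.1 / q ^ (n - h)) ?_ ?_
    · intro j hj
      have hj' := hTm j hj
      simp only [coe_range, Set.mem_Iio]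
      rw [Nat.div_lt_iff_lt_mul (by positivity), ← pow_add, Nat.add_sub_cancel' hn]
      exact hj'.1.1
    · intro j hj k hk hjk
      have hj' := hTm j hj
      have hk' := hTm k hk
      simp only at hjk
      have h1 : (q : ℤ) ^ (n - h) ∣ (k.1 : ℤ) - j.1 := by
        have := dvd_sub (hdv j hj) (hdv k hk)
        rwa [sub_sub_sub_cancel_left] at this
      have h2 : j.1 % q ^ (n - h) = k.1 % q ^ (n - h) := by
        apply (Nat.modEq_iff_dvd).mpr
        exact_mod_cast h1
      have h3 : j.1 = k.1 := by
        rw [← Nat.div_add_mod j.1 (q ^ (n - h)), ← Nat.div_add_mod k.1 (q ^ (n - h)), h2, hjk]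
      refine Prod.ext h3 ?_
      refine nat_eq_of_int_dvd hj'.2.1 hk'.2.1 ?_
      have := dvd_sub (hTj k hk).1 (hTj j hj).1
      push_cast
      rw [h3, sub_sub_sub_cancel_left, add_sub_add_left_eq_sub] at this
      exact this

end FiniteLevel2

end PartB

section PartC
open Finset

section FiniteLevel3
variable {q M : ℕ} [NeZero (q ^ M)] {e : AddChar (ZMod (q ^ M)) ℂ}

/-- averaging over balls -/
noncomputable def zAvg (n : ℕ) (u : ZMod (q ^ M) × ZMod (q ^ M) → ℝ) (x : ZMod (q ^ M) × ZMod (q ^ M)) : ℝ :=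
  (∑ t ∈ zBall q M n, u (x + t)) / (zBall q M n).card

lemma sum_zAvg (n : ℕ) (u : ZMod (q ^ M) × ZMod (q ^ M) → ℝ) : ∑ x, zAvg n u x = ∑ x, u x := by
  have hc : ((zBall q M n).card : ℝ) ≠ 0 := by exact_mod_cast (zBall_card_pos n).ne'
  unfold zAvg
  rw [← Finset.sum_div, Finset.sum_comm, div_eq_iff hc]
  have : ∀ t ∈ zBall q M n, ∑ x, u (x + t) = ∑ x, u x := fun t _ =>
    Equiv.sum_comp (Equiv.addRight t) u
  rw [Finset.sum_congr rfl this, Finset.sum_const, nsmul_eq_mul, mul_comm]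

lemma solve_lin (hq : q.Prime) (hq2 : q ≠ 2) {n h : ℕ} (hn : h ≤ n) (hM : 2 * n ≤ M) {d : ℤ}
    (hd : ¬ (q : ℤ) ^ (n - h) ∣ d) (σ : ZMod (q ^ M)) (hσ : (q : ZMod (q ^ M)) ^ (M - (n + h)) ∣ σ) :
    ∃ v : ZMod (q ^ M), (q : ZMod (q ^ M)) ^ (M - 2 * n) ∣ v ∧ 2 * (d : ZMod (q ^ M)) * v = σ := by
  have hd0 : d ≠ 0 := by rintro rfl; simp at hd
  have hfin : FiniteMultiplicity (q : ℤ) d := by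
    rw [Int.finiteMultiplicity_iff]
    exact ⟨by simpa using hq.one_lt.ne', hd0⟩
  obtain ⟨d', hd', hnd⟩ := hfin.exists_eq_pow_mul_and_not_dvd
  set i := multiplicity (q : ℤ) d with hi
  have hilt : i < n - h := by
    by_contra hcon
    push Not at hcon
    apply hd
    rw [hd']
    exact (pow_dvd_pow _ hcon).mul_right _
  have hunit : IsUnit ((2 * d' : ℤ) : ZMod (q ^ M)) := by
    rw [ZMod.coe_int_isUnit_iff_isCoprime]
    push_cast
    apply IsCoprime.pow_left
    apply IsCoprime.mul_right
    · have : Nat.Coprime q 2 := (Nat.coprime_primes hq Nat.prime_two).mpr hq2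
      exact_mod_cast Nat.isCoprime_iff_coprime.mpr this
    · exact (Nat.prime_iff_prime_int.mp hq).coprime_iff_not_dvd.mpr hnd
  obtain ⟨y, hy⟩ := hunit.exists_right_inv
  obtain ⟨w, rfl⟩ := hσ
  refine ⟨y * (q : ZMod (q ^ M)) ^ (M - (n + h) - i) * w, ?_, ?_⟩
  · exact ((pow_dvd_pow _ (by omega : M - 2 * n ≤ M - (n + h) - i)).mul_left _).mul_right _
  · rw [hd']
    push_cast at hy ⊢
    have : (q : ZMod (q ^ M)) ^ (M - (n + h)) = (q : ZMod (q ^ M)) ^ i * (q : ZMod (q ^ M)) ^ (M - (n + h) - i) := by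
      rw [← pow_add]; congr 1; omega
    rw [this]
    linear_combination (q : ZMod (q ^ M)) ^ i * (q : ZMod (q ^ M)) ^ (M - (n + h) - i) * w * hy

lemma far_shift (hq : q.Prime) (hq2 : q ≠ 2) {n h a b : ℕ} (hn : h ≤ n) (hM : 2 * n ≤ M)
    (hab : ¬ (q : ℤ) ^ (n - h) ∣ (b : ℤ) - a)
    (G u : ZMod (q ^ M) × ZMod (q ^ M) → ℝ)
    (hG : ∀ x t : ZMod (q ^ M) × ZMod (q ^ M), (q : ZMod (q ^ M)) ^ (M - n) ∣ t.1 + 2 * a * t.2 →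
      (q : ZMod (q ^ M)) ^ (M - 2 * n) ∣ t.2 → G (x + t) = G x)
    (hu : ∀ x t : ZMod (q ^ M) × ZMod (q ^ M), (q : ZMod (q ^ M)) ^ (M - n) ∣ t.1 + 2 * b * t.2 →
      (q : ZMod (q ^ M)) ^ (M - 2 * n) ∣ t.2 → u (x + t) = u x)
    (s : ZMod (q ^ M) × ZMod (q ^ M)) (hs : s ∈ zBall q M (n + h)) :
    ∑ x, G x * u (x + s) = ∑ x, G x * u x := by
  rw [mem_zBall] at hs
  obtain ⟨v, hv, hv2⟩ := solve_lin hq hq2 hn hM hab (s.1 + 2 * b * s.2) (dvd_add hs.1 (hs.2.mul_left _))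
  have h1 : ∀ x, u (x + s) = u (x + (-2 * a * v, v)) := by
    intro x
    have hx : x + s = x + (-2 * a * v, v) + (-2 * b * (s.2 - v), s.2 - v) := by
      rw [add_assoc]
      congr 1
      ext
      · simp only [Prod.fst_add]
        push_cast at hv2
        linear_combination (-1 : ZMod (q ^ M)) * hv2
      · simp
    rw [hx]
    apply hu
    · simp
    · exact dvd_sub ((pow_dvd_pow _ (by omega)).trans hs.2) hv
  have h2 : ∀ x, G x = G (x + (-2 * a * v, v)) := by
    intro x
    rw [hG]
    · simp
    · exact hv
  calc ∑ x, G x * u (x + s) = ∑ x, G (x + (-2 * a * v, v)) * u (x + (-2 * a * v, v)) :=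
        Finset.sum_congr rfl fun x _ => by rw [h1 x, ← h2 x]
    _ = _ := Equiv.sum_comp (Equiv.addRight ((-2 * a * v, v) : ZMod (q ^ M) × ZMod (q ^ M))) (fun x => G x * u x)

lemma zAvg_inv (n : ℕ) (u : ZMod (q ^ M) × ZMod (q ^ M) → ℝ) {t : ZMod (q ^ M) × ZMod (q ^ M)}
    (h : ∀ x, u (x + t) = u x) (x : ZMod (q ^ M) × ZMod (q ^ M)) : zAvg n u (x + t) = zAvg n u x := by
  unfold zAvg
  congr 1
  refine Finset.sum_congr rfl fun s _ => ?_
  rw [add_right_comm, h]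

lemma far_zero (hq : q.Prime) (hq2 : q ≠ 2) {n h a b : ℕ} (hn : h ≤ n) (hM : 2 * n ≤ M)
    (hab : ¬ (q : ℤ) ^ (n - h) ∣ (b : ℤ) - a)
    (u' u : ZMod (q ^ M) × ZMod (q ^ M) → ℝ)
    (hu' : ∀ x t : ZMod (q ^ M) × ZMod (q ^ M), (q : ZMod (q ^ M)) ^ (M - n) ∣ t.1 + 2 * a * t.2 →
      (q : ZMod (q ^ M)) ^ (M - 2 * n) ∣ t.2 → u' (x + t) = u' x)
    (hu : ∀ x t : ZMod (q ^ M) × ZMod (q ^ M), (q : ZMod (q ^ M)) ^ (M - n) ∣ t.1 + 2 * b * t.2 →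
      (q : ZMod (q ^ M)) ^ (M - 2 * n) ∣ t.2 → u (x + t) = u x) :
    ∑ x, (u' x - zAvg (n + h) u' x) * (u x - zAvg (n + h) u x) = 0 := by
  have hc : ((zBall q M (n + h)).card : ℝ) ≠ 0 := by exact_mod_cast (zBall_card_pos (n + h)).ne'
  set G := fun x => u' x - zAvg (n + h) u' x with hG
  have hGi : ∀ x t : ZMod (q ^ M) × ZMod (q ^ M), (q : ZMod (q ^ M)) ^ (M - n) ∣ t.1 + 2 * a * t.2 →
      (q : ZMod (q ^ M)) ^ (M - 2 * n) ∣ t.2 → G (x + t) = G x := by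
    intro x t h1 h2
    simp only [hG]
    rw [hu' x t h1 h2, zAvg_inv _ _ (fun x => hu' x t h1 h2)]
  have h1 : ∑ x, G x * zAvg (n + h) u x = ∑ x, G x * u x := by
    unfold zAvg
    simp_rw [← mul_div_assoc]
    rw [← Finset.sum_div, div_eq_iff hc]
    simp_rw [Finset.mul_sum]
    rw [Finset.sum_comm, Finset.sum_congr rfl (fun s hs => far_shift hq hq2 hn hM hab G u hGi hu s hs),
      Finset.sum_const, nsmul_eq_mul, mul_comm]
  simp_rw [mul_sub]
  rw [Finset.sum_sub_distrib]
  show ∑ x, G x * u x - ∑ x, G x * zAvg (n + h) u x = 0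
  rw [h1, sub_self]

lemma var_le (n : ℕ) (u : ZMod (q ^ M) × ZMod (q ^ M) → ℝ) (hu : ∀ x, 0 ≤ u x) :
    ∑ x, (u x - zAvg n u x) ^ 2 ≤ 2 * ∑ x, u x ^ 2 := by
  have hc : (0 : ℝ) < (zBall q M n).card := by exact_mod_cast (zBall_card_pos n)
  have h1 : ∀ x, (zAvg n u x) ^ 2 ≤ zAvg n (fun x => u x ^ 2) x := by
    intro x
    unfold zAvg
    exact sum_div_card_sq_le_sum_sq_div_card
  have h2 : ∀ x, (u x - zAvg n u x) ^ 2 ≤ u x ^ 2 + zAvg n (fun x => u x ^ 2) x := by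
    intro x
    have h3 : 0 ≤ zAvg n u x := div_nonneg (Finset.sum_nonneg fun t _ => hu _) hc.le
    nlinarith [h1 x, mul_nonneg (hu x) h3]
  refine (Finset.sum_le_sum fun x _ => h2 x).trans ?_
  rw [Finset.sum_add_distrib, sum_zAvg]
  linarith

lemma near_count (hq : 0 < q) {n h a : ℕ} (hn : h ≤ n) :
    (((range (q ^ n)).filter (fun b : ℕ => (q : ℤ) ^ (n - h) ∣ (b : ℤ) - a)).card) ≤ q ^ h := by
  rw [← Finset.card_range (q ^ h)]
  refine Finset.card_le_card_of_injOn (fun j => j / q ^ (n - h)) ?_ ?_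
  · intro j hj
    simp only [coe_filter, mem_range, Set.mem_ofPred_eq] at hj
    simp only [coe_range, Set.mem_Iio]
    rw [Nat.div_lt_iff_lt_mul (by positivity), ← pow_add, Nat.add_sub_cancel' hn]
    exact hj.1
  · intro j hj k hk hjk
    simp only [coe_filter, mem_range, Set.mem_ofPred_eq] at hj hk
    simp only at hjk
    have h1 : (q : ℤ) ^ (n - h) ∣ (k : ℤ) - j := by
      have := dvd_sub hk.2 hj.2
      rwa [sub_sub_sub_cancel_right] at this
    have h2 : j % q ^ (n - h) = k % q ^ (n - h) := by
      apply (Nat.modEq_iff_dvd).mpr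
      exact_mod_cast h1
    rw [← Nat.div_add_mod j (q ^ (n - h)), ← Nat.div_add_mod k (q ^ (n - h)), h2, hjk]

lemma high_lemma (hq : q.Prime) (hq2 : q ≠ 2) {n h : ℕ} (hn : h ≤ n) (hM : 2 * n ≤ M)
    (Q : ℕ → ZMod (q ^ M) × ZMod (q ^ M) → ℂ)
    (hQ : ∀ a < q ^ n, Equi e n a (Q a)) :
    ∑ x, (∑ a ∈ range (q ^ n), ‖Q a x‖ ^ 2 - zAvg (n + h) (fun x => ∑ a ∈ range (q ^ n), ‖Q a x‖ ^ 2) x) ^ 2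
      ≤ 2 * q ^ h * ∑ a ∈ range (q ^ n), ∑ x, ‖Q a x‖ ^ 4 := by
  classical
  set u : ℕ → ZMod (q ^ M) × ZMod (q ^ M) → ℝ := fun a x => ‖Q a x‖ ^ 2 with hu
  set G : ℕ → ZMod (q ^ M) × ZMod (q ^ M) → ℝ := fun a x => u a x - zAvg (n + h) (u a) x with hG
  have h1 : ∀ x, (∑ a ∈ range (q ^ n), ‖Q a x‖ ^ 2 - zAvg (n + h) (fun x => ∑ a ∈ range (q ^ n), ‖Q a x‖ ^ 2) x)
      = ∑ a ∈ range (q ^ n), G a x := by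
    intro x
    simp only [hG]
    rw [Finset.sum_sub_distrib]
    congr 1
    unfold zAvg
    rw [← Finset.sum_div, Finset.sum_comm]
  simp_rw [h1]
  let R : ℕ → ℕ → Prop := fun a b => (q : ℤ) ^ (n - h) ∣ (b : ℤ) - a
  have hRs : ∀ a b, R a b → R b a := fun a b h => (dvd_sub_comm).mp h
  have huinv : ∀ a < q ^ n, ∀ x t : ZMod (q ^ M) × ZMod (q ^ M), (q : ZMod (q ^ M)) ^ (M - n) ∣ t.1 + 2 * a * t.2 →
      (q : ZMod (q ^ M)) ^ (M - 2 * n) ∣ t.2 → u a (x + t) = u a x := by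
    intro a ha x t h1 h2
    simp only [hu]
    rw [(hQ a ha).norm h1 h2]
  have h2 : ∀ a ∈ range (q ^ n), ∀ b ∈ range (q ^ n), ∑ x, G a x * G b x
      ≤ if R a b then (∑ x, G a x ^ 2 + ∑ x, G b x ^ 2) / 2 else 0 := by
    intro a ha b hb
    split_ifs with hab
    · rw [← Finset.sum_add_distrib, Finset.sum_div]
      exact Finset.sum_le_sum fun x _ => by nlinarith [sq_nonneg (G a x - G b x)]
    · exact (far_zero hq hq2 hn hM hab (u a) (u b) (huinv a (mem_range.mp ha)) (huinv b (mem_range.mp hb))).le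
  have h3 : ∑ x, (∑ a ∈ range (q ^ n), G a x) ^ 2
      ≤ ∑ a ∈ range (q ^ n), ∑ b ∈ range (q ^ n), if R a b then (∑ x, G a x ^ 2 + ∑ x, G b x ^ 2) / 2 else 0 := by
    have : ∑ x, (∑ a ∈ range (q ^ n), G a x) ^ 2 = ∑ a ∈ range (q ^ n), ∑ b ∈ range (q ^ n), ∑ x, G a x * G b x := by
      simp_rw [sq, Finset.sum_mul_sum]
      rw [Finset.sum_comm]
      refine Finset.sum_congr rfl fun a _ => ?_
      rw [Finset.sum_comm]
    rw [this]
    exact Finset.sum_le_sum fun a ha => Finset.sum_le_sum fun b hb => h2 a ha b hb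
  refine h3.trans ?_
  have hA1 : ∑ a ∈ range (q ^ n), ∑ b ∈ range (q ^ n), (if R a b then ∑ x, G a x ^ 2 else 0)
      ≤ q ^ h * ∑ a ∈ range (q ^ n), ∑ x, G a x ^ 2 := by
    rw [Finset.mul_sum]
    refine Finset.sum_le_sum fun a _ => ?_
    rw [← Finset.sum_filter, Finset.sum_const, nsmul_eq_mul]
    have : (#{b ∈ range (q ^ n) | R a b} : ℝ) ≤ ((q ^ h : ℕ) : ℝ) :=
      Nat.cast_le.mpr (le_trans (le_of_eq (by congr)) (near_count (a := a) hq.pos hn))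
    rw [Nat.cast_pow] at this
    gcongr
  have hA2 : ∑ a ∈ range (q ^ n), ∑ b ∈ range (q ^ n), (if R a b then ∑ x, G b x ^ 2 else 0)
      ≤ q ^ h * ∑ a ∈ range (q ^ n), ∑ x, G a x ^ 2 := by
    rw [Finset.sum_comm]
    refine le_trans (le_of_eq ?_) hA1
    refine Finset.sum_congr rfl fun i _ => Finset.sum_congr rfl fun j _ => ?_
    exact if_congr ⟨hRs _ _, hRs _ _⟩ rfl rfl
  have h6 : (∑ a ∈ range (q ^ n), ∑ b ∈ range (q ^ n), if R a b then (∑ x, G a x ^ 2 + ∑ x, G b x ^ 2) / 2 else 0)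
     = ((∑ a ∈ range (q ^ n), ∑ b ∈ range (q ^ n), (if R a b then ∑ x, G a x ^ 2 else 0) +
        ∑ a ∈ range (q ^ n), ∑ b ∈ range (q ^ n), (if R a b then ∑ x, G b x ^ 2 else 0)) / 2) := by
    rw [← Finset.sum_add_distrib, Finset.sum_div]
    refine Finset.sum_congr rfl fun i _ => ?_
    rw [← Finset.sum_add_distrib, Finset.sum_div]
    refine Finset.sum_congr rfl fun j _ => ?_
    split_ifs <;> simp
  rw [h6]
  have h7 : ∑ a ∈ range (q ^ n), ∑ x, G a x ^ 2 ≤ 2 * ∑ a ∈ range (q ^ n), ∑ x, ‖Q a x‖ ^ 4 := by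
    rw [Finset.mul_sum]
    refine Finset.sum_le_sum fun a _ => ?_
    refine (var_le (n + h) (u a) (fun x => by positivity)).trans (le_of_eq ?_)
    congr 1
    exact Finset.sum_congr rfl fun x _ => by simp only [hu]; ring
  have h8 := mul_le_mul_of_nonneg_left h7 (by positivity : (0 : ℝ) ≤ (q : ℝ) ^ h)
  linarith

end FiniteLevel3

end PartC

section PartD
open Finset

section FiniteLevel4
variable {q M : ℕ} [NeZero (q ^ M)] {e : AddChar (ZMod (q ^ M)) ℂ}

/-- square function -/
noncomputable def gSq (h : ℕ) (Q : ℕ → ℕ → ZMod (q ^ M) × ZMod (q ^ M) → ℂ) (k : ℕ)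
    (x : ZMod (q ^ M) × ZMod (q ^ M)) : ℝ := ∑ a ∈ range (q ^ (k * h)), ‖Q k a x‖ ^ 2

/-- partial sums over the coarse intervals -/
noncomputable def eSum (h : ℕ) (Q : ℕ → ℕ → ZMod (q ^ M) × ZMod (q ^ M) → ℂ) (k b : ℕ)
    (x : ZMod (q ^ M) × ZMod (q ^ M)) : ℂ := ∑ a ∈ range (q ^ (k * h)) with a % q ^ h = b, Q k a x

lemma gSq_nonneg (h : ℕ) (Q : ℕ → ℕ → ZMod (q ^ M) × ZMod (q ^ M) → ℂ) (k : ℕ)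
    (x : ZMod (q ^ M) × ZMod (q ^ M)) : 0 ≤ gSq h Q k x := by
  unfold gSq; positivity

variable {h J : ℕ} {l : ℝ} {Q : ℕ → ℕ → ZMod (q ^ M) × ZMod (q ^ M) → ℂ}

lemma Q_equi (hq : 0 < q) (hM : 2 * (J * h) ≤ M)
    (hrec : ∀ k < J, ∀ a x, Q k a x = ∑ c ∈ range (q ^ h), prune l (Q (k + 1) (a + q ^ (k * h) * c) x))
    (hJ : ∀ a < q ^ (J * h), Equi e (J * h) a (Q J a)) :
    ∀ k ≤ J, ∀ a < q ^ (k * h), Equi e (k * h) a (Q k a) := by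
  intro k hk
  induction hk using Nat.decreasingInduction with
  | self => exact hJ
  | of_succ k hk ih =>
    intro a ha
    have : Q k a = fun x => ∑ c ∈ range (q ^ h), prune l (Q (k + 1) (a + q ^ (k * h) * c) x) := by
      funext x; exact hrec k hk a x
    rw [this]
    have hkJ : k * h ≤ J * h := Nat.mul_le_mul_right _ hk.le
    have hkk : k * h ≤ (k + 1) * h := Nat.mul_le_mul_right _ (Nat.le_succ k)
    apply Equi.sum
    intro c hc
    rw [mem_range] at hc
    refine Equi.coarsen (c := c) hkk (by omega) ?_
    apply Equi.prune
    apply ih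
    rw [Nat.succ_mul, pow_add]
    calc a + q ^ (k * h) * c < q ^ (k * h) + q ^ (k * h) * c := by omega
      _ = q ^ (k * h) * (c + 1) := by ring
      _ ≤ _ := Nat.mul_le_mul_left _ hc

lemma g_low (hq : 0 < q) (he : ∀ c : ZMod (q ^ M), c ≠ 0 → ∃ w, e (c * w) ≠ 1) (hM : 2 * (J * h) ≤ M)
    (hrec : ∀ k < J, ∀ a x, Q k a x = ∑ c ∈ range (q ^ h), prune l (Q (k + 1) (a + q ^ (k * h) * c) x))
    (hJ : ∀ a < q ^ (J * h), Equi e (J * h) a (Q J a)) {k : ℕ} (hk : k < J) (x : ZMod (q ^ M) × ZMod (q ^ M)) :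
    zAvg (k * h + h) (gSq h Q k) x ≤ gSq h Q (k + 1) x := by
  have hkJ : (k + 1) * h ≤ J * h := Nat.mul_le_mul_right _ hk
  have hk1 : (k + 1) * h = k * h + h := Nat.succ_mul _ _
  have hequi := Q_equi hq hM hrec hJ (k + 1) hk
  rw [hk1] at hequi hkJ
  have hc : (0 : ℝ) < (zBall q M (k * h + h)).card := by exact_mod_cast (zBall_card_pos _)
  have := low_lemma hq he (n := k * h) (h := h) (by omega) (fun b x => prune l (Q (k + 1) b x))
    (fun b hb => (hequi b hb).prune l) x
  unfold zAvg gSq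
  rw [div_le_iff₀' hc]
  simp_rw [hrec k hk]
  refine this.trans ?_
  rw [hk1]
  gcongr
  exact norm_prune_le _ _

lemma sum_g_le (hq : 0 < q) (he : ∀ c : ZMod (q ^ M), c ≠ 0 → ∃ w, e (c * w) ≠ 1) (hM : 2 * (J * h) ≤ M)
    (hrec : ∀ k < J, ∀ a x, Q k a x = ∑ c ∈ range (q ^ h), prune l (Q (k + 1) (a + q ^ (k * h) * c) x))
    (hJ : ∀ a < q ^ (J * h), Equi e (J * h) a (Q J a)) :
    ∀ k ≤ J, ∑ x, gSq h Q k x ≤ ∑ x, gSq h Q J x := by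
  intro k hk
  induction hk using Nat.decreasingInduction with
  | self => exact le_rfl
  | of_succ k hk ih =>
    rw [← sum_zAvg (k * h + h)]
    exact (Finset.sum_le_sum fun x _ => g_low hq he hM hrec hJ hk x).trans ih

lemma eSum_step (hl : 0 < l)
    (hrec : ∀ k < J, ∀ a x, Q k a x = ∑ c ∈ range (q ^ h), prune l (Q (k + 1) (a + q ^ (k * h) * c) x))
    {k : ℕ} (hk1 : 1 ≤ k) (hk : k < J) (b : ℕ) (x : ZMod (q ^ M) × ZMod (q ^ M)) :
    ‖eSum h Q (k + 1) b x - eSum h Q k b x‖ ≤ gSq h Q (k + 1) x / l := by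
  have h1 : eSum h Q k b x = ∑ a ∈ range (q ^ ((k + 1) * h)) with a % q ^ h = b, prune l (Q (k + 1) a x) := by
    unfold eSum
    rw [Nat.succ_mul, pow_add, Finset.sum_filter, Finset.sum_filter, ← sum_range_split]
    refine Finset.sum_congr rfl fun a _ => ?_
    have hdv : q ^ h ∣ q ^ (k * h) := pow_dvd_pow _ (Nat.le_mul_of_pos_left _ hk1)
    have : ∀ c, (a + q ^ (k * h) * c) % q ^ h = a % q ^ h := by
      intro c
      obtain ⟨d, hd⟩ := hdv
      rw [hd, mul_assoc, Nat.add_mul_mod_self_left]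
    simp_rw [this]
    split_ifs with hab
    · exact hrec k hk a x
    · simp
  rw [h1]
  unfold eSum gSq
  rw [← Finset.sum_sub_distrib, Finset.sum_div]
  refine (norm_sum_le _ _).trans ((Finset.sum_le_sum fun a _ => norm_sub_prune_le hl _).trans ?_)
  exact Finset.sum_le_sum_of_subset_of_nonneg (Finset.filter_subset _ _) (fun _ _ _ => by positivity)

lemma g_high (hq : q.Prime) (hq2 : q ≠ 2) (hM : 2 * (J * h) ≤ M) (hl : 0 < l)
    (hrec : ∀ k < J, ∀ a x, Q k a x = ∑ c ∈ range (q ^ h), prune l (Q (k + 1) (a + q ^ (k * h) * c) x))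
    (hJ : ∀ a < q ^ (J * h), Equi e (J * h) a (Q J a)) {k : ℕ} (hk1 : 1 ≤ k) (hk : k < J) :
    ∑ x, (gSq h Q k x - zAvg (k * h + h) (gSq h Q k) x) ^ 2
      ≤ 2 * q ^ h * ((q ^ h * l) ^ 2 * ∑ x, gSq h Q k x) := by
  have hkJ : k * h ≤ J * h := Nat.mul_le_mul_right _ hk.le
  have h1 := high_lemma hq hq2 (n := k * h) (h := h) (Nat.le_mul_of_pos_left _ hk1) (by omega) (Q k)
    (Q_equi hq.pos hM hrec hJ k hk.le)
  refine h1.trans ?_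
  gcongr
  unfold gSq
  rw [Finset.sum_comm, Finset.mul_sum]
  refine Finset.sum_le_sum fun x _ => ?_
  rw [Finset.mul_sum]
  refine Finset.sum_le_sum fun a _ => ?_
  have h2 : ‖Q k a x‖ ≤ q ^ h * l := by
    rw [hrec k hk]
    refine (norm_sum_le _ _).trans ((Finset.sum_le_sum fun c _ => norm_prune_le' hl.le _).trans ?_)
    simp
  calc ‖Q k a x‖ ^ 4 = ‖Q k a x‖ ^ 2 * ‖Q k a x‖ ^ 2 := by ring
    _ ≤ _ := by gcongr

lemma g_inv (hq : 0 < q) (hM : 2 * (J * h) ≤ M)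
    (hrec : ∀ k < J, ∀ a x, Q k a x = ∑ c ∈ range (q ^ h), prune l (Q (k + 1) (a + q ^ (k * h) * c) x))
    (hJ : ∀ a < q ^ (J * h), Equi e (J * h) a (Q J a)) {k j : ℕ} (hkj : k ≤ j) (hj : j ≤ J)
    (x : ZMod (q ^ M) × ZMod (q ^ M)) {t : ZMod (q ^ M) × ZMod (q ^ M)} (ht : t ∈ zBall q M (k * h)) :
    gSq h Q j (x + t) = gSq h Q j x := by
  have hkJ : k * h ≤ j * h := Nat.mul_le_mul_right _ hkj
  have ht' : t ∈ zBall q M (j * h) := by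
    rw [mem_zBall] at ht ⊢
    exact ⟨(pow_dvd_pow _ (by omega)).trans ht.1, (pow_dvd_pow _ (by omega)).trans ht.2⟩
  unfold gSq
  refine Finset.sum_congr rfl fun a ha => ?_
  rw [(Q_equi hq hM hrec hJ j hj a (mem_range.mp ha)).ball_norm ht']

lemma zBall_neg {n : ℕ} {t : ZMod (q ^ M) × ZMod (q ^ M)} (ht : t ∈ zBall q M n) : -t ∈ zBall q M n := by
  rw [mem_zBall] at ht ⊢
  exact ⟨(dvd_neg).mpr ht.1, (dvd_neg).mpr ht.2⟩

lemma bil_sum (hq : q.Prime) (hq2 : q ≠ 2) (he : ∀ c : ZMod (q ^ M), c ≠ 0 → ∃ w, e (c * w) ≠ 1)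
    (hM : 2 * (J * h) ≤ M)
    (hrec : ∀ k < J, ∀ a x, Q k a x = ∑ c ∈ range (q ^ h), prune l (Q (k + 1) (a + q ^ (k * h) * c) x))
    (hJ : ∀ a < q ^ (J * h), Equi e (J * h) a (Q J a)) {k : ℕ} (hk1 : 1 ≤ k) (hk : k ≤ J)
    (Ω : Finset (ZMod (q ^ M) × ZMod (q ^ M)))
    (hΩ : ∀ x ∈ Ω, ∀ t ∈ zBall q M (k * h), x + t ∈ Ω) :
    ∑ x ∈ Ω, ∑ b ∈ range (q ^ h), ∑ b' ∈ range (q ^ h) with b ≠ b', (‖eSum h Q k b x‖ * ‖eSum h Q k b' x‖) ^ 2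
      ≤ q ^ h * ∑ x ∈ Ω, gSq h Q k x ^ 2 := by
  have hkJ : k * h ≤ J * h := Nat.mul_le_mul_right _ hk
  have hc : (0 : ℝ) < (zBall q M (k * h)).card := by exact_mod_cast (zBall_card_pos _)
  set H : ZMod (q ^ M) × ZMod (q ^ M) → ℝ := fun x =>
    ∑ b ∈ range (q ^ h), ∑ b' ∈ range (q ^ h) with b ≠ b', (‖eSum h Q k b x‖ * ‖eSum h Q k b' x‖) ^ 2 with hH
  have h1 : ∀ t ∈ zBall q M (k * h), ∑ x ∈ Ω, H (x + t) = ∑ x ∈ Ω, H x := by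
    intro t ht
    refine Finset.sum_bij' (fun x _ => x + t) (fun x _ => x + -t) ?_ ?_ ?_ ?_ ?_
    · exact fun x hx => hΩ x hx t ht
    · exact fun x hx => hΩ x hx _ (zBall_neg ht)
    · intros; simp
    · intros; simp
    · intros; rfl
  have h2 : ∀ x, ∑ t ∈ zBall q M (k * h), H (x + t) ≤ (zBall q M (k * h)).card * (q ^ h * gSq h Q k x ^ 2) := by
    intro x
    simp only [hH]
    rw [Finset.sum_comm]
    have h3 : ∀ b ∈ range (q ^ h), ∑ t ∈ zBall q M (k * h), ∑ b' ∈ range (q ^ h) with b ≠ b',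
        (‖eSum h Q k b (x + t)‖ * ‖eSum h Q k b' (x + t)‖) ^ 2
        ≤ ∑ b' ∈ range (q ^ h), (zBall q M (k * h)).card * (q ^ h *
          ((∑ a ∈ range (q ^ (k * h)) with a % q ^ h = b, ‖Q k a x‖ ^ 2) *
            (∑ a ∈ range (q ^ (k * h)) with a % q ^ h = b', ‖Q k a x‖ ^ 2))) := by
      intro b hb
      rw [Finset.sum_comm]
      refine le_trans ?_ (Finset.sum_le_sum_of_subset_of_nonneg (Finset.filter_subset (fun b' => b ≠ b') _)
        (fun _ _ _ => by positivity))
      refine Finset.sum_le_sum fun b' hb' => ?_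
      rw [mem_filter, mem_range] at hb'
      exact bil_lemma hq hq2 he (by omega) (Nat.le_mul_of_pos_left _ hk1) (Q k)
        (Q_equi hq.pos hM hrec hJ k hk) x (mem_range.mp hb) hb'.1 hb'.2
    refine (Finset.sum_le_sum h3).trans (le_of_eq ?_)
    simp_rw [← Finset.mul_sum]
    rw [← Finset.sum_mul]
    have hfib : ∑ b ∈ range (q ^ h), ∑ a ∈ range (q ^ (k * h)) with a % q ^ h = b, ‖Q k a x‖ ^ 2 = gSq h Q k x := by
      unfold gSq
      apply Finset.sum_fiberwise_of_maps_to
      intro a _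
      rw [mem_range]
      exact Nat.mod_lt _ (pow_pos hq.pos _)
    rw [hfib]
    ring
  have h4 : (zBall q M (k * h)).card * ∑ x ∈ Ω, H x ≤ (zBall q M (k * h)).card * (q ^ h * ∑ x ∈ Ω, gSq h Q k x ^ 2) := by
    calc (zBall q M (k * h)).card * ∑ x ∈ Ω, H x = ∑ t ∈ zBall q M (k * h), ∑ x ∈ Ω, H (x + t) := by
          rw [Finset.sum_congr rfl h1, Finset.sum_const, nsmul_eq_mul]
      _ = ∑ x ∈ Ω, ∑ t ∈ zBall q M (k * h), H (x + t) := Finset.sum_comm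
      _ ≤ ∑ x ∈ Ω, (zBall q M (k * h)).card * (q ^ h * gSq h Q k x ^ 2) := Finset.sum_le_sum fun x _ => h2 x
      _ = _ := by simp_rw [← Finset.mul_sum]
  exact le_of_mul_le_mul_left h4 hc

end FiniteLevel4

end PartD

section PartE
open Finset

section FiniteLevel5
variable {q M : ℕ} [NeZero (q ^ M)] {e : AddChar (ZMod (q ^ M)) ℂ}
variable {h J : ℕ} {l : ℝ} {Q : ℕ → ℕ → ZMod (q ^ M) × ZMod (q ^ M) → ℂ}

lemma one_add_inv_pow_le (J i : ℕ) (hJ : 1 ≤ J) (hi : i ≤ J) : (1 + 1 / (J : ℝ)) ^ i ≤ 3 := by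
  have hJ' : (0 : ℝ) < J := by exact_mod_cast hJ
  have h1 : 1 + 1 / (J : ℝ) ≤ Real.exp (1 / J) := by
    have := Real.add_one_le_exp (1 / (J : ℝ)); linarith
  calc (1 + 1 / (J : ℝ)) ^ i ≤ (1 + 1 / (J : ℝ)) ^ J :=
        pow_le_pow_right₀ (by have : 0 < 1 / (J : ℝ) := by positivity
                              linarith) hi
    _ ≤ (Real.exp (1 / J)) ^ J := by gcongr
    _ = Real.exp 1 := by rw [← Real.exp_nat_mul]; congr 1; field_simp
    _ ≤ 3 := by have := Real.exp_one_lt_d9; linarith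

lemma g_chain (hJ1 : 1 ≤ J) {S : ℝ} (hS : 0 < S) {k : ℕ} {x : ZMod (q ^ M) × ZMod (q ^ M)}
    (hgJ : gSq h Q J x ≤ S)
    (hlow : ∀ j, k < j → j < J → gSq h Q j x ≤ (1 + 1 / (J : ℝ)) * gSq h Q (j + 1) x) :
    ∀ j, k < j → j ≤ J → gSq h Q j x ≤ 3 * S := by
  have key : ∀ i, i ≤ J → k < J - i → gSq h Q (J - i) x ≤ (1 + 1 / (J : ℝ)) ^ i * S := by
    intro i
    induction i with
    | zero => intro _ _; simpa using hgJ
    | succ i ih =>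
      intro hi hk
      have h1 := hlow (J - (i + 1)) hk (by omega)
      have h2 := ih (by omega) (by omega)
      have h3 : J - (i + 1) + 1 = J - i := by omega
      rw [h3] at h1
      refine h1.trans ?_
      rw [pow_succ']
      rw [mul_assoc]
      gcongr
  intro j hj hjJ
  have h1 := key (J - j) (by omega) (by omega)
  rw [Nat.sub_sub_self hjJ] at h1
  refine h1.trans ?_
  gcongr
  exact one_add_inv_pow_le J _ hJ1 (by omega)

lemma e_chain (hl : 0 < l)
    (hrec : ∀ k < J, ∀ a x, Q k a x = ∑ c ∈ range (q ^ h), prune l (Q (k + 1) (a + q ^ (k * h) * c) x))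
    {S : ℝ} (hS : 0 < S) {x : ZMod (q ^ M) × ZMod (q ^ M)} (b : ℕ) {k : ℕ} (hk1 : 1 ≤ k) (hkJ : k ≤ J)
    (hg : ∀ j, k < j → j ≤ J → gSq h Q j x ≤ 3 * S) :
    ‖eSum h Q J b x - eSum h Q k b x‖ ≤ J * (3 * S / l) := by
  have key : ∀ i, i ≤ J → k ≤ J - i → ‖eSum h Q J b x - eSum h Q (J - i) b x‖ ≤ i * (3 * S / l) := by
    intro i
    induction i with
    | zero => simp
    | succ i ih =>
      intro hi hk
      have h2 := ih (by omega) (by omega)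
      have h3 : J - (i + 1) + 1 = J - i := by omega
      have h1 := eSum_step hl hrec (k := J - (i + 1)) (by omega) (by omega) b x
      rw [h3] at h1
      have h4 : gSq h Q (J - i) x / l ≤ 3 * S / l := by
        gcongr
        exact hg _ (by omega) (by omega)
      have h5 := norm_sub_le_norm_sub_add_norm_sub (eSum h Q J b x) (eSum h Q (J - i) b x) (eSum h Q (J - (i + 1)) b x)
      push_cast
      linarith
  have h1 := key (J - k) (by omega) (by omega)
  rw [Nat.sub_sub_self hkJ] at h1
  refine h1.trans ?_
  gcongr
  omega

lemma pair_lower {α C₀ L A A' B B' d : ℝ} (hα : 0 < α) (hC₀ : 1 ≤ C₀) (hL : 1 ≤ L) (hA : A ≤ L * α) (hA' : A' ≤ L * α)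
    (hA0 : 0 ≤ A) (hA0' : 0 ≤ A') (hAA : (α / C₀) ^ 2 ≤ A * A') (hd : d = α / (8 * C₀ ^ 2 * L)) (hB : A - d ≤ B)
    (hB' : A' - d ≤ B') : α ^ 2 / (2 * C₀ ^ 2) ≤ B * B' := by
  have hd0 : 0 < d := by rw [hd]; positivity
  have hdL : d * (L * α) = (α / C₀) ^ 2 / 8 := by rw [hd]; field_simp
  have h1 : d ≤ A := by
    by_contra hcon
    push Not at hcon
    have : A * A' ≤ d * (L * α) := by gcongr
    have h3 : 0 < (α / C₀) ^ 2 := by positivity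
    linarith
  have h2 : d ≤ A' := by
    by_contra hcon
    push Not at hcon
    have : A * A' ≤ (L * α) * d := by gcongr
    have h3 : 0 < (α / C₀) ^ 2 := by positivity
    linarith
  have h3 : (A - d) * (A' - d) ≤ B * B' := by
    apply mul_le_mul hB hB' (by linarith) (by linarith)
  have h4 : α ^ 2 / (2 * C₀ ^ 2) = (α / C₀) ^ 2 / 2 := by field_simp
  rw [h4]
  have h5 : d * A ≤ d * (L * α) := by gcongr
  have h6 : d * A' ≤ d * (L * α) := by gcongr
  have h7 : 0 < (α / C₀) ^ 2 := by positivity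
  nlinarith [sq_nonneg d]

theorem finite_level_aux (hq : q.Prime) (hq2 : q ≠ 2)
    (he : ∀ c : ZMod (q ^ M), c ≠ 0 → ∃ w, e (c * w) ≠ 1)
    (hM : 2 * (J * h) ≤ M) (hJ1 : 1 ≤ J) {S α C₀ L : ℝ} (hS : 0 < S) (hα : 0 < α) (hC₀ : 1 ≤ C₀) (hL : 1 ≤ L)
    (hl : l = 24 * C₀ ^ 2 * L * J * S / α)
    (hrec : ∀ k < J, ∀ a x, Q k a x = ∑ c ∈ range (q ^ h), prune l (Q (k + 1) (a + q ^ (k * h) * c) x))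
    (hJ : ∀ a < q ^ (J * h), Equi e (J * h) a (Q J a))
    (hgJ : ∀ x, gSq h Q J x ≤ S)
    (U : Finset (ZMod (q ^ M) × ZMod (q ^ M)))
    (hU : ∀ x ∈ U, (∃ b < q ^ h, ∃ b' < q ^ h, b ≠ b' ∧ (α / C₀) ^ 2 ≤ ‖eSum h Q J b x‖ * ‖eSum h Q J b' x‖) ∧
      ∀ b < q ^ h, ‖eSum h Q J b x‖ ≤ L * α) :
    α ^ 6 * U.card ≤ 20000 * C₀ ^ 8 * J ^ 5 * L ^ 2 * q ^ (4 * h) * S ^ 2 * ∑ x, gSq h Q J x := by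
  classical
  have hJ' : (1 : ℝ) ≤ J := by exact_mod_cast hJ1
  have hJ0 : (0 : ℝ) < J := by linarith
  have hl0 : 0 < l := by rw [hl]; positivity
  set W := ∑ x, gSq h Q J x with hW
  have hW0 : 0 ≤ W := Finset.sum_nonneg fun x _ => gSq_nonneg _ _ _ _
  -- lower bound for the pruned pairs
  have hpair : ∀ x ∈ U, ∀ k, 1 ≤ k → k ≤ J →
      (∀ j, k < j → j < J → gSq h Q j x ≤ (1 + 1 / (J : ℝ)) * gSq h Q (j + 1) x) →
      ∃ b < q ^ h, ∃ b' < q ^ h, b ≠ b' ∧ α ^ 2 / (2 * C₀ ^ 2) ≤ ‖eSum h Q k b x‖ * ‖eSum h Q k b' x‖ := by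
    intro x hx k hk1 hkJ hlow
    obtain ⟨⟨b, hb, b', hb', hbb, hp⟩, hup⟩ := hU x hx
    have hg := g_chain hJ1 hS (hgJ x) hlow
    have hd : J * (3 * S / l) = α / (8 * C₀ ^ 2 * L) := by
      rw [hl]; field_simp; norm_num
    have h1 := e_chain hl0 hrec hS b hk1 hkJ hg
    have h2 := e_chain hl0 hrec hS b' hk1 hkJ hg
    refine ⟨b, hb, b', hb', hbb, pair_lower hα hC₀ hL (hup b hb) (hup b' hb') (norm_nonneg _) (norm_nonneg _) hp hd ?_ ?_⟩
    · have := norm_sub_norm_le (eSum h Q J b x) (eSum h Q k b x); linarith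
    · have := norm_sub_norm_le (eSum h Q J b' x) (eSum h Q k b' x); linarith
  let Low : ℕ → ZMod (q ^ M) × ZMod (q ^ M) → Prop := fun k x =>
    gSq h Q k x ≤ (1 + 1 / (J : ℝ)) * gSq h Q (k + 1) x
  let Ω : ℕ → Finset (ZMod (q ^ M) × ZMod (q ^ M)) := fun k =>
    Finset.univ.filter (fun x => ¬ Low k x ∧ ∀ j, k < j → j < J → Low j x)
  let U0 := U.filter (fun x => ∀ j, 0 < j → j < J → Low j x)
  let Uk : ℕ → Finset (ZMod (q ^ M) × ZMod (q ^ M)) := fun k => U.filter (fun x => x ∈ Ω k)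
  have hcover : U ⊆ U0 ∪ (Finset.Ico 1 J).biUnion Uk := by
    intro x hx
    rw [mem_union]
    by_cases hlow : ∀ j, 0 < j → j < J → Low j x
    · left; exact mem_filter.mpr ⟨hx, hlow⟩
    · right
      push Not at hlow
      obtain ⟨j0, hj0, hj0J, hnl⟩ := hlow
      set T := (Finset.Ico 1 J).filter (fun j => ¬ Low j x) with hT
      have hTne : T.Nonempty := ⟨j0, by rw [hT, mem_filter, mem_Ico]; exact ⟨⟨hj0, hj0J⟩, hnl⟩⟩
      have hmax := T.max'_mem hTne
      set k := T.max' hTne with hk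
      rw [hT, mem_filter] at hmax
      rw [mem_biUnion]
      refine ⟨k, hmax.1, mem_filter.mpr ⟨hx, mem_filter.mpr ⟨mem_univ _, hmax.2, ?_⟩⟩⟩
      intro j hkj hjJ
      by_contra hcon
      have : j ∈ T := by
        rw [hT, mem_filter, mem_Ico]
        exact ⟨⟨by omega, hjJ⟩, hcon⟩
      have := T.le_max' j this
      omega
  -- the low part
  have hU0 : α ^ 6 * (U0.card : ℝ) ≤ 72 * C₀ ^ 6 * (S ^ 2 * W) := by
    have h1 : ∀ x ∈ U0, (α ^ 2 / (2 * C₀ ^ 2)) ^ 3 ≤ 9 * S ^ 2 * gSq h Q 1 x := by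
      intro x hx
      have hx' := mem_filter.mp hx
      obtain ⟨b, hb, b', hb', hbb, hp⟩ := hpair x hx'.1 1 le_rfl hJ1
        (fun j hj hjJ => hx'.2 j (by omega) hjJ)
      have hg : gSq h Q 1 x ≤ 3 * S :=
        g_chain (k := 0) hJ1 hS (hgJ x) hx'.2 1 (by omega) hJ1
      have hg0 := gSq_nonneg h Q 1 x
      have he1 : ∀ c < q ^ h, ‖eSum h Q 1 c x‖ ^ 2 ≤ gSq h Q 1 x := by
        intro c hc
        have : eSum h Q 1 c x = Q 1 c x := by
          unfold eSum
          rw [one_mul, Finset.sum_filter]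
          rw [Finset.sum_eq_single c]
          · rw [if_pos (Nat.mod_eq_of_lt hc)]
          · intro a ha hac
            rw [if_neg]
            rw [Nat.mod_eq_of_lt (mem_range.mp ha)]; exact hac
          · intro hcn; exact absurd (mem_range.mpr hc) hcn
        rw [this]
        unfold gSq
        rw [one_mul]
        exact Finset.single_le_sum (f := fun a => ‖Q 1 a x‖ ^ 2) (fun _ _ => by positivity) (mem_range.mpr hc)
      have hp2 : α ^ 2 / (2 * C₀ ^ 2) ≤ gSq h Q 1 x := by
        have := he1 b hb
        have := he1 b' hb'
        nlinarith [sq_nonneg (‖eSum h Q 1 b x‖ - ‖eSum h Q 1 b' x‖)]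
      calc (α ^ 2 / (2 * C₀ ^ 2)) ^ 3 ≤ (gSq h Q 1 x) ^ 3 := by gcongr
        _ = (gSq h Q 1 x) ^ 2 * gSq h Q 1 x := by ring
        _ ≤ (3 * S) ^ 2 * gSq h Q 1 x := by gcongr
        _ = _ := by ring
    have h2 : (U0.card : ℝ) * (α ^ 2 / (2 * C₀ ^ 2)) ^ 3 ≤ 9 * S ^ 2 * W := by
      calc (U0.card : ℝ) * (α ^ 2 / (2 * C₀ ^ 2)) ^ 3 = ∑ x ∈ U0, (α ^ 2 / (2 * C₀ ^ 2)) ^ 3 := by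
            rw [Finset.sum_const, nsmul_eq_mul]
        _ ≤ ∑ x ∈ U0, 9 * S ^ 2 * gSq h Q 1 x := Finset.sum_le_sum h1
        _ ≤ ∑ x, 9 * S ^ 2 * gSq h Q 1 x := Finset.sum_le_sum_of_subset_of_nonneg (Finset.subset_univ _)
            (fun x _ _ => mul_nonneg (by positivity) (gSq_nonneg _ _ _ _))
        _ = 9 * S ^ 2 * ∑ x, gSq h Q 1 x := by rw [Finset.mul_sum]
        _ ≤ 9 * S ^ 2 * W := by
            gcongr
            exact sum_g_le hq.pos he hM hrec hJ 1 hJ1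
    have h3 : α ^ 6 * (U0.card : ℝ) = 8 * C₀ ^ 6 * ((U0.card : ℝ) * (α ^ 2 / (2 * C₀ ^ 2)) ^ 3) := by
      field_simp; norm_num
    rw [h3]
    calc 8 * C₀ ^ 6 * ((U0.card : ℝ) * (α ^ 2 / (2 * C₀ ^ 2)) ^ 3) ≤ 8 * C₀ ^ 6 * (9 * S ^ 2 * W) := by gcongr
      _ = _ := by ring
  -- the high parts
  have hUk : ∀ k ∈ Finset.Ico 1 J, α ^ 6 * ((Uk k).card : ℝ)
      ≤ 4608 * C₀ ^ 8 * (J + 1) ^ 2 * J ^ 2 * L ^ 2 * q ^ (4 * h) * (S ^ 2 * W) := by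
    intro k hk
    rw [mem_Ico] at hk
    have h1 : ∀ x ∈ Uk k, (α ^ 2 / (2 * C₀ ^ 2)) ^ 2 ≤ ∑ b ∈ range (q ^ h), ∑ b' ∈ range (q ^ h) with b ≠ b',
        (‖eSum h Q k b x‖ * ‖eSum h Q k b' x‖) ^ 2 := by
      intro x hx
      have hx' := mem_filter.mp hx
      have hxΩ := (mem_filter.mp hx'.2).2
      obtain ⟨b, hb, b', hb', hbb, hp⟩ := hpair x hx'.1 k hk.1 hk.2.le hxΩ.2
      calc (α ^ 2 / (2 * C₀ ^ 2)) ^ 2 ≤ (‖eSum h Q k b x‖ * ‖eSum h Q k b' x‖) ^ 2 := by gcongr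
        _ ≤ ∑ b' ∈ range (q ^ h) with b ≠ b', (‖eSum h Q k b x‖ * ‖eSum h Q k b' x‖) ^ 2 :=
          Finset.single_le_sum (f := fun b' => (‖eSum h Q k b x‖ * ‖eSum h Q k b' x‖) ^ 2)
            (fun _ _ => by positivity) (mem_filter.mpr ⟨mem_range.mpr hb', hbb⟩)
        _ ≤ _ := Finset.single_le_sum (f := fun b => ∑ b' ∈ range (q ^ h) with b ≠ b',
            (‖eSum h Q k b x‖ * ‖eSum h Q k b' x‖) ^ 2)
            (fun _ _ => by positivity) (mem_range.mpr hb)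
    have hΩinv : ∀ x ∈ Ω k, ∀ t ∈ zBall q M (k * h), x + t ∈ Ω k := by
      intro x hx t ht
      have hxΩ := (mem_filter.mp hx).2
      have hinv : ∀ j, k ≤ j → j < J → (Low j (x + t) ↔ Low j x) := by
        intro j hkj hjJ
        show gSq h Q j (x + t) ≤ (1 + 1 / (J : ℝ)) * gSq h Q (j + 1) (x + t) ↔ _
        rw [g_inv hq.pos hM hrec hJ hkj hjJ.le x ht, g_inv hq.pos hM hrec hJ (by omega : k ≤ j + 1) hjJ x ht]
      refine mem_filter.mpr ⟨mem_univ _, ?_, ?_⟩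
      · rw [hinv k le_rfl hk.2]; exact hxΩ.1
      · intro j hkj hjJ
        rw [hinv j hkj.le hjJ]; exact hxΩ.2 j hkj hjJ
    have h2 : ∀ x ∈ Ω k, gSq h Q k x ^ 2 ≤ (J + 1) ^ 2 * (gSq h Q k x - zAvg (k * h + h) (gSq h Q k) x) ^ 2 := by
      intro x hx
      have hxΩ := (mem_filter.mp hx).2.1
      have hxl : (1 + 1 / (J : ℝ)) * gSq h Q (k + 1) x < gSq h Q k x := not_le.mp hxΩ
      have hav := g_low hq.pos he hM hrec hJ hk.2 x
      have hg0 := gSq_nonneg h Q k x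
      set A := zAvg (k * h + h) (gSq h Q k) x
      set g := gSq h Q k x
      have h3 : (1 + 1 / (J : ℝ)) * A ≤ g := by
        have : (1 + 1 / (J : ℝ)) * A ≤ (1 + 1 / (J : ℝ)) * gSq h Q (k + 1) x := by gcongr
        linarith
      have h4 : (J + 1) * A ≤ J * g := by
        have := mul_le_mul_of_nonneg_left h3 hJ0.le
        have h5 : J * ((1 + 1 / (J : ℝ)) * A) = (J + 1) * A := by field_simp
        linarith
      have h5 : g ≤ (J + 1) * (g - A) := by linarith
      calc g ^ 2 ≤ ((J + 1) * (g - A)) ^ 2 := by gcongr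
        _ = _ := by ring
    have h3 : ((Uk k).card : ℝ) * (α ^ 2 / (2 * C₀ ^ 2)) ^ 2
        ≤ q ^ h * ((J + 1) ^ 2 * (2 * q ^ h * ((q ^ h * l) ^ 2 * W))) := by
      calc ((Uk k).card : ℝ) * (α ^ 2 / (2 * C₀ ^ 2)) ^ 2 = ∑ x ∈ Uk k, (α ^ 2 / (2 * C₀ ^ 2)) ^ 2 := by
            rw [Finset.sum_const, nsmul_eq_mul]
        _ ≤ ∑ x ∈ Uk k, ∑ b ∈ range (q ^ h), ∑ b' ∈ range (q ^ h) with b ≠ b',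
              (‖eSum h Q k b x‖ * ‖eSum h Q k b' x‖) ^ 2 := Finset.sum_le_sum h1
        _ ≤ ∑ x ∈ Ω k, ∑ b ∈ range (q ^ h), ∑ b' ∈ range (q ^ h) with b ≠ b',
              (‖eSum h Q k b x‖ * ‖eSum h Q k b' x‖) ^ 2 :=
            Finset.sum_le_sum_of_subset_of_nonneg (fun x hx => (mem_filter.mp hx).2)
              (fun _ _ _ => by positivity)
        _ ≤ q ^ h * ∑ x ∈ Ω k, gSq h Q k x ^ 2 := bil_sum hq hq2 he hM hrec hJ hk.1 hk.2.le (Ω k) hΩinv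
        _ ≤ q ^ h * ∑ x ∈ Ω k, (J + 1) ^ 2 * (gSq h Q k x - zAvg (k * h + h) (gSq h Q k) x) ^ 2 := by
            gcongr with x hx
            exact h2 x hx
        _ ≤ q ^ h * ∑ x, (J + 1) ^ 2 * (gSq h Q k x - zAvg (k * h + h) (gSq h Q k) x) ^ 2 := by
            gcongr
            exact Finset.subset_univ _
        _ = q ^ h * ((J + 1) ^ 2 * ∑ x, (gSq h Q k x - zAvg (k * h + h) (gSq h Q k) x) ^ 2) := by
            simp_rw [← Finset.mul_sum]
        _ ≤ q ^ h * ((J + 1) ^ 2 * (2 * q ^ h * ((q ^ h * l) ^ 2 * ∑ x, gSq h Q k x))) := by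
            gcongr
            exact g_high hq hq2 hM hl0 hrec hJ hk.1 hk.2
        _ ≤ _ := by
            gcongr
            exact sum_g_le hq.pos he hM hrec hJ k hk.2.le
    have h4 : α ^ 6 * ((Uk k).card : ℝ) = 4 * C₀ ^ 4 * α ^ 2 * (((Uk k).card : ℝ) * (α ^ 2 / (2 * C₀ ^ 2)) ^ 2) := by
      field_simp; norm_num
    rw [h4]
    calc 4 * C₀ ^ 4 * α ^ 2 * (((Uk k).card : ℝ) * (α ^ 2 / (2 * C₀ ^ 2)) ^ 2)
        ≤ 4 * C₀ ^ 4 * α ^ 2 * (q ^ h * ((J + 1) ^ 2 * (2 * q ^ h * ((q ^ h * l) ^ 2 * W)))) := by gcongr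
      _ = _ := by
        rw [hl, show 4 * h = h * 4 by ring, pow_mul]
        field_simp
        ring
  have hcard : (U.card : ℝ) ≤ U0.card + ∑ k ∈ Finset.Ico 1 J, ((Uk k).card : ℝ) := by
    have h1 := (Finset.card_le_card hcover).trans ((Finset.card_union_le _ _).trans
      (Nat.add_le_add_left Finset.card_biUnion_le _))
    exact_mod_cast h1
  have hsum : ∑ k ∈ Finset.Ico 1 J, α ^ 6 * ((Uk k).card : ℝ)
      ≤ J * (4608 * C₀ ^ 8 * (J + 1) ^ 2 * J ^ 2 * L ^ 2 * q ^ (4 * h) * (S ^ 2 * W)) := by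
    refine (Finset.sum_le_sum hUk).trans ?_
    rw [Finset.sum_const, nsmul_eq_mul, Nat.card_Ico]
    gcongr
    omega
  have hq1 : (1 : ℝ) ≤ q ^ (4 * h) := one_le_pow₀ (by exact_mod_cast hq.one_lt.le)
  have hSW : 0 ≤ S ^ 2 * W := by positivity
  calc α ^ 6 * (U.card : ℝ) ≤ α ^ 6 * (U0.card + ∑ k ∈ Finset.Ico 1 J, ((Uk k).card : ℝ)) := by gcongr
    _ = α ^ 6 * (U0.card : ℝ) + ∑ k ∈ Finset.Ico 1 J, α ^ 6 * ((Uk k).card : ℝ) := by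
        rw [mul_add, Finset.mul_sum]
    _ ≤ 72 * C₀ ^ 6 * (S ^ 2 * W) + J * (4608 * C₀ ^ 8 * (J + 1) ^ 2 * J ^ 2 * L ^ 2 * q ^ (4 * h) * (S ^ 2 * W)) :=
        add_le_add hU0 hsum
    _ ≤ 72 * (C₀ ^ 8 * J ^ 5 * L ^ 2 * q ^ (4 * h)) * (S ^ 2 * W)
        + J * (4608 * C₀ ^ 8 * (J + J) ^ 2 * J ^ 2 * L ^ 2 * q ^ (4 * h) * (S ^ 2 * W)) := by
        have hc : C₀ ^ 6 ≤ C₀ ^ 8 * J ^ 5 * L ^ 2 * q ^ (4 * h) := by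
          calc C₀ ^ 6 = C₀ ^ 6 * 1 * 1 * 1 := by ring
            _ ≤ C₀ ^ 8 * J ^ 5 * L ^ 2 * q ^ (4 * h) := by
              gcongr
              · norm_num
              · exact one_le_pow₀ hJ'
              · exact one_le_pow₀ hL
        gcongr
    _ = 18504 * (C₀ ^ 8 * J ^ 5 * L ^ 2 * q ^ (4 * h) * S ^ 2 * W) := by ring
    _ ≤ 20000 * (C₀ ^ 8 * J ^ 5 * L ^ 2 * q ^ (4 * h) * S ^ 2 * W) := by
        gcongr
        norm_num
    _ = _ := by ring

/-- the pruned functions, indexed by `i = J - k` -/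
noncomputable def prunedRec (q M h J : ℕ) (l : ℝ) (F : ℕ → ZMod (q ^ M) × ZMod (q ^ M) → ℂ) :
    ℕ → ℕ → ZMod (q ^ M) × ZMod (q ^ M) → ℂ
  | 0 => F
  | i + 1 => fun a x => ∑ c ∈ range (q ^ h), prune l (prunedRec q M h J l F i (a + q ^ ((J - (i + 1)) * h) * c) x)

theorem finite_level (hq : q.Prime) (hq2 : q ≠ 2)
    (he : ∀ c : ZMod (q ^ M), c ≠ 0 → ∃ w, e (c * w) ≠ 1)
    (hM : 2 * (J * h) ≤ M) (hJ1 : 1 ≤ J) {S α C₀ L : ℝ} (hS : 0 < S) (hα : 0 < α) (hC₀ : 1 ≤ C₀) (hL : 1 ≤ L)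
    (F : ℕ → ZMod (q ^ M) × ZMod (q ^ M) → ℂ)
    (hF : ∀ a < q ^ (J * h), Equi e (J * h) a (F a))
    (hFS : ∀ x, ∑ a ∈ range (q ^ (J * h)), ‖F a x‖ ^ 2 ≤ S)
    (U : Finset (ZMod (q ^ M) × ZMod (q ^ M)))
    (hU : ∀ x ∈ U, (∃ b < q ^ h, ∃ b' < q ^ h, b ≠ b' ∧ (α / C₀) ^ 2 ≤
        ‖∑ a ∈ range (q ^ (J * h)) with a % q ^ h = b, F a x‖ *
        ‖∑ a ∈ range (q ^ (J * h)) with a % q ^ h = b', F a x‖) ∧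
      ∀ b < q ^ h, ‖∑ a ∈ range (q ^ (J * h)) with a % q ^ h = b, F a x‖ ≤ L * α) :
    α ^ 6 * U.card ≤ 20000 * C₀ ^ 8 * J ^ 5 * L ^ 2 * q ^ (4 * h) * S ^ 2 *
      ∑ x, ∑ a ∈ range (q ^ (J * h)), ‖F a x‖ ^ 2 := by
  set l : ℝ := 24 * C₀ ^ 2 * L * J * S / α with hl
  set Q : ℕ → ℕ → ZMod (q ^ M) × ZMod (q ^ M) → ℂ := fun k => prunedRec q M h J l F (J - k) with hQ
  have hQJ : Q J = F := by simp only [hQ, Nat.sub_self]; rfl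
  have hrec : ∀ k < J, ∀ a x, Q k a x = ∑ c ∈ range (q ^ h), prune l (Q (k + 1) (a + q ^ (k * h) * c) x) := by
    intro k hk a x
    simp only [hQ]
    have h1 : J - k = (J - (k + 1)) + 1 := by omega
    rw [h1]
    simp only [prunedRec]
    have h2 : J - (J - (k + 1) + 1) = k := by omega
    rw [h2]
  have hg : ∀ x, gSq h Q J x = ∑ a ∈ range (q ^ (J * h)), ‖F a x‖ ^ 2 := by
    intro x; unfold gSq; rw [hQJ]
  have hE : ∀ b x, eSum h Q J b x = ∑ a ∈ range (q ^ (J * h)) with a % q ^ h = b, F a x := by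
    intro b x; unfold eSum; rw [hQJ]
  have := finite_level_aux hq hq2 he hM hJ1 hS hα hC₀ hL hl hrec (by rw [hQJ]; exact hF)
    (fun x => by rw [hg]; exact hFS x) U (fun x hx => by simp only [hE]; exact hU x hx)
  simp only [hg] at this
  exact this

end FiniteLevel5

end PartE

section PartG

section PadicPart
variable {q : ℕ} [Fact q.Prime]

lemma qp_norm_add_le {x y : ℚ_[q]} {c : ℝ} (hx : ‖x‖ ≤ c) (hy : ‖y‖ ≤ c) : ‖x + y‖ ≤ c :=
  (IsUltrametricDist.norm_add_le_max x y).trans (max_le hx hy)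

lemma qp_norm_sub_le {x y : ℚ_[q]} {c : ℝ} (hx : ‖x‖ ≤ c) (hy : ‖y‖ ≤ c) : ‖x - y‖ ≤ c := by
  rw [sub_eq_add_neg]
  exact qp_norm_add_le hx (by rwa [norm_neg])

lemma qp_norm_nat (a : ℕ) : ‖(a : ℚ_[q])‖ ≤ 1 := by
  simpa using Padic.norm_int_le_one (p := q) (a : ℤ)

lemma qp_one_lt : (1 : ℝ) < q := by exact_mod_cast (Fact.out : q.Prime).one_lt

lemma qp_pos : (0 : ℝ) < q := zero_lt_one.trans qp_one_lt

lemma qp_zpow_le_one (n : ℕ) : (q : ℝ) ^ (-(n : ℤ)) ≤ 1 :=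
  zpow_le_one_of_nonpos₀ qp_one_lt.le (by omega)

lemma lc_of_shift {E Y : Type*} [SeminormedAddCommGroup E] (φ : E → Y) (δ : ℝ) (hδ : 0 < δ)
    (h : ∀ x t, ‖t‖ ≤ δ → φ (x + t) = φ x) : IsLocallyConstant φ := by
  rw [IsLocallyConstant.iff_eventually_eq]
  intro x
  filter_upwards [Metric.closedBall_mem_nhds x hδ] with y hy
  have := h x (y - x) (by simpa [dist_eq_norm] using hy)
  simpa using this

variable {χ : ℚ_[q] → ℂ}

lemma chi_shift (hχ_mul : ∀ x y : ℚ_[q], χ (x + y) = χ x * χ y)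
    (hχ_triv : ∀ x : ℚ_[q], ‖x‖ ≤ 1 → χ x = 1) {x y : ℚ_[q]} (h : ‖x - y‖ ≤ 1) : χ x = χ y := by
  have := hχ_mul (x - y) y
  rw [sub_add_cancel, hχ_triv _ h, one_mul] at this
  exact this

lemma chi_lc (hχ_mul : ∀ x y : ℚ_[q], χ (x + y) = χ x * χ y)
    (hχ_triv : ∀ x : ℚ_[q], ‖x‖ ≤ 1 → χ x = 1) : IsLocallyConstant χ :=
  lc_of_shift χ 1 one_pos (fun x t ht => chi_shift hχ_mul hχ_triv (by simpa using ht))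

variable {μ : Measure ℚ_[q]} [μ.IsAddHaarMeasure] [SigmaFinite μ] {f : ℚ_[q] × ℚ_[q] → ℂ}

lemma qp_norm_mul_le_one {x y : ℚ_[q]} {N : ℤ} (hx : ‖x‖ ≤ (q : ℝ) ^ (-N)) (hy : ‖y‖ ≤ (q : ℝ) ^ N) :
    ‖x * y‖ ≤ 1 := by
  rw [norm_mul]
  calc ‖x‖ * ‖y‖ ≤ (q : ℝ) ^ (-N) * (q : ℝ) ^ N := by gcongr
    _ = 1 := by rw [zpow_neg, inv_mul_cancel₀ (zpow_ne_zero _ qp_pos.ne')]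

/-- the Fourier transform is invariant under small shifts -/
lemma fourier_shift (hχ_mul : ∀ x y : ℚ_[q], χ (x + y) = χ x * χ y)
    (hχ_triv : ∀ x : ℚ_[q], ‖x‖ ≤ 1 → χ x = 1) (hf : HasCompactSupport f) :
    ∃ M₀ : ℕ, ∀ p k : ℚ_[q] × ℚ_[q], ‖k.1‖ ≤ (q : ℝ) ^ (-(M₀ : ℤ)) → ‖k.2‖ ≤ (q : ℝ) ^ (-(M₀ : ℤ)) →
      qpFourier q μ χ f (p + k) = qpFourier q μ χ f p := by
  obtain ⟨B, hB⟩ := hf.isBounded.exists_norm_le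
  obtain ⟨M₀, hM₀⟩ := pow_unbounded_of_one_lt B (qp_one_lt (q := q))
  refine ⟨M₀, fun p k h1 h2 => ?_⟩
  unfold qpFourier
  congr 1
  ext x
  by_cases hx : f x = 0
  · simp [hx]
  · have hx' : ‖x‖ ≤ (q : ℝ) ^ (M₀ : ℤ) := by
      rw [zpow_natCast]
      exact (hB x (subset_tsupport f hx)).trans hM₀.le
    have hx1 := (norm_fst_le x).trans hx'
    have hx2 := (norm_snd_le x).trans hx'
    congr 1
    apply chi_shift hχ_mul hχ_triv
    have : -((p + k).1 * x.1 + (p + k).2 * x.2) - -(p.1 * x.1 + p.2 * x.2) = -(k.1 * x.1 + k.2 * x.2) := by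
      simp only [Prod.fst_add, Prod.snd_add]; ring
    rw [this, norm_neg]
    exact qp_norm_add_le (qp_norm_mul_le_one h1 hx1) (qp_norm_mul_le_one h2 hx2)

lemma fourier_lc (hχ_mul : ∀ x y : ℚ_[q], χ (x + y) = χ x * χ y)
    (hχ_triv : ∀ x : ℚ_[q], ‖x‖ ≤ 1 → χ x = 1) (hf : HasCompactSupport f) :
    IsLocallyConstant (qpFourier q μ χ f) := by
  obtain ⟨M₀, h⟩ := fourier_shift (μ := μ) hχ_mul hχ_triv hf
  exact lc_of_shift _ ((q : ℝ) ^ (-(M₀ : ℤ))) (zpow_pos qp_pos _)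
    (fun x t ht => h x t ((norm_fst_le t).trans ht) ((norm_snd_le t).trans ht))

/-- the Fourier support hypothesis -/
def FSupp (q : ℕ) [Fact q.Prime] (μ : Measure ℚ_[q]) [SigmaFinite μ] (χ : ℚ_[q] → ℂ)
    (f : ℚ_[q] × ℚ_[q] → ℂ) (n : ℕ) : Prop :=
  ∀ p : ℚ_[q] × ℚ_[q], ¬ (‖p.1‖ ≤ 1 ∧ ‖p.2 - p.1 ^ 2‖ ≤ (q : ℝ) ^ (-((2 * n : ℕ) : ℤ))) →
        qpFourier q μ χ f p = 0

lemma fourier_int (hχ_mul : ∀ x y : ℚ_[q], χ (x + y) = χ x * χ y)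
    (hχ_triv : ∀ x : ℚ_[q], ‖x‖ ≤ 1 → χ x = 1) (hf : HasCompactSupport f) {n : ℕ}
    (hs : FSupp q μ χ f n) (x : ℚ_[q] × ℚ_[q]) :
    Integrable (fun ξη : ℚ_[q] × ℚ_[q] => qpFourier q μ χ f ξη * χ (ξη.1 * x.1 + ξη.2 * x.2)) (μ.prod μ) := by
  apply Continuous.integrable_of_hasCompactSupport
  · have h1 := (fourier_lc (μ := μ) hχ_mul hχ_triv hf).continuous
    have h2 := (chi_lc hχ_mul hχ_triv).continuous
    fun_prop
  · apply HasCompactSupport.mul_right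
    refine HasCompactSupport.of_support_subset_isCompact
      (isCompact_closedBall (0 : ℚ_[q] × ℚ_[q]) 1) ?_
    intro p hp
    have := not_imp_comm.mp (hs p) hp
    rw [mem_closedBall_zero_iff, Prod.norm_def]
    refine max_le this.1 ?_
    have h2 : p.2 = (p.2 - p.1 ^ 2) + p.1 ^ 2 := by ring
    rw [h2]
    refine qp_norm_add_le (this.2.trans (qp_zpow_le_one _)) ?_
    rw [norm_pow]
    exact pow_le_one₀ (norm_nonneg _) this.1

lemma itv_measurable (n a : ℕ) : MeasurableSet (qpItv q n a) := by
  have : qpItv q n a = Metric.closedBall (a : ℚ_[q]) ((q : ℝ) ^ (-(n : ℤ))) := by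
    ext x; simp [qpItv, dist_eq_norm]
  rw [this]
  exact measurableSet_closedBall

lemma strip_measurable (n a : ℕ) :
    MeasurableSet (qpItv q n a ×ˢ (Set.univ : Set ℚ_[q])) :=
  (itv_measurable n a).prod MeasurableSet.univ

/-- equivariance of the wave packets -/
lemma proj_equi (hχ_mul : ∀ x y : ℚ_[q], χ (x + y) = χ x * χ y)
    (hχ_triv : ∀ x : ℚ_[q], ‖x‖ ≤ 1 → χ x = 1) {n : ℕ}
    (hs : FSupp q μ χ f n) (a : ℕ) (x t : ℚ_[q] × ℚ_[q])
    (h1 : ‖t.1 + 2 * a * t.2‖ ≤ (q : ℝ) ^ (n : ℤ)) (h2 : ‖t.2‖ ≤ (q : ℝ) ^ ((2 * n : ℕ) : ℤ)) :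
    qpProj q μ χ f (qpItv q n a) (x + t) =
      χ (a * t.1 + a ^ 2 * t.2) * qpProj q μ χ f (qpItv q n a) x := by
  unfold qpProj
  rw [← integral_const_mul]
  apply setIntegral_congr_fun (strip_measurable n a)
  rintro ⟨ξ, η⟩ ⟨hξ, -⟩
  simp only [qpItv, Set.mem_ofPred_eq] at hξ
  dsimp only
  by_cases hp : qpFourier q μ χ f (ξ, η) = 0
  · rw [hp]; simp
  have hs' := not_imp_comm.mp (hs (ξ, η)) hp
  dsimp only at hs'
  have key : χ (ξ * (x + t).1 + η * (x + t).2) = χ (a * t.1 + a ^ 2 * t.2) * χ (ξ * x.1 + η * x.2) := by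
    rw [← hχ_mul]
    apply chi_shift hχ_mul hχ_triv
    have : ξ * (x + t).1 + η * (x + t).2 - (a * t.1 + a ^ 2 * t.2 + (ξ * x.1 + η * x.2))
        = (ξ - a) * (t.1 + 2 * a * t.2) + ((η - ξ ^ 2) + (ξ - a) * (ξ - a)) * t.2 := by
      simp only [Prod.fst_add, Prod.snd_add]; ring
    rw [this]
    refine qp_norm_add_le (qp_norm_mul_le_one hξ h1) (qp_norm_mul_le_one (qp_norm_add_le hs'.2 ?_) h2)
    rw [norm_mul]
    calc ‖ξ - a‖ * ‖ξ - a‖ ≤ (q : ℝ) ^ (-(n : ℤ)) * (q : ℝ) ^ (-(n : ℤ)) := by gcongr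
      _ = _ := by rw [← zpow_add₀ qp_pos.ne']; congr 1; push_cast; ring
  rw [key]; ring

/-- the wave packets are compactly supported -/
lemma proj_supp (hχ_mul : ∀ x y : ℚ_[q], χ (x + y) = χ x * χ y)
    (hχ_triv : ∀ x : ℚ_[q], ‖x‖ ≤ 1 → χ x = 1)
    (hχ_nontriv : ∃ x : ℚ_[q], ‖x‖ ≤ (q : ℝ) ∧ χ x ≠ 1) (hf : HasCompactSupport f) (n : ℕ) :
    ∃ M₁ : ℕ, ∀ a : ℕ, ∀ x : ℚ_[q] × ℚ_[q], ¬ (‖x.1‖ ≤ (q : ℝ) ^ M₁ ∧ ‖x.2‖ ≤ (q : ℝ) ^ M₁) →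
      qpProj q μ χ f (qpItv q n a) x = 0 := by
  obtain ⟨M₀, hM₀⟩ := fourier_shift (μ := μ) hχ_mul hχ_triv hf
  obtain ⟨z, hz1, hz2⟩ := hχ_nontriv
  refine ⟨M₀ + n + 1, fun a x hx => ?_⟩
  have hmul : ∀ k : ℚ_[q] × ℚ_[q], ‖k.1‖ ≤ (q : ℝ) ^ (-((M₀ + n : ℕ) : ℤ)) →
      ‖k.2‖ ≤ (q : ℝ) ^ (-((M₀ + n : ℕ) : ℤ)) →
      qpProj q μ χ f (qpItv q n a) x = χ (k.1 * x.1 + k.2 * x.2) * qpProj q μ χ f (qpItv q n a) x := by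
    intro k hk1 hk2
    have hle0 : (q : ℝ) ^ (-((M₀ + n : ℕ) : ℤ)) ≤ (q : ℝ) ^ (-(M₀ : ℤ)) :=
      zpow_le_zpow_right₀ qp_one_lt.le (by push_cast; omega)
    have hlen : (q : ℝ) ^ (-((M₀ + n : ℕ) : ℤ)) ≤ (q : ℝ) ^ (-(n : ℤ)) :=
      zpow_le_zpow_right₀ qp_one_lt.le (by push_cast; omega)
    unfold qpProj
    rw [← integral_const_mul, ← integral_indicator (strip_measurable n a),
      ← integral_indicator (strip_measurable n a)]
    rw [← integral_add_right_eq_self _ k]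
    congr 1
    ext p
    have hiff : p + k ∈ qpItv q n a ×ˢ (Set.univ : Set ℚ_[q]) ↔ p ∈ qpItv q n a ×ˢ (Set.univ : Set ℚ_[q]) := by
      simp only [Set.mem_prod, Set.mem_univ, and_true, qpItv, Set.mem_ofPred_eq, Prod.fst_add]
      constructor
      · intro h
        have : p.1 - a = (p.1 + k.1 - a) - k.1 := by ring
        rw [this]; exact qp_norm_sub_le h (hk1.trans hlen)
      · intro h
        have : p.1 + k.1 - a = (p.1 - a) + k.1 := by ring
        rw [this]; exact qp_norm_add_le h (hk1.trans hlen)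
    by_cases hp : p ∈ qpItv q n a ×ˢ (Set.univ : Set ℚ_[q])
    · rw [Set.indicator_of_mem (hiff.mpr hp), Set.indicator_of_mem hp,
        hM₀ p k (hk1.trans hle0) (hk2.trans hle0)]
      have : (p + k).1 * x.1 + (p + k).2 * x.2 = (k.1 * x.1 + k.2 * x.2) + (p.1 * x.1 + p.2 * x.2) := by
        simp only [Prod.fst_add, Prod.snd_add]; ring
      rw [this, hχ_mul (k.1 * x.1 + k.2 * x.2)]; ring
    · rw [Set.indicator_of_notMem (fun h => hp (hiff.mp h)), Set.indicator_of_notMem hp]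
  have hz : ∀ y : ℚ_[q], (q : ℝ) ^ (M₀ + n + 1) < ‖y‖ →
      y ≠ 0 ∧ ‖z / y‖ ≤ (q : ℝ) ^ (-((M₀ + n : ℕ) : ℤ)) := by
    intro y hy
    have hy0 : 0 < ‖y‖ := lt_trans (pow_pos qp_pos _) hy
    refine ⟨norm_pos_iff.mp hy0, ?_⟩
    rw [norm_div, div_le_iff₀ hy0]
    calc ‖z‖ ≤ q := hz1
      _ = (q : ℝ) ^ (-((M₀ + n : ℕ) : ℤ)) * (q : ℝ) ^ (M₀ + n + 1) := by
        rw [zpow_neg, zpow_natCast, pow_succ (q : ℝ) (M₀ + n)]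
        field_simp [qp_pos.ne']
      _ ≤ _ := by gcongr
  have hfin : ∀ c : ℂ, c ≠ 1 → qpProj q μ χ f (qpItv q n a) x = c * qpProj q μ χ f (qpItv q n a) x →
      qpProj q μ χ f (qpItv q n a) x = 0 := by
    intro c hc h
    have : (c - 1) * qpProj q μ χ f (qpItv q n a) x = 0 := by rw [sub_mul, ← h]; ring
    exact (mul_eq_zero.mp this).resolve_left (sub_ne_zero.mpr hc)
  rw [not_and_or, not_le, not_le] at hx
  rcases hx with hx | hx
  · obtain ⟨h0, h1⟩ := hz _ hx
    refine hfin (χ z) hz2 ?_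
    have := hmul (z / x.1, 0) h1 (by simpa using (zpow_pos qp_pos _).le)
    simpa [div_mul_cancel₀ _ h0] using this
  · obtain ⟨h0, h1⟩ := hz _ hx
    refine hfin (χ z) hz2 ?_
    have := hmul (0, z / x.2) (by simpa using (zpow_pos qp_pos _).le) h1
    simpa [div_mul_cancel₀ _ h0] using this

lemma itv_disjoint {n a b : ℕ} (ha : a < q ^ n) (hb : b < q ^ n) (hab : a ≠ b) :
    Disjoint (qpItv q n a) (qpItv q n b) := by
  rw [Set.disjoint_left]
  intro ξ h1 h2
  simp only [qpItv, Set.mem_ofPred_eq] at h1 h2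
  apply hab
  have h : ‖((a - b : ℤ) : ℚ_[q])‖ ≤ (q : ℝ) ^ (-(n : ℤ)) := by
    have : ((a - b : ℤ) : ℚ_[q]) = (ξ - b) - (ξ - a) := by push_cast; ring
    rw [this]; exact qp_norm_sub_le h2 h1
  rw [Padic.norm_int_le_pow_iff_dvd] at h
  have h' : (b : ℤ) ≡ a [ZMOD ((q ^ n : ℕ) : ℤ)] := by
    rw [Int.modEq_iff_dvd]; exact_mod_cast h
  have := Int.natCast_modEq_iff.mp h'
  exact (Nat.ModEq.eq_of_lt_of_lt this hb ha).symm

lemma qp_approx (y : ℚ_[q]) (hy : ‖y‖ ≤ 1) (n : ℕ) :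
    ∃ a : ℕ, a < q ^ n ∧ ‖y - a‖ ≤ (q : ℝ) ^ (-(n : ℤ)) := by
  obtain ⟨z, rfl⟩ : ∃ z : ℤ_[q], (z : ℚ_[q]) = y := ⟨⟨y, hy⟩, rfl⟩
  refine ⟨z.appr n, PadicInt.appr_lt _ _, ?_⟩
  have := (PadicInt.norm_le_pow_iff_mem_span_pow _ n).mpr (PadicInt.appr_spec n z)
  rw [PadicInt.norm_def, PadicInt.coe_sub, PadicInt.coe_natCast] at this
  exact this

/-- decomposition of intervals -/
lemma itv_union {n h b : ℕ} (hn : h ≤ n) (hb : b < q ^ h) :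
    qpItv q h b = ⋃ a ∈ (Finset.range (q ^ n)).filter (fun a => a % q ^ h = b), qpItv q n a := by
  have hle : (q : ℝ) ^ (-(n : ℤ)) ≤ (q : ℝ) ^ (-(h : ℤ)) :=
    zpow_le_zpow_right₀ qp_one_lt.le (by omega)
  ext ξ
  simp only [Set.mem_iUnion, Finset.mem_filter, Finset.mem_range, qpItv, Set.mem_ofPred_eq, exists_prop]
  constructor
  · intro hξ
    have h1 : ‖ξ‖ ≤ 1 := by
      have : ξ = (ξ - b) + b := by ring
      rw [this]; exact qp_norm_add_le (hξ.trans (qp_zpow_le_one _)) (qp_norm_nat b)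
    obtain ⟨a, ha, ha'⟩ := qp_approx ξ h1 n
    refine ⟨a, ⟨ha, ?_⟩, ha'⟩
    have hd : ‖((a - b : ℤ) : ℚ_[q])‖ ≤ (q : ℝ) ^ (-(h : ℤ)) := by
      have : ((a - b : ℤ) : ℚ_[q]) = (ξ - b) - (ξ - a) := by push_cast; ring
      rw [this]; exact qp_norm_sub_le hξ (ha'.trans hle)
    rw [Padic.norm_int_le_pow_iff_dvd] at hd
    have h' : (b : ℤ) ≡ a [ZMOD ((q ^ h : ℕ) : ℤ)] := by
      rw [Int.modEq_iff_dvd]; exact_mod_cast hd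
    have := Int.natCast_modEq_iff.mp h'
    exact Eq.trans this.symm (Nat.mod_eq_of_lt hb)
  · rintro ⟨a, ⟨-, hab⟩, hd⟩
    have h' : ‖((a - b : ℤ) : ℚ_[q])‖ ≤ (q : ℝ) ^ (-(h : ℤ)) := by
      rw [Padic.norm_int_le_pow_iff_dvd]
      have h1 : b ≡ a [MOD q ^ h] := by
        unfold Nat.ModEq; rw [hab, Nat.mod_eq_of_lt hb]
      have := Int.modEq_iff_dvd.mp (Int.natCast_modEq_iff.mpr h1)
      exact_mod_cast this
    have : ξ - b = (ξ - a) + ((a - b : ℤ) : ℚ_[q]) := by push_cast; ring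
    rw [this]; exact qp_norm_add_le (hd.trans hle) h'

lemma proj_sum (hχ_mul : ∀ x y : ℚ_[q], χ (x + y) = χ x * χ y)
    (hχ_triv : ∀ x : ℚ_[q], ‖x‖ ≤ 1 → χ x = 1) (hf : HasCompactSupport f) {n h b : ℕ}
    (hs : FSupp q μ χ f n) (hn : h ≤ n) (hb : b < q ^ h) (x : ℚ_[q] × ℚ_[q]) :
    qpProj q μ χ f (qpItv q h b) x =
      ∑ a ∈ (Finset.range (q ^ n)).filter (fun a => a % q ^ h = b), qpProj q μ χ f (qpItv q n a) x := by
  unfold qpProj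
  rw [itv_union hn hb]
  have : (⋃ a ∈ (Finset.range (q ^ n)).filter (fun a => a % q ^ h = b), qpItv q n a) ×ˢ (Set.univ : Set ℚ_[q])
      = ⋃ a ∈ (Finset.range (q ^ n)).filter (fun a => a % q ^ h = b), (qpItv q n a ×ˢ (Set.univ : Set ℚ_[q])) := by
    ext p; simp
  rw [this]
  apply integral_biUnion_finset
  · intro a _; exact strip_measurable n a
  · intro a ha b hb' hab
    simp only [Finset.coe_filter, Finset.mem_range, Set.mem_ofPred_eq] at ha hb'
    exact Set.Disjoint.set_prod_left (itv_disjoint ha.1 hb'.1 hab) _ _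
  · intro a _; exact (fourier_int hχ_mul hχ_triv hf hs x).integrableOn

end PadicPart

end PartG

section PartH

section Disc
variable {q : ℕ} [Fact q.Prime] {M : ℕ} [NeZero (q ^ M)]

/-- the embedding `ℤ/q^M → q^(-M)ℤ` -/
noncomputable def zi (q M : ℕ) [Fact q.Prime] (u : ZMod (q ^ M)) : ℚ_[q] := (u.val : ℚ_[q]) / (q : ℚ_[q]) ^ M

lemma int_div_norm (z : ℤ) (s : ℕ) (hd : (q : ℤ) ^ (M - s) ∣ z) :
    ‖(z : ℚ_[q]) / (q : ℚ_[q]) ^ M‖ ≤ (q : ℝ) ^ s := by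
  rw [← Padic.norm_int_le_pow_iff_dvd] at hd
  rw [norm_div, Padic.norm_p_pow, div_le_iff₀ (zpow_pos qp_pos _)]
  refine hd.trans ?_
  rw [← zpow_natCast, ← zpow_add₀ qp_pos.ne']
  exact zpow_le_zpow_right₀ qp_one_lt.le (by omega)

lemma zi_int (z : ℤ) (u : ZMod (q ^ M)) (h : (z : ZMod (q ^ M)) = u) :
    ‖(z : ℚ_[q]) / (q : ℚ_[q]) ^ M - zi q M u‖ ≤ 1 := by
  have h1 : ((z - u.val : ℤ) : ZMod (q ^ M)) = 0 := by
    push_cast; rw [h]; simp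
  rw [ZMod.intCast_zmod_eq_zero_iff_dvd] at h1
  have h2 := int_div_norm (q := q) (M := M) (z - u.val) 0 (by exact_mod_cast h1)
  rw [zi, ← sub_div]
  simpa using h2

lemma zi_dvd (u : ZMod (q ^ M)) (s : ℕ) (h : (q : ZMod (q ^ M)) ^ (M - s) ∣ u) :
    ‖zi q M u‖ ≤ (q : ℝ) ^ s := by
  obtain ⟨c, rfl⟩ := h
  have h1 := zi_int ((q : ℤ) ^ (M - s) * c.val) ((q : ZMod (q ^ M)) ^ (M - s) * c) (by push_cast; simp)
  have h2 := int_div_norm (q := q) (M := M) ((q : ℤ) ^ (M - s) * c.val) s (Dvd.intro _ rfl)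
  have h3 := qp_norm_sub_le h2 (h1.trans (one_le_pow₀ (qp_one_lt (q := q)).le (n := s)))
  rwa [sub_sub_cancel] at h3

lemma zi_add (u v : ZMod (q ^ M)) : ‖(zi q M u + zi q M v) - zi q M (u + v)‖ ≤ 1 := by
  have := zi_int (u.val + v.val : ℤ) (u + v) (by push_cast; simp)
  simpa [zi, add_div] using this

lemma zi_inj {u v : ZMod (q ^ M)} (h : ‖zi q M u - zi q M v‖ ≤ 1) : u = v := by
  rw [zi, zi, ← sub_div, norm_div, Padic.norm_p_pow, div_le_iff₀ (zpow_pos qp_pos _), one_mul] at h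
  have h' : ‖((u.val - v.val : ℤ) : ℚ_[q])‖ ≤ (q : ℝ) ^ (-(M : ℤ)) := by simpa using h
  rw [Padic.norm_int_le_pow_iff_dvd] at h'
  have : ((u.val - v.val : ℤ) : ZMod (q ^ M)) = 0 := by
    rw [ZMod.intCast_zmod_eq_zero_iff_dvd]; exact_mod_cast h'
  push_cast at this
  simpa [sub_eq_zero] using this

lemma zi_surj (x : ℚ_[q]) (hx : ‖x‖ ≤ (q : ℝ) ^ M) : ∃ u : ZMod (q ^ M), ‖x - zi q M u‖ ≤ 1 := by
  have hq0 : ((q : ℚ_[q]) ^ M) ≠ 0 := by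
    have := (Fact.out : q.Prime).ne_zero
    positivity
  have h1 : ‖x * (q : ℚ_[q]) ^ M‖ ≤ 1 := by
    rw [norm_mul, Padic.norm_p_pow, zpow_neg, zpow_natCast, ← div_eq_mul_inv, div_le_one (pow_pos qp_pos _)]
    exact hx
  obtain ⟨a, ha, ha'⟩ := qp_approx _ h1 M
  refine ⟨(a : ZMod (q ^ M)), ?_⟩
  have : x - zi q M (a : ZMod (q ^ M)) = (x * (q : ℚ_[q]) ^ M - a) / (q : ℚ_[q]) ^ M := by
    rw [zi, ZMod.val_cast_of_lt ha, sub_div, mul_div_cancel_right₀ _ hq0]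
  rw [this, norm_div, Padic.norm_p_pow, div_le_one (zpow_pos qp_pos _)]
  exact ha'

variable {χ : ℚ_[q] → ℂ}

/-- the induced character of `ℤ/q^M` -/
noncomputable def zChar (M : ℕ) [NeZero (q ^ M)] (hχ_mul : ∀ x y : ℚ_[q], χ (x + y) = χ x * χ y)
    (hχ_triv : ∀ x : ℚ_[q], ‖x‖ ≤ 1 → χ x = 1) : AddChar (ZMod (q ^ M)) ℂ where
  toFun u := χ (zi q M u)
  map_zero_eq_one' := by simp [zi, hχ_triv]
  map_add_eq_mul' u v := by
    rw [← hχ_mul]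
    exact (chi_shift hχ_mul hχ_triv (zi_add u v)).symm

lemma zChar_apply (hχ_mul : ∀ x y : ℚ_[q], χ (x + y) = χ x * χ y)
    (hχ_triv : ∀ x : ℚ_[q], ‖x‖ ≤ 1 → χ x = 1) (u : ZMod (q ^ M)) :
    zChar M hχ_mul hχ_triv u = χ (zi q M u) := rfl

lemma zChar_prim (hχ_mul : ∀ x y : ℚ_[q], χ (x + y) = χ x * χ y)
    (hχ_triv : ∀ x : ℚ_[q], ‖x‖ ≤ 1 → χ x = 1)
    (hχ_nontriv : ∃ x : ℚ_[q], ‖x‖ ≤ (q : ℝ) ∧ χ x ≠ 1) (c : ZMod (q ^ M)) (hc : c ≠ 0) :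
    ∃ w, zChar M hχ_mul hχ_triv (c * w) ≠ 1 := by
  obtain ⟨z, hz1, hz2⟩ := hχ_nontriv
  have hq0 : ((q : ℚ_[q]) ^ M) ≠ 0 := by
    have := (Fact.out : q.Prime).ne_zero
    positivity
  have hc1 : ¬ ‖(c.val : ℚ_[q])‖ ≤ (q : ℝ) ^ (-(M : ℤ)) := by
    intro h
    have h' : ‖((c.val : ℤ) : ℚ_[q])‖ ≤ (q : ℝ) ^ (-(M : ℤ)) := by simpa using h
    rw [Padic.norm_int_le_pow_iff_dvd] at h'
    apply hc
    have : ((c.val : ℤ) : ZMod (q ^ M)) = 0 := by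
      rw [ZMod.intCast_zmod_eq_zero_iff_dvd]; exact_mod_cast h'
    simpa using this
  rw [Padic.norm_le_pow_iff_norm_lt_pow_add_one, not_lt] at hc1
  have hcpos : 0 < ‖(c.val : ℚ_[q])‖ := lt_of_lt_of_le (zpow_pos qp_pos _) hc1
  have hc0 : (c.val : ℚ_[q]) ≠ 0 := norm_pos_iff.mp hcpos
  have h1 : ‖z * (q : ℚ_[q]) ^ M / c.val‖ ≤ 1 := by
    rw [norm_div, div_le_one hcpos, norm_mul, Padic.norm_p_pow]
    refine le_trans ?_ hc1
    rw [zpow_add₀ qp_pos.ne', zpow_one, mul_comm]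
    gcongr
  obtain ⟨w, hw, hw'⟩ := qp_approx _ h1 M
  refine ⟨(w : ZMod (q ^ M)), ?_⟩
  rw [zChar_apply]
  have h2 := zi_int (c.val * w : ℤ) (c * (w : ZMod (q ^ M))) (by push_cast; simp)
  have h3 : ‖z - ((c.val * w : ℤ) : ℚ_[q]) / (q : ℚ_[q]) ^ M‖ ≤ 1 := by
    have : z - ((c.val * w : ℤ) : ℚ_[q]) / (q : ℚ_[q]) ^ M
        = c.val * ((z * (q : ℚ_[q]) ^ M / c.val - w) / (q : ℚ_[q]) ^ M) := by
      push_cast; field_simp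
    rw [this, norm_mul, norm_div, Padic.norm_p_pow]
    refine mul_le_one₀ (qp_norm_nat _) (by positivity) ?_
    rw [div_le_one (zpow_pos qp_pos _)]
    exact hw'
  have h4 := qp_norm_add_le h3 h2
  rw [sub_add_sub_cancel] at h4
  rw [← chi_shift hχ_mul hχ_triv h4]
  exact hz2

/-- the embedding in dimension two -/
noncomputable def zi2 (q M : ℕ) [Fact q.Prime] (u : ZMod (q ^ M) × ZMod (q ^ M)) : ℚ_[q] × ℚ_[q] :=
  (zi q M u.1, zi q M u.2)

variable {μ : Measure ℚ_[q]} [μ.IsAddHaarMeasure] [SigmaFinite μ] {f : ℚ_[q] × ℚ_[q] → ℂ}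

lemma proj_inv (hχ_mul : ∀ x y : ℚ_[q], χ (x + y) = χ x * χ y)
    (hχ_triv : ∀ x : ℚ_[q], ‖x‖ ≤ 1 → χ x = 1) {n : ℕ}
    (hs : FSupp q μ χ f n) (a : ℕ) (x y : ℚ_[q] × ℚ_[q])
    (h1 : ‖x.1 - y.1‖ ≤ 1) (h2 : ‖x.2 - y.2‖ ≤ 1) :
    qpProj q μ χ f (qpItv q n a) x = qpProj q μ χ f (qpItv q n a) y := by
  have ha : ∀ c : ℕ, ∀ z : ℚ_[q], ‖z‖ ≤ 1 → ‖(c : ℚ_[q]) * z‖ ≤ 1 := by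
    intro c z hz
    rw [norm_mul]
    exact mul_le_one₀ (qp_norm_nat _) (norm_nonneg _) hz
  have h := proj_equi (μ := μ) (f := f) hχ_mul hχ_triv hs a y (x - y)
    (le_trans (qp_norm_add_le h1 (by simpa using ha (2 * a) _ h2))
      (one_le_zpow₀ (qp_one_lt (q := q)).le (by omega)))
    (le_trans h2 (one_le_zpow₀ (qp_one_lt (q := q)).le (by omega)))
  rw [add_sub_cancel] at h
  simp only [Prod.fst_sub, Prod.snd_sub] at h
  rw [hχ_triv _ (qp_norm_add_le (ha a _ h1) (by
    have := ha (a ^ 2) _ h2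
    rwa [Nat.cast_pow] at this)), one_mul] at h
  exact h

lemma disc_equi (hχ_mul : ∀ x y : ℚ_[q], χ (x + y) = χ x * χ y)
    (hχ_triv : ∀ x : ℚ_[q], ‖x‖ ≤ 1 → χ x = 1) {n : ℕ}
    (hs : FSupp q μ χ f n) (a : ℕ) :
    Equi (zChar M hχ_mul hχ_triv) n a (fun u => qpProj q μ χ f (qpItv q n a) (zi2 q M u)) := by
  intro x t h1 h2
  dsimp only
  rw [proj_inv hχ_mul hχ_triv hs a (zi2 q M (x + t)) (zi2 q M x + zi2 q M t)
    (by rw [norm_sub_rev]; exact zi_add _ _) (by rw [norm_sub_rev]; exact zi_add _ _)]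
  rw [proj_equi hχ_mul hχ_triv hs a]
  · rw [zChar_apply]
    congr 1
    apply chi_shift hχ_mul hχ_triv
    have := zi_int (a * t.1.val + a ^ 2 * t.2.val : ℤ) ((a : ZMod (q ^ M)) * t.1 + (a : ZMod (q ^ M)) ^ 2 * t.2) (by push_cast; simp)
    refine le_of_eq_of_le ?_ this
    congr 2
    simp only [zi2, zi]; push_cast; ring
  · have h3 := zi_dvd _ _ h1
    have := zi_int (t.1.val + 2 * a * t.2.val : ℤ) (t.1 + 2 * (a : ZMod (q ^ M)) * t.2) (by push_cast; simp)
    have h4 := qp_norm_add_le (this.trans (one_le_pow₀ (qp_one_lt (q := q)).le (n := n))) h3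
    rw [sub_add_cancel] at h4
    rw [zpow_natCast]
    refine le_of_eq_of_le ?_ h4
    congr 1
    simp only [zi2, zi]; push_cast; ring
  · rw [zpow_natCast]; exact zi_dvd _ _ h2

/-- unit cells -/
def cell (q : ℕ) [Fact q.Prime] (y : ℚ_[q] × ℚ_[q]) : Set (ℚ_[q] × ℚ_[q]) :=
  {x | ‖x.1 - y.1‖ ≤ 1 ∧ ‖x.2 - y.2‖ ≤ 1}

lemma cell_eq (y : ℚ_[q] × ℚ_[q]) : cell q y = Metric.closedBall y.1 1 ×ˢ Metric.closedBall y.2 1 := by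
  ext x; simp [cell, dist_eq_norm]

lemma cell_measurable (y : ℚ_[q] × ℚ_[q]) : MeasurableSet (cell q y) := by
  rw [cell_eq]; exact measurableSet_closedBall.prod measurableSet_closedBall

lemma cell_volume (hμ : μ {x : ℚ_[q] | ‖x‖ ≤ 1} = 1) (y : ℚ_[q] × ℚ_[q]) : (μ.prod μ) (cell q y) = 1 := by
  have h : ∀ z : ℚ_[q], μ (Metric.closedBall z 1) = 1 := by
    intro z
    rw [Measure.addHaar_closedBall_center, ← hμ]
    congr 1
    ext x; simp
  rw [cell_eq, Measure.prod_prod, h, h, one_mul]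

lemma cell_cover (x : ℚ_[q] × ℚ_[q]) (h : ‖x.1‖ ≤ (q : ℝ) ^ M ∧ ‖x.2‖ ≤ (q : ℝ) ^ M) :
    ∃ u, x ∈ cell q (zi2 q M u) := by
  obtain ⟨u, hu⟩ := zi_surj x.1 h.1
  obtain ⟨v, hv⟩ := zi_surj x.2 h.2
  exact ⟨(u, v), hu, hv⟩

lemma cell_unique {x : ℚ_[q] × ℚ_[q]} {u v : ZMod (q ^ M) × ZMod (q ^ M)} (hu : x ∈ cell q (zi2 q M u))
    (hv : x ∈ cell q (zi2 q M v)) : u = v := by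
  apply Prod.ext
  · apply zi_inj (q := q)
    have := qp_norm_sub_le hv.1 hu.1
    rwa [sub_sub_sub_cancel_left] at this
  · apply zi_inj (q := q)
    have := qp_norm_sub_le hv.2 hu.2
    rwa [sub_sub_sub_cancel_left] at this

lemma disc_integral (hμ : μ {x : ℚ_[q] | ‖x‖ ≤ 1} = 1) (φ : ℚ_[q] × ℚ_[q] → ℝ)
    (hinv : ∀ x y : ℚ_[q] × ℚ_[q], ‖x.1 - y.1‖ ≤ 1 → ‖x.2 - y.2‖ ≤ 1 → φ x = φ y)
    (hsupp : ∀ x : ℚ_[q] × ℚ_[q], ¬ (‖x.1‖ ≤ (q : ℝ) ^ M ∧ ‖x.2‖ ≤ (q : ℝ) ^ M) → φ x = 0) :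
    ∫ x, φ x ∂(μ.prod μ) = ∑ u, φ (zi2 q M u) := by
  have h : φ = fun x => ∑ u, (cell q (zi2 q M u)).indicator (fun _ => φ (zi2 q M u)) x := by
    funext x
    by_cases hx : ∃ u, x ∈ cell q (zi2 q M u)
    · obtain ⟨u, hu⟩ := hx
      rw [Finset.sum_eq_single u]
      · rw [Set.indicator_of_mem hu]
        exact hinv _ _ hu.1 hu.2
      · intro v _ hv
        exact Set.indicator_of_notMem (fun h => hv (cell_unique h hu)) _
      · intro h; exact absurd (Finset.mem_univ _) h
    · rw [hsupp x (fun h => hx (cell_cover x h))]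
      symm
      apply Finset.sum_eq_zero
      intro u _
      exact Set.indicator_of_notMem (fun h => hx ⟨u, h⟩) _
  conv_lhs => rw [h]
  rw [integral_finsetSum]
  · apply Finset.sum_congr rfl
    intro u _
    rw [integral_indicator_const _ (cell_measurable _), Measure.real, cell_volume hμ]
    simp
  · intro u _
    rw [integrable_indicator_iff (cell_measurable _)]
    exact integrableOn_const (by rw [cell_volume hμ]; exact ENNReal.one_ne_top)

lemma disc_measure (hμ : μ {x : ℚ_[q] | ‖x‖ ≤ 1} = 1) (U : Set (ℚ_[q] × ℚ_[q]))
    (V : Finset (ZMod (q ^ M) × ZMod (q ^ M)))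
    (hV : ∀ x ∈ U, ∃ u ∈ V, x ∈ cell q (zi2 q M u)) : ((μ.prod μ) U).toReal ≤ V.card := by
  have h : (μ.prod μ) U ≤ V.card := by
    calc (μ.prod μ) U ≤ (μ.prod μ) (⋃ u ∈ V, cell q (zi2 q M u)) := by
          apply measure_mono
          intro x hx
          obtain ⟨u, hu, hxu⟩ := hV x hx
          exact Set.mem_biUnion hu hxu
      _ ≤ ∑ u ∈ V, (μ.prod μ) (cell q (zi2 q M u)) := measure_biUnion_finset_le _ _
      _ = V.card := by simp [cell_volume hμ]
  simpa using ENNReal.toReal_mono (by simp) h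

end Disc

end PartH

section PartI

section Final
variable {q : ℕ} [Fact q.Prime]
variable {χ : ℚ_[q] → ℂ}
variable {μ : Measure ℚ_[q]} [μ.IsAddHaarMeasure] [SigmaFinite μ] {f : ℚ_[q] × ℚ_[q] → ℂ}

lemma padic_level (hq2 : q ≠ 2) (hμ : μ {x : ℚ_[q] | ‖x‖ ≤ 1} = 1)
    (hχ_mul : ∀ x y : ℚ_[q], χ (x + y) = χ x * χ y)
    (hχ_triv : ∀ x : ℚ_[q], ‖x‖ ≤ 1 → χ x = 1)
    (hχ_nontriv : ∃ x : ℚ_[q], ‖x‖ ≤ (q : ℝ) ∧ χ x ≠ 1)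
    (hf : HasCompactSupport f) {J h : ℕ} (hJ : 1 ≤ J) (hs : FSupp q μ χ f (J * h))
    {α C₀ L : ℝ} (hα : 0 < α) (hC₀ : 1 ≤ C₀) (hL : 1 ≤ L) (U : Set (ℚ_[q] × ℚ_[q]))
    (hU : ∀ x ∈ U, (∃ b < q ^ h, ∃ b' < q ^ h, b ≠ b' ∧ (α / C₀) ^ 2 ≤
      ‖qpProj q μ χ f (qpItv q h b) x‖ * ‖qpProj q μ χ f (qpItv q h b') x‖) ∧
      ∀ b < q ^ h, ‖qpProj q μ χ f (qpItv q h b) x‖ ≤ L * α) :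
    α ^ 6 * ((μ.prod μ) U).toReal ≤ 20000 * C₀ ^ 8 * J ^ 5 * L ^ 2 * q ^ (4 * h) *
      (∑ a ∈ Finset.range (q ^ (J * h)), (⨆ x, ‖qpProj q μ χ f (qpItv q (J * h) a) x‖) ^ 2) ^ 2 *
      ∑ a ∈ Finset.range (q ^ (J * h)), ∫ x, ‖qpProj q μ χ f (qpItv q (J * h) a) x‖ ^ 2 ∂(μ.prod μ) := by
  classical
  have hqp : q.Prime := Fact.out
  obtain ⟨M₁, hM₁⟩ := proj_supp (μ := μ) hχ_mul hχ_triv hχ_nontriv hf (J * h)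
  set M := M₁ + 2 * (J * h) with hMdef
  haveI : NeZero (q ^ M) := ⟨pow_ne_zero _ hqp.ne_zero⟩
  have hsup : ∀ a : ℕ, ∀ x : ℚ_[q] × ℚ_[q], ¬ (‖x.1‖ ≤ (q : ℝ) ^ M ∧ ‖x.2‖ ≤ (q : ℝ) ^ M) →
      qpProj q μ χ f (qpItv q (J * h) a) x = 0 := by
    intro a x hx
    apply hM₁ a x
    intro hx'
    have : (q : ℝ) ^ M₁ ≤ (q : ℝ) ^ M := pow_le_pow_right₀ qp_one_lt.le (by omega)
    exact hx ⟨hx'.1.trans this, hx'.2.trans this⟩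
  have hinv := fun a x y h1 h2 => proj_inv (μ := μ) (f := f) hχ_mul hχ_triv hs a x y h1 h2
  have hhn : h ≤ J * h := Nat.le_mul_of_pos_left h hJ
  have hsum := fun b (hb : b < q ^ h) x => proj_sum (μ := μ) hχ_mul hχ_triv hf hs hhn hb x
  set F : ℕ → ℚ_[q] × ℚ_[q] → ℂ := fun a => qpProj q μ χ f (qpItv q (J * h) a) with hFdef
  have hne : ∀ x ∈ U, ¬ ∀ a, F a x = 0 := by
    intro x hx h0
    obtain ⟨⟨b, hb, b', hb', -, hbb⟩, -⟩ := hU x hx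
    rw [hsum b hb, Finset.sum_eq_zero (fun a _ => h0 a), norm_zero, zero_mul] at hbb
    have : 0 < (α / C₀) ^ 2 := by positivity
    linarith
  have hbdd : ∀ a, BddAbove (Set.range fun x => ‖F a x‖) := by
    intro a
    have : (Set.range fun x => ‖F a x‖) ⊆ insert 0 (Set.range fun u => ‖F a (zi2 q M u)‖) := by
      rintro _ ⟨x, rfl⟩
      by_cases hx : ‖x.1‖ ≤ (q : ℝ) ^ M ∧ ‖x.2‖ ≤ (q : ℝ) ^ M
      · obtain ⟨u, hu⟩ := cell_cover x hx
        right
        exact ⟨u, by dsimp only; rw [hFdef]; dsimp only; rw [hinv a x _ hu.1 hu.2]⟩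
      · left
        dsimp only; rw [hFdef]; dsimp only
        rw [hsup a x hx, norm_zero]
    exact (((Set.finite_range _).insert 0).subset this).bddAbove
  set S := ∑ a ∈ Finset.range (q ^ (J * h)), (⨆ x, ‖F a x‖) ^ 2 with hSdef
  have hFS : ∀ x, ∑ a ∈ Finset.range (q ^ (J * h)), ‖F a x‖ ^ 2 ≤ S := by
    intro x
    apply Finset.sum_le_sum
    intro a _
    gcongr
    exact le_ciSup (hbdd a) x
  have hW : ∑ a ∈ Finset.range (q ^ (J * h)), ∫ x, ‖F a x‖ ^ 2 ∂(μ.prod μ)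
      = ∑ u, ∑ a ∈ Finset.range (q ^ (J * h)), ‖F a (zi2 q M u)‖ ^ 2 := by
    rw [Finset.sum_comm]
    apply Finset.sum_congr rfl
    intro a _
    apply disc_integral hμ (fun x => ‖F a x‖ ^ 2)
    · intro x y h1 h2
      simp only [hFdef, hinv a x y h1 h2]
    · intro x hx
      simp [hFdef, hsup a x hx]
  set V : Finset (ZMod (q ^ M) × ZMod (q ^ M)) := Finset.univ.filter
    (fun u => ∃ x ∈ U, x ∈ cell q (zi2 q M u)) with hV
  have hmeas : ((μ.prod μ) U).toReal ≤ V.card := by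
    apply disc_measure hμ
    intro x hx
    have : ‖x.1‖ ≤ (q : ℝ) ^ M ∧ ‖x.2‖ ≤ (q : ℝ) ^ M := by
      by_contra hx'
      exact hne x hx (fun a => hsup a x hx')
    obtain ⟨u, hu⟩ := cell_cover x this
    exact ⟨u, Finset.mem_filter.mpr ⟨Finset.mem_univ _, x, hx, hu⟩, hu⟩
  have hS0 : 0 ≤ S := Finset.sum_nonneg (fun _ _ => by positivity)
  rw [hW]
  rcases hS0.eq_or_lt with hS | hS
  · have hUe : U = ∅ := by
      rw [Set.eq_empty_iff_forall_notMem]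
      intro x hx
      obtain ⟨⟨b, hb, b', hb', -, hbb⟩, -⟩ := hU x hx
      have h1 : ∀ a ∈ Finset.range (q ^ (J * h)), F a x = 0 := by
        have h2 := hFS x
        rw [← hS] at h2
        have h3 := (Finset.sum_eq_zero_iff_of_nonneg (fun _ _ => by positivity)).mp
          (le_antisymm h2 (Finset.sum_nonneg (fun _ _ => by positivity)))
        intro a ha
        have := h3 a ha
        simpa using this
      rw [hsum b hb, Finset.sum_eq_zero (fun a ha => h1 a (Finset.mem_filter.mp ha).1), norm_zero, zero_mul] at hbb
      have : 0 < (α / C₀) ^ 2 := by positivity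
      linarith
    rw [hUe, ← hS]; simp
  · refine le_trans (mul_le_mul_of_nonneg_left hmeas (by positivity)) ?_
    refine finite_level (e := zChar M hχ_mul hχ_triv) hqp hq2 (zChar_prim hχ_mul hχ_triv hχ_nontriv) (by omega) hJ hS hα hC₀ hL
      (fun a u => F a (zi2 q M u)) (fun a _ => disc_equi hχ_mul hχ_triv hs a) (fun u => hFS _) V ?_
    intro u hu
    obtain ⟨-, x, hx, hxu⟩ := Finset.mem_filter.mp hu
    have hbF : ∀ b < q ^ h, ∑ a ∈ Finset.range (q ^ (J * h)) with a % q ^ h = b, F a (zi2 q M u)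
        = qpProj q μ χ f (qpItv q h b) x := by
      intro b hb
      rw [hsum b hb]
      apply Finset.sum_congr rfl
      intro a _
      exact (hinv a x _ hxu.1 hxu.2).symm
    obtain ⟨⟨b, hb, b', hb', hne', hbb⟩, hall⟩ := hU x hx
    refine ⟨⟨b, hb, b', hb', hne', ?_⟩, ?_⟩
    · rw [hbF b hb, hbF b' hb']; exact hbb
    · intro c hc
      rw [hbF c hc]; exact hall c hc

/-- unpacking the maximum over pairs -/
lemma maxPair_exists {h : ℕ} {x : ℚ_[q] × ℚ_[q]} {c : ℝ} (hc : 0 < c)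
    (hle : c ≤ qpMaxPair q μ χ f h 0 0 x) :
    ∃ b < q ^ h, ∃ b' < q ^ h, b ≠ b' ∧ c ^ 2 ≤
      ‖qpProj q μ χ f (qpItv q h b) x‖ * ‖qpProj q μ χ f (qpItv q h b') x‖ := by
  by_contra hcon
  push Not at hcon
  set G : ℕ → ℕ → ℝ := fun b b' =>
    Real.sqrt ‖qpProj q μ χ f (qpItv q h b) x * qpProj q μ χ f (qpItv q h b') x‖ with hG
  have hmem : ∀ b, b ∈ qpSubItv q h 0 0 → b < q ^ h := fun b hb => by
    simp only [qpSubItv, Finset.mem_filter, Finset.mem_range] at hb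
    exact hb.1
  have hlt : ∀ b < q ^ h, ∀ b' < q ^ h, b ≠ b' → G b b' < c := by
    intro b hb b' hb' hne
    rw [hG]
    dsimp only
    rw [Real.sqrt_lt' hc, norm_mul]
    exact hcon b hb b' hb' hne
  obtain ⟨d, hd0, hdc, hd⟩ : ∃ d : ℝ, 0 ≤ d ∧ d < c ∧ ∀ b < q ^ h, ∀ b' < q ^ h, b ≠ b' → G b b' ≤ d := by
    set T : Finset ℝ := insert 0 ((((Finset.range (q ^ h)) ×ˢ (Finset.range (q ^ h))).filter
      (fun p => p.1 ≠ p.2)).image (fun p => G p.1 p.2)) with hT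
    have hTn : T.Nonempty := ⟨0, Finset.mem_insert_self _ _⟩
    refine ⟨T.max' hTn, T.le_max' 0 (Finset.mem_insert_self _ _), ?_, ?_⟩
    · rw [Finset.max'_lt_iff]
      intro y hy
      rw [hT, Finset.mem_insert, Finset.mem_image] at hy
      rcases hy with rfl | ⟨p, hp, rfl⟩
      · exact hc
      · simp only [Finset.mem_filter, Finset.mem_product, Finset.mem_range] at hp
        exact hlt _ hp.1.1 _ hp.1.2 hp.2
    · intro b hb b' hb' hne
      apply T.le_max'
      rw [hT, Finset.mem_insert, Finset.mem_image]
      right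
      exact ⟨(b, b'), by simp [hb, hb', hne], rfl⟩
  have : qpMaxPair q μ χ f h 0 0 x ≤ d := by
    unfold qpMaxPair
    refine Real.iSup_le (fun b => Real.iSup_le (fun hb => Real.iSup_le (fun b' => Real.iSup_le (fun hb' =>
      Real.iSup_le (fun hne => ?_) hd0) hd0) hd0) hd0) hd0
    exact hd b (hmem b hb) b' (hmem b' hb') hne
  linarith

lemma six_le {h : ℕ} {x : ℚ_[q] × ℚ_[q]} {c : ℝ}
    (hle : (∑ b ∈ Finset.range (q ^ h), ‖qpProj q μ χ f (qpItv q h b) x‖ ^ 6) ^ ((1 : ℝ) / 6) ≤ c) :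
    ∀ b < q ^ h, ‖qpProj q μ χ f (qpItv q h b) x‖ ≤ c := by
  intro b hb
  refine le_trans ?_ hle
  have h1 : ‖qpProj q μ χ f (qpItv q h b) x‖ ^ 6 ≤ ∑ b ∈ Finset.range (q ^ h), ‖qpProj q μ χ f (qpItv q h b) x‖ ^ 6 :=
    Finset.single_le_sum (f := fun b => ‖qpProj q μ χ f (qpItv q h b) x‖ ^ 6)
      (fun _ _ => by positivity) (Finset.mem_range.mpr hb)
  calc ‖qpProj q μ χ f (qpItv q h b) x‖ = (‖qpProj q μ χ f (qpItv q h b) x‖ ^ 6) ^ ((1 : ℝ) / 6) := by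
        rw [← Real.rpow_natCast, ← Real.rpow_mul (norm_nonneg _)]; norm_num
    _ ≤ _ := by gcongr

/-- the final numerical estimate -/
lemma final_numerics (hq3 : 3 ≤ q) {ε : ℝ} (hε : 0 < ε) {A m r J : ℕ} (hA : 1 / ε ≤ (A : ℝ))
    (hr : 4 ∣ r) (hr0 : 4 ≤ r)
    (hR : (q : ℝ) ^ ((q : ℝ) ^ ((A : ℝ) * ((r : ℝ) - 4))) ≤ (q : ℝ) ^ (2 * m))
    (hm : 1 ≤ m) (hJ : J ≤ 2 * m) (hJ1 : 1 ≤ J) :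
    1 ≤ Real.log ((q : ℝ) ^ (2 * m)) ∧
    (J : ℝ) ^ 5 * (Real.log ((q : ℝ) ^ (2 * m)) * (q : ℝ) ^ (r / 2)) ^ 2 * (q : ℝ) ^ (4 * (r / 2)) ≤
      (q : ℝ) ^ 12 * (Real.log ((q : ℝ) ^ (2 * m))) ^ ((7 : ℝ) + 7 * ε / 2) := by
  have hq1 : (1 : ℝ) < q := qp_one_lt
  have hlogq : 1 ≤ Real.log q := by
    rw [Real.le_log_iff_exp_le (by linarith)]
    have h3 : (3 : ℝ) ≤ q := by exact_mod_cast hq3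
    linarith [Real.exp_one_lt_d9]
  set l := Real.log ((q : ℝ) ^ (2 * m)) with hl
  have hml : ((2 * m : ℕ) : ℝ) ≤ l := by
    rw [hl, Real.log_pow]
    exact le_mul_of_one_le_right (by positivity) hlogq
  have hm1 : (1 : ℝ) ≤ ((2 * m : ℕ) : ℝ) := by exact_mod_cast (by omega : 1 ≤ 2 * m)
  have hl1 : 1 ≤ l := hm1.trans hml
  refine ⟨hl1, ?_⟩
  have hl0 : 0 < l := by linarith
  have hJl : (J : ℝ) ≤ l := le_trans (by exact_mod_cast hJ) hml
  have h1 : (q : ℝ) ^ ((A : ℝ) * ((r : ℝ) - 4)) ≤ l := by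
    rw [← Real.rpow_natCast (q : ℝ) (2 * m)] at hR
    exact ((Real.rpow_le_rpow_left_iff hq1).mp hR).trans hml
  have hA0 : 0 < (A : ℝ) := lt_of_lt_of_le (by positivity) hA
  have h2 : (q : ℝ) ^ (r - 4) ≤ l ^ ε := by
    have h3 : (q : ℝ) ^ (r - 4) = ((q : ℝ) ^ ((A : ℝ) * ((r : ℝ) - 4))) ^ (1 / (A : ℝ)) := by
      rw [← Real.rpow_mul (by positivity), ← Real.rpow_natCast, Nat.cast_sub hr0]
      congr 1
      field_simp
      norm_num
    rw [h3]
    calc ((q : ℝ) ^ ((A : ℝ) * ((r : ℝ) - 4))) ^ (1 / (A : ℝ)) ≤ l ^ (1 / (A : ℝ)) := by gcongr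
      _ ≤ l ^ ε := by
        apply Real.rpow_le_rpow_of_exponent_le hl1
        rw [div_le_iff₀ hA0]
        rw [div_le_iff₀ hε] at hA
        linarith
  have h4 : (q : ℝ) ^ (3 * r) ≤ (q : ℝ) ^ 12 * l ^ (7 * ε / 2) := by
    have h5 : (q : ℝ) ^ (3 * r) = (q : ℝ) ^ 12 * ((q : ℝ) ^ (r - 4)) ^ 3 := by
      rw [← pow_mul, ← pow_add]; congr 1; omega
    rw [h5]
    gcongr
    calc ((q : ℝ) ^ (r - 4)) ^ 3 ≤ (l ^ ε) ^ 3 := by gcongr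
      _ = l ^ (3 * ε) := by rw [← Real.rpow_natCast, ← Real.rpow_mul hl0.le]; congr 1; push_cast; ring
      _ ≤ l ^ (7 * ε / 2) := Real.rpow_le_rpow_of_exponent_le hl1 (by linarith)
  have h6 : ((q : ℝ) ^ (r / 2)) ^ 2 * (q : ℝ) ^ (4 * (r / 2)) = (q : ℝ) ^ (3 * r) := by
    rw [← pow_mul, ← pow_add]; congr 1; omega
  calc (J : ℝ) ^ 5 * (l * (q : ℝ) ^ (r / 2)) ^ 2 * (q : ℝ) ^ (4 * (r / 2))
      = (J : ℝ) ^ 5 * l ^ 2 * (q : ℝ) ^ (3 * r) := by rw [← h6]; ring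
    _ ≤ l ^ 5 * l ^ 2 * ((q : ℝ) ^ 12 * l ^ (7 * ε / 2)) := by gcongr
    _ = _ := by
      rw [Real.rpow_add hl0, show l ^ (7 : ℝ) = l ^ 7 by exact_mod_cast Real.rpow_natCast l 7]
      ring

end Final

end PartI

/-- **Level set estimate (Proposition 5.5).** For `J ∈ {1,…,N}`, Schwartz `f` with Fourier
support in `Ξ_{1/R_J}` and `α > 0`, the set `U_α(f)` where
`max_{τ₁ ≠ τ₁'} |f_{τ₁} f_{τ₁'}|^{1/2} ∼ α` (within a factor `C₀`) and
`(∑_{τ₁} |f_{τ₁}|⁶)^{1/6} ≤ C₀ (log R) q^{r/2} α` satisfies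
`α⁶ μ²(U_α(f)) ≤ C (log R)^{7+7ε/2} (∑_{τ_J} ‖f_{τ_J}‖_∞²)² (∑_{τ_J} ∫ |f_{τ_J}|²)`. -/
theorem level_set_estimate (q : ℕ) [Fact q.Prime] (hq2 : q ≠ 2)
    (μ : Measure ℚ_[q]) [μ.IsAddHaarMeasure] [SigmaFinite μ]
    (hμ : μ {x : ℚ_[q] | ‖x‖ ≤ 1} = 1)
    (χ : ℚ_[q] → ℂ)
    (hχ_mul : ∀ x y : ℚ_[q], χ (x + y) = χ x * χ y)
    (hχ_norm : ∀ x : ℚ_[q], ‖χ x‖ = 1)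
    (hχ_triv : ∀ x : ℚ_[q], ‖x‖ ≤ 1 → χ x = 1)
    (hχ_nontriv : ∃ x : ℚ_[q], ‖x‖ ≤ (q : ℝ) ∧ χ x ≠ 1)
    (ε : ℝ) (hε : 0 < ε) (hε1 : ε < 1) (C₀ : ℝ) (hC₀ : 1 ≤ C₀) :
    ∃ C : ℝ, 0 < C ∧ ∃ R₀ : ℕ, ∀ A : ℕ, 1 / ε ≤ (A : ℝ) → (A : ℝ) ≤ 2 / ε →
      ∀ m : ℕ, R₀ ≤ q ^ (2 * m) →
      ∀ r : ℕ, 4 ∣ r →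
        (q : ℝ) ^ ((q : ℝ) ^ ((A : ℝ) * ((r : ℝ) - 4))) ≤ (q : ℝ) ^ (2 * m) →
        ((q : ℝ) ^ (2 * m) : ℝ) < (q : ℝ) ^ ((q : ℝ) ^ ((A : ℝ) * (r : ℝ))) →
      ∀ N : ℕ, q ^ (N * r) ≤ q ^ (2 * m) → q ^ (2 * m) < q ^ ((N + 1) * r) →
      ∀ J : ℕ, 1 ≤ J → J ≤ N →
      ∀ f : ℚ_[q] × ℚ_[q] → ℂ, IsLocallyConstant f → HasCompactSupport f →
      (∀ p : ℚ_[q] × ℚ_[q],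
        ¬ (‖p.1‖ ≤ 1 ∧ ‖p.2 - p.1 ^ 2‖ ≤ (q : ℝ) ^ (-((J * r : ℕ) : ℤ))) →
        qpFourier q μ χ f p = 0) →
      ∀ α : ℝ, 0 < α →
      α ^ 6 * ((μ.prod μ)
          {x : ℚ_[q] × ℚ_[q] |
            (C₀⁻¹ * α ≤ qpMaxPair q μ χ f (r / 2) 0 0 x ∧
              qpMaxPair q μ χ f (r / 2) 0 0 x ≤ C₀ * α) ∧
            (∑ b ∈ Finset.range (q ^ (r / 2)),
                ‖qpProj q μ χ f (qpItv q (r / 2) b) x‖ ^ 6) ^ ((1 : ℝ) / 6)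
              ≤ C₀ * (Real.log ((q : ℝ) ^ (2 * m)) * ((q : ℝ) ^ (r / 2) * α))}).toReal
        ≤ C * (Real.log ((q : ℝ) ^ (2 * m))) ^ ((7 : ℝ) + 7 * ε / 2) *
            (∑ b ∈ Finset.range (q ^ (J * (r / 2))),
                (⨆ x, ‖qpProj q μ χ f (qpItv q (J * (r / 2)) b) x‖) ^ 2) ^ 2 *
            ∑ b ∈ Finset.range (q ^ (J * (r / 2))),
              ∫ x, ‖qpProj q μ χ f (qpItv q (J * (r / 2)) b) x‖ ^ 2 ∂(μ.prod μ) := by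
  have hqp : q.Prime := Fact.out
  have hq3 : 3 ≤ q := by
    have := hqp.two_le
    omega
  have hq0 : (0 : ℝ) < q := qp_pos
  have hC0 : 0 < C₀ := by linarith
  refine ⟨20000 * C₀ ^ 10 * (q : ℝ) ^ 12, by positivity, 2, ?_⟩
  intro A hA _ m hm r hr hR _ N hN hN' J hJ hJN f _ hf hsupp α hα
  have hm1 : 1 ≤ m := by
    by_contra h
    have : m = 0 := by omega
    subst this
    simp at hm
  have hN1 : N * r ≤ 2 * m := (Nat.pow_le_pow_iff_right hqp.one_lt).mp hN
  have hN2 : 2 * m < (N + 1) * r := (Nat.pow_lt_pow_iff_right hqp.one_lt).mp hN'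
  have hr0 : 4 ≤ r := by
    have : r ≠ 0 := by rintro rfl; simp at hN2
    omega
  have hJm : J ≤ 2 * m := by nlinarith
  obtain ⟨hl1, hnum⟩ := final_numerics hq3 hε hA hr hr0 hR hm1 hJm hJ
  set l := Real.log ((q : ℝ) ^ (2 * m)) with hl
  have hs : FSupp q μ χ f (J * (r / 2)) := by
    intro p hp
    apply hsupp p
    have : 2 * (J * (r / 2)) = J * r := by
      obtain ⟨k, rfl⟩ := hr
      rw [show 4 * k / 2 = 2 * k by omega]; ring
    rwa [this] at hp
  have hqr : (1 : ℝ) ≤ (q : ℝ) ^ (r / 2) := one_le_pow₀ (qp_one_lt (q := q)).le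
  have hL : 1 ≤ C₀ * (l * (q : ℝ) ^ (r / 2)) :=
    one_le_mul_of_one_le_of_one_le hC₀ (one_le_mul_of_one_le_of_one_le hl1 hqr)
  refine (padic_level hq2 hμ hχ_mul hχ_triv hχ_nontriv hf hJ hs hα hC₀ hL _ ?_).trans ?_
  · rintro x ⟨⟨h1, -⟩, h2⟩
    constructor
    · have := maxPair_exists (by positivity) h1
      rwa [inv_mul_eq_div] at this
    · intro b hb
      refine (six_le h2 b hb).trans (le_of_eq (by ring))
  · gcongr ?_ * _ * _
    calc 20000 * C₀ ^ 8 * (J : ℝ) ^ 5 * (C₀ * (l * (q : ℝ) ^ (r / 2))) ^ 2 * (q : ℝ) ^ (4 * (r / 2))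
        = 20000 * C₀ ^ 10 * ((J : ℝ) ^ 5 * (l * (q : ℝ) ^ (r / 2)) ^ 2 * (q : ℝ) ^ (4 * (r / 2))) := by ring
      _ ≤ 20000 * C₀ ^ 10 * ((q : ℝ) ^ 12 * l ^ ((7 : ℝ) + 7 * ε / 2)) := by gcongr
      _ = _ := by ring
end

section
/- Let δ = q^{-2m} with m ∈ ℕ, m ≥ 1. Let I₁, I₂ ⊂ ℤ_q be intervals (not necessarily of the same length) whose mutual distance κ := inf{|ξ₁ − ξ₂| : ξ₁ ∈ I₁, ξ₂ ∈ I₂} satisfies κ ≥ δ^{1/2}. For i = 1, 2 let f_i : ℚ_q² → ℂ be a Schwartz function whose Fourier transform vanishes outside {(ξ,η) ∈ ℚ_q² : ξ ∈ I_i, |η − ξ²| ≤ δ}. Then ∫_{ℚ_q²} |f₁ f₂|² dμ² ≤ (δ²/κ) (∫_{ℚ_q²} |f₁|² dμ²)(∫_{ℚ_q²} |f₂|² dμ²). -/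
open MeasureTheory

namespace BR
variable {q : ℕ} [Fact q.Prime]

lemma one_lt_q : (1:ℝ) < q := by exact_mod_cast (Fact.out : q.Prime).one_lt
lemma q_pos : (0:ℝ) < q := lt_trans one_pos one_lt_q

lemma ball_step (μ : Measure ℚ_[q]) [μ.IsAddHaarMeasure] (n : ℤ) :
    μ (Metric.closedBall 0 ((q:ℝ)^(n+1))) = q * μ (Metric.closedBall 0 ((q:ℝ)^n)) := by
  have hq0 : (q:ℚ_[q]) ≠ 0 := by exact_mod_cast (Fact.out : q.Prime).ne_zero
  have hqn := q_pos (q := q)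
  have hU : Metric.closedBall (0:ℚ_[q]) ((q:ℝ)^(n+1)) =
      ⋃ i : Fin q, Metric.closedBall (((i:ℕ):ℚ_[q]) * (q:ℚ_[q])^(-(n+1))) ((q:ℝ)^n) := by
    ext x
    simp only [Metric.mem_closedBall, dist_zero_right, Set.mem_iUnion]
    constructor
    · intro hx
      have h1 : ‖x * (q:ℚ_[q])^(n+1)‖ ≤ 1 := by
        rw [norm_mul, Padic.norm_p_zpow, zpow_neg]
        exact mul_inv_le_one_of_le₀ hx (by positivity)
      let y : ℤ_[q] := ⟨_, h1⟩
      obtain ⟨i, hi, hi2⟩ := PadicInt.exists_mem_range (p := q) y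
      refine ⟨⟨i, hi⟩, ?_⟩
      have hi2 : ‖y - (i:ℤ_[q])‖ < 1 := PadicInt.mem_nonunits.1 hi2
      have h3 : ‖x * (q:ℚ_[q])^(n+1) - (i:ℚ_[q])‖ < 1 := by
        rw [PadicInt.norm_def, PadicInt.coe_sub, PadicInt.coe_natCast] at hi2
        exact hi2
      have h4 := (Padic.norm_lt_pow_iff_norm_le_pow_sub_one (p := q) _ 0).1 (by simpa using h3)
      have h5 : x - (i:ℚ_[q]) * (q:ℚ_[q])^(-(n+1)) =
          (x * (q:ℚ_[q])^(n+1) - (i:ℚ_[q])) * (q:ℚ_[q])^(-(n+1)) := by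
        rw [zpow_neg]; field_simp
      rw [dist_eq_norm, h5, norm_mul, Padic.norm_p_zpow, neg_neg]
      calc _ ≤ (q:ℝ)^(0-1:ℤ) * (q:ℝ)^(n+1) := by gcongr
        _ = _ := by rw [← zpow_add₀ hqn.ne']; congr 1; ring
    · rintro ⟨i, hi⟩
      have h1 : ‖((i:ℕ):ℚ_[q]) * (q:ℚ_[q])^(-(n+1))‖ ≤ (q:ℝ)^(n+1) := by
        rw [norm_mul, Padic.norm_p_zpow, neg_neg]
        have := Padic.norm_int_le_one (p := q) (i:ℕ)
        simp only [Int.cast_natCast] at this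
        exact mul_le_of_le_one_left (by positivity) this
      have h2 : (q:ℝ)^n ≤ (q:ℝ)^(n+1) := zpow_le_zpow_right₀ one_lt_q.le (by omega)
      rw [dist_eq_norm] at hi
      have := Padic.nonarchimedean (x - ((i:ℕ):ℚ_[q]) * (q:ℚ_[q])^(-(n+1))) (((i:ℕ):ℚ_[q]) * (q:ℚ_[q])^(-(n+1)))
      rw [sub_add_cancel] at this
      exact this.trans (max_le (hi.trans h2) h1)
  rw [hU, measure_iUnion]
  · have : ∀ i : Fin q, μ (Metric.closedBall (((i:ℕ):ℚ_[q]) * (q:ℚ_[q])^(-(n+1))) ((q:ℝ)^n))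
        = μ (Metric.closedBall 0 ((q:ℝ)^n)) := fun i => Measure.addHaar_closedBall_center μ _ _
    simp only [this, tsum_fintype, Finset.sum_const, Finset.card_univ, Fintype.card_fin, nsmul_eq_mul]
  · intro i j hij
    simp only [Function.onFun]
    rw [Set.disjoint_left]
    intro x hxi hxj
    rw [Metric.mem_closedBall, dist_eq_norm] at hxi hxj
    have h := Padic.nonarchimedean (x - ((j:ℕ):ℚ_[q]) * (q:ℚ_[q])^(-(n+1)))
      (-(x - ((i:ℕ):ℚ_[q]) * (q:ℚ_[q])^(-(n+1))))
    rw [norm_neg] at h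
    have h2 := h.trans (max_le hxj hxi)
    have h3 : x - ((j:ℕ):ℚ_[q]) * (q:ℚ_[q])^(-(n+1)) +
      (-(x - ((i:ℕ):ℚ_[q]) * (q:ℚ_[q])^(-(n+1)))) =
      (((i:ℤ) - (j:ℤ) : ℤ) : ℚ_[q]) * (q:ℚ_[q])^(-(n+1)) := by push_cast; ring
    rw [h3, norm_mul, Padic.norm_p_zpow, neg_neg] at h2
    have h4 : ‖(((i:ℤ) - (j:ℤ) : ℤ) : ℚ_[q])‖ < 1 := by
      by_contra hc
      push Not at hc
      have : (q:ℝ)^n < (q:ℝ)^(n+1) := zpow_lt_zpow_right₀ one_lt_q (by omega)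
      nlinarith [zpow_pos hqn n]
    rw [Padic.norm_intCast_lt_one_iff] at h4
    apply hij
    have hi := i.2
    have hj := j.2
    have := Int.eq_zero_of_abs_lt_dvd h4 (by rw [abs_lt]; omega)
    ext; omega
  · intro i; exact Metric.isClosed_closedBall.measurableSet

lemma ball_measure (μ : Measure ℚ_[q]) [μ.IsAddHaarMeasure]
    (hμ : μ {x : ℚ_[q] | ‖x‖ ≤ 1} = 1) (c : ℚ_[q]) (n : ℤ) :
    μ (Metric.closedBall c ((q:ℝ)^n)) = ENNReal.ofReal ((q:ℝ)^n) := by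
  have hqn := q_pos (q := q)
  rw [Measure.addHaar_closedBall_center μ]
  have hqE : (q:ENNReal) = ENNReal.ofReal q := by simp
  induction n with
  | zero =>
    simp only [zpow_zero, ENNReal.ofReal_one]
    rw [← hμ]; congr 1; ext; simp
  | succ n ih =>
    rw [ball_step, ih, hqE, ← ENNReal.ofReal_mul hqn.le, zpow_add_one₀ hqn.ne', mul_comm]
  | pred n ih =>
    have h := ball_step μ (-(n:ℤ)-1)
    rw [sub_add_cancel, ih] at h
    have h2 : ENNReal.ofReal ((q:ℝ)^(-(n:ℤ))) = q * ENNReal.ofReal ((q:ℝ)^(-(n:ℤ)-1)) := by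
      rw [hqE, ← ENNReal.ofReal_mul hqn.le, zpow_sub_one₀ hqn.ne']; congr 1; field_simp
    rw [h2] at h
    exact ((ENNReal.mul_right_inj (by simpa using hqn.ne') (by simp)).1 h).symm

/-- the standard bilinear pairing -/
noncomputable def dot (s x : ℚ_[q] × ℚ_[q]) : ℚ_[q] := s.1 * x.1 + s.2 * x.2

lemma norm_dot_le (s x : ℚ_[q] × ℚ_[q]) : ‖dot s x‖ ≤ ‖s‖ * ‖x‖ := by
  refine (Padic.nonarchimedean _ _).trans (max_le ?_ ?_) <;> rw [norm_mul]
  · exact mul_le_mul (norm_fst_le s) (norm_fst_le x) (norm_nonneg _) (norm_nonneg _)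
  · exact mul_le_mul (norm_snd_le s) (norm_snd_le x) (norm_nonneg _) (norm_nonneg _)

lemma norm_add_le_max' (x y : ℚ_[q] × ℚ_[q]) : ‖x + y‖ ≤ max ‖x‖ ‖y‖ := by
  rw [Prod.norm_def]
  refine max_le ?_ ?_
  · exact (Padic.nonarchimedean _ _).trans (max_le_max (norm_fst_le x) (norm_fst_le y))
  · exact (Padic.nonarchimedean _ _).trans (max_le_max (norm_snd_le x) (norm_snd_le y))

lemma norm_add_le_of (x y : ℚ_[q] × ℚ_[q]) {r : ℝ} (hx : ‖x‖ ≤ r) (hy : ‖y‖ ≤ r) : ‖x + y‖ ≤ r :=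
  (norm_add_le_max' x y).trans (max_le hx hy)

lemma norm_add_le_iff (x y : ℚ_[q] × ℚ_[q]) {r : ℝ} (hy : ‖y‖ ≤ r) : ‖x + y‖ ≤ r ↔ ‖x‖ ≤ r := by
  refine ⟨fun h => ?_, fun h => norm_add_le_of x y h hy⟩
  have := norm_add_le_of (x + y) (-y) h (by rwa [norm_neg])
  rwa [add_neg_cancel_right] at this

lemma dot_add_left (s t x : ℚ_[q] × ℚ_[q]) : dot (s + t) x = dot s x + dot t x := by
  simp [dot]; ring
lemma dot_add_right (s x y : ℚ_[q] × ℚ_[q]) : dot s (x + y) = dot s x + dot s y := by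
  simp [dot]; ring
lemma dot_sub_right (s x y : ℚ_[q] × ℚ_[q]) : dot s (x - y) = dot s x + - dot s y := by
  simp [dot]; ring
lemma dot_comm (s x : ℚ_[q] × ℚ_[q]) : dot s x = dot x s := by
  simp [dot]; ring

/-- the character hypotheses -/
structure IsChar (χ : ℚ_[q] → ℂ) : Prop where
  mul : ∀ x y : ℚ_[q], χ (x + y) = χ x * χ y
  norm : ∀ x : ℚ_[q], ‖χ x‖ = 1
  triv : ∀ x : ℚ_[q], ‖x‖ ≤ 1 → χ x = 1
  nontriv : ∃ x : ℚ_[q], ‖x‖ ≤ (q : ℝ) ∧ χ x ≠ 1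

variable {χ : ℚ_[q] → ℂ}

lemma IsChar.cont (h : IsChar χ) : Continuous χ := by
  rw [Metric.continuous_iff]
  intro b ε hε
  refine ⟨1, one_pos, fun a ha => ?_⟩
  rw [dist_eq_norm] at ha
  have : χ a = χ b := by
    rw [← sub_add_cancel a b, h.mul, h.triv _ ha.le, one_mul]
  simpa [this] using hε

lemma IsChar.neg (h : IsChar χ) (x : ℚ_[q]) : χ (-x) = (starRingEnd ℂ) (χ x) := by
  have h1 : χ x * χ (-x) = 1 := by
    rw [← h.mul, add_neg_cancel, h.triv 0 (by simp)]
  have h2 : χ x * (starRingEnd ℂ) (χ x) = 1 := by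
    rw [Complex.mul_conj, Complex.normSq_eq_norm_sq, h.norm]; simp
  have h0 : χ x ≠ 0 := left_ne_zero_of_mul_eq_one h1
  exact mul_left_cancel₀ h0 (h1.trans h2.symm)

lemma zpow_lt_norm (x : ℚ_[q]) {n : ℤ} (h : (q:ℝ)^n < ‖x‖) : (q:ℝ)^(n+1) ≤ ‖x‖ := by
  by_contra hc
  push Not at hc
  exact absurd ((Padic.norm_le_pow_iff_norm_lt_pow_add_one x n).2 hc) (not_le.2 h)

lemma IsChar.exists_ne (h : IsChar χ) (n : ℤ) (u : ℚ_[q] × ℚ_[q]) (hu : (q:ℝ)^(-n) < ‖u‖) :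
    ∃ s : ℚ_[q] × ℚ_[q], ‖s‖ ≤ (q:ℝ)^n ∧ χ (dot s u) ≠ 1 := by
  obtain ⟨z, hz, hz1⟩ := h.nontriv
  have key : ∀ v : ℚ_[q], (q:ℝ)^(-n) < ‖v‖ → ‖z / v‖ ≤ (q:ℝ)^n ∧ v ≠ 0 := by
    intro v hv
    have hv0 : 0 < ‖v‖ := lt_trans (zpow_pos q_pos _) hv
    refine ⟨?_, norm_pos_iff.1 hv0⟩
    rw [norm_div, div_le_iff₀ hv0]
    have h1 := zpow_lt_norm v hv
    calc ‖z‖ ≤ q := hz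
      _ = (q:ℝ)^n * (q:ℝ)^(-n+1) := by
        rw [← zpow_add₀ q_pos.ne']; simp
      _ ≤ _ := by have := zpow_pos (q_pos (q := q)) n; gcongr
  rw [Prod.norm_def, lt_max_iff] at hu
  rcases hu with hu | hu
  · obtain ⟨h1, h2⟩ := key _ hu
    refine ⟨(z / u.1, 0), ?_, ?_⟩
    · simpa [Prod.norm_def, zpow_nonneg q_pos.le] using h1
    · simpa [dot, h2] using hz1
  · obtain ⟨h1, h2⟩ := key _ hu
    refine ⟨(0, z / u.2), ?_, ?_⟩
    · simpa [Prod.norm_def, zpow_nonneg q_pos.le] using h1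
    · simpa [dot, h2] using hz1

/-- Schwartz at scale N -/
structure Sch (N : ℤ) (f : ℚ_[q] × ℚ_[q] → ℂ) : Prop where
  inv : ∀ x h, ‖h‖ ≤ (q:ℝ)^(-N) → f (x + h) = f x
  supp : ∀ x, f x ≠ 0 → ‖x‖ ≤ (q:ℝ)^N

lemma Sch.cont {N : ℤ} {f : ℚ_[q] × ℚ_[q] → ℂ} (h : Sch N f) : Continuous f := by
  rw [Metric.continuous_iff]
  intro b ε hε
  refine ⟨(q:ℝ)^(-N), zpow_pos q_pos _, fun a ha => ?_⟩
  rw [dist_eq_norm] at ha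
  have : f a = f b := by
    rw [← add_sub_cancel b a, h.inv _ _ ha.le]
  simpa [this] using hε

lemma Sch.compact {N : ℤ} {f : ℚ_[q] × ℚ_[q] → ℂ} (h : Sch N f) : HasCompactSupport f := by
  refine HasCompactSupport.intro (isCompact_closedBall 0 ((q:ℝ)^N)) fun x hx => ?_
  by_contra hc
  exact hx (by simpa using h.supp x hc)

lemma Sch.integrable {N : ℤ} {f : ℚ_[q] × ℚ_[q] → ℂ} (h : Sch N f)
    (ν : Measure (ℚ_[q] × ℚ_[q])) [IsFiniteMeasureOnCompacts ν] : Integrable f ν :=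
  h.cont.integrable_of_hasCompactSupport h.compact

lemma exists_sch {f : ℚ_[q] × ℚ_[q] → ℂ} (hf : IsLocallyConstant f) (hc : HasCompactSupport f) :
    ∃ N₀ : ℤ, ∀ N ≥ N₀, Sch N f := by
  obtain ⟨R, hR⟩ := hc.isCompact.isBounded.exists_norm_le
  obtain ⟨n, hn⟩ := pow_unbounded_of_one_lt R (one_lt_q (q := q))
  have hs : ∀ x, f x ≠ 0 → ‖x‖ ≤ (q:ℝ)^n := fun x hx => (hR x (subset_tsupport f hx)).trans hn.le
  obtain ⟨δ, hδ, hL⟩ := lebesgue_number_lemma_of_metric (s := Metric.closedBall (0 : ℚ_[q] × ℚ_[q]) ((q:ℝ)^n))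
    (c := fun z : ℂ => f ⁻¹' {z}) (isCompact_closedBall _ _) (fun z => hf {z}) (by
      intro x _; simp)
  obtain ⟨k, hk⟩ := exists_pow_lt_of_lt_one hδ (inv_lt_one_of_one_lt₀ (one_lt_q (q := q)))
  have hq1 := (one_lt_q (q := q)).le
  refine ⟨max n k, fun N hN => ⟨fun x h hh => ?_, fun x hx => (hs x hx).trans ?_⟩⟩
  · by_cases hx : ‖x‖ ≤ (q:ℝ)^n
    · obtain ⟨z, hz⟩ := hL x (by simpa using hx)
      have h1 : f x = z := hz (Metric.mem_ball_self hδ)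
      have h2 : f (x + h) = z := hz (by
        rw [Metric.mem_ball, dist_eq_norm, add_sub_cancel_left]
        refine hh.trans_lt (lt_of_le_of_lt ?_ hk)
        rw [inv_pow, ← zpow_natCast, ← zpow_neg]
        exact zpow_le_zpow_right₀ hq1 (by omega))
      rw [h1, h2]
    · have hh' : ‖h‖ ≤ (q:ℝ)^n := by
        refine hh.trans ?_
        rw [← zpow_natCast]
        exact zpow_le_zpow_right₀ hq1 (by omega)
      have hx' : ¬ ‖x + h‖ ≤ (q:ℝ)^n := by rwa [norm_add_le_iff _ _ hh']
      rw [not_imp_comm.1 (hs x) hx, not_imp_comm.1 (hs (x+h)) hx']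
  · rw [← zpow_natCast]
    exact zpow_le_zpow_right₀ hq1 (by omega)

lemma continuous_dot : Continuous fun p : (ℚ_[q] × ℚ_[q]) × (ℚ_[q] × ℚ_[q]) => dot p.1 p.2 := by
  unfold dot; fun_prop

lemma fub {ν : Measure (ℚ_[q] × ℚ_[q])} [SFinite ν] {F G : ℚ_[q] × ℚ_[q] → ℂ}
    (hF : Integrable F ν) (hG : Integrable G ν)
    {k : (ℚ_[q] × ℚ_[q]) × (ℚ_[q] × ℚ_[q]) → ℂ} (hk : Continuous k) (hk1 : ∀ p, ‖k p‖ = 1) :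
    Integrable (fun p : (ℚ_[q] × ℚ_[q]) × (ℚ_[q] × ℚ_[q]) => F p.1 * G p.2 * k p) (ν.prod ν) :=
  (hF.mul_prod hG).mul_bdd (c := 1) hk.aestronglyMeasurable
    (Filter.Eventually.of_forall fun p => (hk1 p).le)

variable {μ : Measure ℚ_[q]} [μ.IsAddHaarMeasure] [SigmaFinite μ]

lemma ball2_measure (hμ : μ {x : ℚ_[q] | ‖x‖ ≤ 1} = 1) (c : ℚ_[q] × ℚ_[q]) (n : ℤ) :
    (μ.prod μ).real (Metric.closedBall c ((q:ℝ)^n)) = ((q:ℝ)^n)^2 := by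
  have h0 : (0:ℝ) ≤ (q:ℝ)^n := zpow_nonneg q_pos.le _
  rw [← Prod.mk.eta (p := c), ← closedBall_prod_same, measureReal_def, Measure.prod_prod, ball_measure μ hμ,
    ball_measure μ hμ, ENNReal.toReal_mul, ENNReal.toReal_ofReal h0, sq]

lemma four_eq (f : ℚ_[q] × ℚ_[q] → ℂ) (p : ℚ_[q] × ℚ_[q]) :
    qpFourier q μ χ f p = ∫ x, f x * χ (-(dot p x)) ∂(μ.prod μ) := rfl

lemma four_sch (hχ : IsChar χ) {N : ℤ} {f : ℚ_[q] × ℚ_[q] → ℂ} (h : Sch N f) :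
    Sch N (qpFourier q μ χ f) := by
  constructor
  · intro p s hs
    rw [four_eq, four_eq]
    refine integral_congr_ae (Filter.Eventually.of_forall fun x => ?_)
    by_cases hx : f x = 0
    · simp [hx]
    have h1 := h.supp x hx
    have h2 : ‖-dot s x‖ ≤ 1 := by
      rw [norm_neg]
      refine (norm_dot_le s x).trans ?_
      calc ‖s‖ * ‖x‖ ≤ (q:ℝ)^(-N) * (q:ℝ)^N := by
            have := zpow_pos (q_pos (q := q)) (-N); gcongr
        _ = 1 := by rw [← zpow_add₀ q_pos.ne']; simp
    simp only
    rw [dot_add_left, neg_add, hχ.mul, hχ.triv _ h2, mul_one]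
  · intro p hp
    by_contra hc
    push Not at hc
    obtain ⟨s, hs, hs1⟩ := hχ.exists_ne (-N) p (by simpa using hc)
    apply hp
    have e : qpFourier q μ χ f p = χ (dot s p) * qpFourier q μ χ f p := by
      conv_lhs => rw [four_eq, ← integral_sub_right_eq_self _ s]
      rw [four_eq, ← integral_const_mul]
      refine integral_congr_ae (Filter.Eventually.of_forall fun x => ?_)
      simp only
      have : f (x - s) = f x := by
        rw [sub_eq_add_neg]; exact h.inv _ _ (by rwa [norm_neg])
      rw [this, dot_sub_right, neg_add, neg_neg, hχ.mul, dot_comm p s]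
      ring
    have : (1 - χ (dot s p)) * qpFourier q μ χ f p = 0 := by linear_combination e
    exact (mul_eq_zero.1 this).resolve_left (sub_ne_zero.2 hs1.symm)

lemma ortho (hμ : μ {x : ℚ_[q] | ‖x‖ ≤ 1} = 1) (hχ : IsChar χ) (n : ℤ) (u : ℚ_[q] × ℚ_[q]) :
    ∫ s, (Metric.closedBall (0 : ℚ_[q] × ℚ_[q]) ((q:ℝ)^n)).indicator (1 : ℚ_[q] × ℚ_[q] → ℂ) s * χ (dot s u) ∂(μ.prod μ) =
      (Metric.closedBall (0 : ℚ_[q] × ℚ_[q]) ((q:ℝ)^(-n))).indicator (fun _ => (((q:ℝ)^n)^2 : ℂ)) u := by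
  by_cases hu : ‖u‖ ≤ (q:ℝ)^(-n)
  · rw [Set.indicator_of_mem (by simpa using hu)]
    have : ∀ s, (Metric.closedBall (0 : ℚ_[q] × ℚ_[q]) ((q:ℝ)^n)).indicator (1 : ℚ_[q] × ℚ_[q] → ℂ) s * χ (dot s u)
        = (Metric.closedBall (0 : ℚ_[q] × ℚ_[q]) ((q:ℝ)^n)).indicator (1 : ℚ_[q] × ℚ_[q] → ℂ) s := by
      intro s
      by_cases hs : s ∈ Metric.closedBall (0 : ℚ_[q] × ℚ_[q]) ((q:ℝ)^n)
      · have hs' : ‖s‖ ≤ (q:ℝ)^n := by simpa using hs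
        rw [hχ.triv, mul_one]
        refine (norm_dot_le s u).trans ?_
        calc ‖s‖ * ‖u‖ ≤ (q:ℝ)^n * (q:ℝ)^(-n) := by
              have := zpow_pos (q_pos (q := q)) n; gcongr
          _ = 1 := by rw [← zpow_add₀ q_pos.ne']; simp
      · rw [Set.indicator_of_notMem hs, zero_mul]
    simp_rw [this]
    rw [integral_indicator Metric.isClosed_closedBall.measurableSet]
    simp only [Pi.one_apply, integral_const, measureReal_restrict_apply_univ]
    rw [ball2_measure hμ, Complex.real_smul]
    push_cast; ring
  · rw [Set.indicator_of_notMem (by simpa using hu)]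
    push Not at hu
    obtain ⟨t, ht, ht1⟩ := hχ.exists_ne n u hu
    set I := ∫ s, (Metric.closedBall (0 : ℚ_[q] × ℚ_[q]) ((q:ℝ)^n)).indicator (1 : ℚ_[q] × ℚ_[q] → ℂ) s * χ (dot s u) ∂(μ.prod μ) with hI
    have e : I = χ (dot t u) * I := by
      conv_lhs => rw [hI, ← integral_add_right_eq_self _ t]
      rw [hI, ← integral_const_mul]
      refine integral_congr_ae (Filter.Eventually.of_forall fun s => ?_)
      have hm : s + t ∈ Metric.closedBall (0 : ℚ_[q] × ℚ_[q]) ((q:ℝ)^n) ↔ s ∈ Metric.closedBall (0 : ℚ_[q] × ℚ_[q]) ((q:ℝ)^n) := by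
        simpa using norm_add_le_iff s t ht
      simp only [dot_add_left, hχ.mul]
      by_cases hs : s ∈ Metric.closedBall (0 : ℚ_[q] × ℚ_[q]) ((q:ℝ)^n)
      · rw [Set.indicator_of_mem hs, Set.indicator_of_mem (hm.2 hs)]
        simp only [Pi.one_apply]; ring
      · rw [Set.indicator_of_notMem hs, Set.indicator_of_notMem (mt hm.1 hs)]
        ring
    have : (1 - χ (dot t u)) * I = 0 := by linear_combination e
    exact (mul_eq_zero.1 this).resolve_left (sub_ne_zero.2 ht1.symm)

lemma inversion (hμ : μ {x : ℚ_[q] | ‖x‖ ≤ 1} = 1) (hχ : IsChar χ) {N : ℤ} {f : ℚ_[q] × ℚ_[q] → ℂ} (h : Sch N f)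
    (x : ℚ_[q] × ℚ_[q]) :
    f x = ∫ s, qpFourier q μ χ f s * χ (dot s x) ∂(μ.prod μ) := by
  symm
  set B := Metric.closedBall (0 : ℚ_[q] × ℚ_[q]) ((q:ℝ)^N) with hB
  have hBm : MeasurableSet B := Metric.isClosed_closedBall.measurableSet
  have hBi : Integrable (B.indicator (1 : ℚ_[q] × ℚ_[q] → ℂ)) (μ.prod μ) := by
    rw [integrable_indicator_iff hBm]
    exact integrableOn_const (isCompact_closedBall _ _).measure_lt_top.ne
  have e1 : ∀ s, qpFourier q μ χ f s * χ (dot s x) =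
      ∫ y, B.indicator (1 : ℚ_[q] × ℚ_[q] → ℂ) s * f y * χ (dot s (x - y)) ∂(μ.prod μ) := by
    intro s
    by_cases hs : s ∈ B
    · rw [Set.indicator_of_mem hs, four_eq, ← integral_mul_const]
      refine integral_congr_ae (Filter.Eventually.of_forall fun y => ?_)
      simp only [dot_sub_right, hχ.mul, Pi.one_apply]
      ring
    · rw [Set.indicator_of_notMem hs]
      have : qpFourier q μ χ f s = 0 := by
        by_contra hc
        exact hs (by simpa [hB] using (four_sch hχ h).supp s hc)
      simp [this]
  simp_rw [e1]
  rw [integral_integral_swap]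
  · have e2 : ∀ y, ∫ s, B.indicator (1 : ℚ_[q] × ℚ_[q] → ℂ) s * f y * χ (dot s (x - y)) ∂(μ.prod μ) =
        (Metric.closedBall x ((q:ℝ)^(-N))).indicator (fun _ => f x * (((q:ℝ)^N)^2 : ℂ)) y := by
      intro y
      have : ∀ s, B.indicator (1 : ℚ_[q] × ℚ_[q] → ℂ) s * f y * χ (dot s (x - y)) =
        f y * (B.indicator (1 : ℚ_[q] × ℚ_[q] → ℂ) s * χ (dot s (x - y))) := fun s => by ring
      simp_rw [this]
      rw [integral_const_mul, ortho hμ hχ]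
      by_cases hy : ‖x - y‖ ≤ (q:ℝ)^(-N)
      · rw [Set.indicator_of_mem (by simpa using hy), Set.indicator_of_mem (by
          rw [Metric.mem_closedBall, dist_comm, dist_eq_norm]; exact hy)]
        rw [← h.inv y _ hy, add_sub_cancel]
      · rw [Set.indicator_of_notMem (by simpa using hy), Set.indicator_of_notMem (by
          rw [Metric.mem_closedBall, dist_comm, dist_eq_norm]; exact hy), mul_zero]
    simp_rw [e2]
    rw [integral_indicator_const _ Metric.isClosed_closedBall.measurableSet, ball2_measure hμ, zpow_neg]
    have hq : (q:ℂ)^N ≠ 0 := zpow_ne_zero _ (by exact_mod_cast (Fact.out : q.Prime).ne_zero)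
    rw [Complex.real_smul]
    push_cast
    field_simp
  · refine fub hBi (h.integrable _) (k := fun p => χ (dot p.1 (x - p.2))) ?_ (fun p => hχ.norm _)
    exact hχ.cont.comp (continuous_dot.comp (by fun_prop : Continuous fun p : (ℚ_[q] × ℚ_[q]) × (ℚ_[q] × ℚ_[q]) => (p.1, x - p.2)))

lemma four_mul (hμ : μ {x : ℚ_[q] | ‖x‖ ≤ 1} = 1) (hχ : IsChar χ) {N : ℤ} {f g : ℚ_[q] × ℚ_[q] → ℂ}
    (hf : Sch N f) (hg : Sch N g) (p : ℚ_[q] × ℚ_[q]) :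
    qpFourier q μ χ (fun x => f x * g x) p =
      ∫ s, qpFourier q μ χ f s * qpFourier q μ χ g (p - s) ∂(μ.prod μ) := by
  have e1 : ∀ x, f x * g x * χ (-dot p x) =
      ∫ s, g x * qpFourier q μ χ f s * χ (- dot (p - s) x) ∂(μ.prod μ) := by
    intro x
    rw [inversion hμ hχ hf x, mul_assoc, ← integral_mul_const]
    refine integral_congr_ae (Filter.Eventually.of_forall fun s => ?_)
    have : -dot (p - s) x = dot s x + - dot p x := by simp [dot]; ring
    simp only [this, hχ.mul]
    ring
  rw [four_eq]
  simp_rw [e1]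
  rw [integral_integral_swap]
  · refine integral_congr_ae (Filter.Eventually.of_forall fun s => ?_)
    simp only
    rw [four_eq g, ← integral_const_mul]
    refine integral_congr_ae (Filter.Eventually.of_forall fun x => ?_)
    simp only; ring
  · refine fub (hg.integrable _) ((four_sch hχ hf).integrable _) (k := fun z => χ (- dot (p - z.2) z.1)) ?_ (fun p => hχ.norm _)
    exact hχ.cont.comp (continuous_dot.comp (by fun_prop : Continuous fun z : (ℚ_[q] × ℚ_[q]) × (ℚ_[q] × ℚ_[q]) => (p - z.2, z.1))).neg

lemma parseval (hμ : μ {x : ℚ_[q] | ‖x‖ ≤ 1} = 1) (hχ : IsChar χ) {N : ℤ} {f : ℚ_[q] × ℚ_[q] → ℂ}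
    (hf : Sch N f) :
    ∫ x, ‖f x‖^2 ∂(μ.prod μ) = ∫ s, ‖qpFourier q μ χ f s‖^2 ∂(μ.prod μ) := by
  have e1 : ∀ x, ((‖f x‖^2 : ℝ) : ℂ) =
      ∫ s, (starRingEnd ℂ) (f x) * qpFourier q μ χ f s * χ (dot s x) ∂(μ.prod μ) := by
    intro x
    simp_rw [mul_assoc]
    rw [integral_const_mul, ← inversion hμ hχ hf x, mul_comm, Complex.mul_conj, Complex.normSq_eq_norm_sq]
  have hfc : Integrable (fun x => (starRingEnd ℂ) (f x)) (μ.prod μ) :=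
    (Complex.continuous_conj.comp hf.cont).integrable_of_hasCompactSupport
      (hf.compact.comp_left (map_zero _))
  apply Complex.ofReal_injective
  rw [← integral_complex_ofReal, ← integral_complex_ofReal]
  simp_rw [e1]
  rw [integral_integral_swap]
  · refine integral_congr_ae (Filter.Eventually.of_forall fun s => ?_)
    simp only
    rw [← Complex.normSq_eq_norm_sq, ← Complex.mul_conj, four_eq, ← integral_conj, ← integral_const_mul]
    refine integral_congr_ae (Filter.Eventually.of_forall fun x => ?_)
    simp only [map_mul, hχ.neg, Complex.conj_conj]; ring
  · refine fub hfc ((four_sch hχ hf).integrable _) (k := fun z => χ (dot z.2 z.1)) ?_ (fun p => hχ.norm _)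
    exact hχ.cont.comp (continuous_dot.comp (by fun_prop : Continuous fun z : (ℚ_[q] × ℚ_[q]) × (ℚ_[q] × ℚ_[q]) => (z.2, z.1)))

lemma Sch.mul {N : ℤ} {f g : ℚ_[q] × ℚ_[q] → ℂ} (hf : Sch N f) (hg : Sch N g) :
    Sch N (fun x => f x * g x) :=
  ⟨fun x h hh => by simp only [hf.inv x h hh, hg.inv x h hh],
    fun x hx => hf.supp x (left_ne_zero_of_mul hx)⟩

lemma l2_eq {N : ℤ} {f : ℚ_[q] × ℚ_[q] → ℂ} (hf : Sch N f) :
    ENNReal.ofReal (∫ x, ‖f x‖^2 ∂(μ.prod μ)) = ∫⁻ x, ‖f x‖ₑ^2 ∂(μ.prod μ) := by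
  have hcs : HasCompactSupport (fun x => ‖f x‖^2) := by
    refine HasCompactSupport.intro (isCompact_closedBall 0 ((q:ℝ)^N)) fun x hx => ?_
    have : f x = 0 := by
      by_contra hc
      exact hx (by simpa using hf.supp x hc)
    simp [this]
  have hcc : Continuous (fun x => ‖f x‖^2) := hf.cont.norm.pow 2
  have hi : Integrable (fun x => ‖f x‖^2) (μ.prod μ) := hcc.integrable_of_hasCompactSupport hcs
  rw [ofReal_integral_eq_lintegral_ofReal hi]
  · refine lintegral_congr fun x => ?_
    rw [ENNReal.ofReal_pow (norm_nonneg _), ofReal_norm]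
  · exact Filter.Eventually.of_forall fun x => by positivity

lemma conv_bound {N : ℤ} {F G : ℚ_[q] × ℚ_[q] → ℂ} (hF : Sch N F) (hG : Sch N G) (C : ENNReal)
    (hC : ∀ p, (μ.prod μ) {s | F s ≠ 0 ∧ G (p - s) ≠ 0} ≤ C) :
    ∫⁻ p, ‖∫ s, F s * G (p - s) ∂(μ.prod μ)‖ₑ^2 ∂(μ.prod μ) ≤
      C * (∫⁻ s, ‖F s‖ₑ^2 ∂(μ.prod μ)) * ∫⁻ s, ‖G s‖ₑ^2 ∂(μ.prod μ) := by
  have hFc := hF.cont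
  have hGc := hG.cont
  have key : ∀ p, ‖∫ s, F s * G (p - s) ∂(μ.prod μ)‖ₑ^2 ≤
      C * ∫⁻ s, ‖F s‖ₑ^2 * ‖G (p - s)‖ₑ^2 ∂(μ.prod μ) := by
    intro p
    set A := {s | F s ≠ 0 ∧ G (p - s) ≠ 0} with hA
    have hAm : MeasurableSet A := by
      apply IsOpen.measurableSet
      apply IsOpen.inter
      · exact isOpen_ne_fun hFc continuous_const
      · exact isOpen_ne_fun (by fun_prop) continuous_const
    have h1 : ‖∫ s, F s * G (p - s) ∂(μ.prod μ)‖ₑ ≤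
        ∫⁻ s, (A.indicator (1 : ℚ_[q] × ℚ_[q] → ENNReal) * fun s => ‖F s * G (p - s)‖ₑ) s ∂(μ.prod μ) := by
      refine (enorm_integral_le_lintegral_enorm _).trans (lintegral_mono fun s => ?_)
      by_cases hs : s ∈ A
      · simp [Set.indicator_of_mem hs]
      · have : F s * G (p - s) = 0 := by
          by_contra hc
          exact hs ⟨left_ne_zero_of_mul hc, right_ne_zero_of_mul hc⟩
        simp [this]
    have h2 := h1.trans (ENNReal.lintegral_mul_le_Lp_mul_Lq (μ.prod μ) Real.HolderConjugate.two_two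
      ((measurable_one.indicator hAm).aemeasurable)
      (by apply Continuous.aemeasurable; fun_prop))
    have h3 : ∫⁻ s, (A.indicator (1 : ℚ_[q] × ℚ_[q] → ENNReal) s) ^ (2:ℝ) ∂(μ.prod μ) = (μ.prod μ) A := by
      rw [← lintegral_indicator_one hAm]
      refine lintegral_congr fun s => ?_
      by_cases hs : s ∈ A <;> simp [hs]
    have h4 : ∫⁻ s, ‖F s * G (p - s)‖ₑ ^ (2:ℝ) ∂(μ.prod μ) = ∫⁻ s, ‖F s‖ₑ^2 * ‖G (p - s)‖ₑ^2 ∂(μ.prod μ) := by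
      refine lintegral_congr fun s => ?_
      rw [enorm_mul, ENNReal.rpow_two, mul_pow]
    rw [h3, h4] at h2
    have h5 : ∀ a : ENNReal, (a ^ (1 / (2:ℝ)))^2 = a := fun a => by
      rw [← ENNReal.rpow_two, ← ENNReal.rpow_mul]; norm_num
    calc _ ≤ _ := pow_le_pow_left' h2 2
      _ = (μ.prod μ) A * ∫⁻ s, ‖F s‖ₑ^2 * ‖G (p - s)‖ₑ^2 ∂(μ.prod μ) := by
        rw [mul_pow, h5, h5]
      _ ≤ _ := by gcongr; exact hC p
  have hm2 : Measurable fun z : (ℚ_[q] × ℚ_[q]) × (ℚ_[q] × ℚ_[q]) => ‖F z.2‖ₑ^2 * ‖G (z.1 - z.2)‖ₑ^2 := by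
    have h1 : Measurable fun z : (ℚ_[q] × ℚ_[q]) × (ℚ_[q] × ℚ_[q]) => ‖F z.2‖ₑ :=
      Continuous.measurable (by fun_prop)
    have h2 : Measurable fun z : (ℚ_[q] × ℚ_[q]) × (ℚ_[q] × ℚ_[q]) => ‖G (z.1 - z.2)‖ₑ :=
      Continuous.measurable (by fun_prop)
    exact (h1.pow_const 2).mul (h2.pow_const 2)
  have hF2 : Measurable fun s => ‖F s‖ₑ^2 := (Continuous.measurable (by fun_prop : Continuous fun s => ‖F s‖ₑ)).pow_const 2
  have hG2 : Measurable fun s => ‖G s‖ₑ^2 := (Continuous.measurable (by fun_prop : Continuous fun s => ‖G s‖ₑ)).pow_const 2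
  calc _ ≤ ∫⁻ p, C * ∫⁻ s, ‖F s‖ₑ^2 * ‖G (p - s)‖ₑ^2 ∂(μ.prod μ) ∂(μ.prod μ) := lintegral_mono key
    _ = C * ∫⁻ p, ∫⁻ s, ‖F s‖ₑ^2 * ‖G (p - s)‖ₑ^2 ∂(μ.prod μ) ∂(μ.prod μ) :=
        lintegral_const_mul _ hm2.lintegral_prod_right'
    _ = C * ∫⁻ s, ∫⁻ p, ‖F s‖ₑ^2 * ‖G (p - s)‖ₑ^2 ∂(μ.prod μ) ∂(μ.prod μ) := by
        rw [lintegral_lintegral_swap hm2.aemeasurable]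
    _ = C * ∫⁻ s, ‖F s‖ₑ^2 * (∫⁻ p, ‖G p‖ₑ^2 ∂(μ.prod μ)) ∂(μ.prod μ) := by
        congr 1
        refine lintegral_congr fun s => ?_
        have hG3 : Measurable fun p => ‖G (p - s)‖ₑ^2 :=
          (Continuous.measurable (by fun_prop : Continuous fun p => ‖G (p - s)‖ₑ)).pow_const 2
        rw [lintegral_const_mul _ hG3,
          lintegral_sub_right_eq_self (fun p => ‖G p‖ₑ^2) s]
    _ = _ := by rw [lintegral_mul_const _ hF2, mul_assoc]

lemma shear_measure (hμ : μ {x : ℚ_[q] | ‖x‖ ≤ 1} = 1) (c : ℚ_[q]) (i j : ℤ) :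
    (μ.prod μ) {s | ‖s.1 - c‖ ≤ (q:ℝ)^i ∧ ‖s.2 - s.1^2‖ ≤ (q:ℝ)^j} =
      ENNReal.ofReal ((q:ℝ)^i) * ENNReal.ofReal ((q:ℝ)^j) := by
  rw [Measure.prod_apply]
  · have : ∀ x : ℚ_[q], μ (Prod.mk x ⁻¹' {s : ℚ_[q] × ℚ_[q] | ‖s.1 - c‖ ≤ (q:ℝ)^i ∧ ‖s.2 - s.1^2‖ ≤ (q:ℝ)^j}) =
        (Metric.closedBall c ((q:ℝ)^i)).indicator (fun _ => ENNReal.ofReal ((q:ℝ)^j)) x := by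
      intro x
      by_cases hx : ‖x - c‖ ≤ (q:ℝ)^i
      · rw [Set.indicator_of_mem (by simpa [dist_eq_norm] using hx), ← ball_measure μ hμ (x^2)]
        congr 1; ext y; simp [hx, dist_eq_norm]
      · rw [Set.indicator_of_notMem (by simpa [dist_eq_norm] using hx)]
        simp [hx]
    simp_rw [this]
    rw [lintegral_indicator_const Metric.isClosed_closedBall.measurableSet, ball_measure μ hμ, mul_comm]
  · apply IsClosed.measurableSet
    apply IsClosed.inter
    · exact isClosed_le (by fun_prop : Continuous fun s : ℚ_[q] × ℚ_[q] => ‖s.1 - c‖) continuous_const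
    · exact isClosed_le (by fun_prop : Continuous fun s : ℚ_[q] × ℚ_[q] => ‖s.2 - s.1^2‖) continuous_const

lemma geom (hq2 : q ≠ 2) (a₁ a₂ : ℚ_[q]) {r₁ r₂ δ : ℝ} (h1 : r₁ < ‖a₁ - a₂‖) (h2 : r₂ < ‖a₁ - a₂‖)
    (p s s' : ℚ_[q] × ℚ_[q])
    (hs1 : ‖s.1 - a₁‖ ≤ r₁) (hs2 : ‖s.2 - s.1^2‖ ≤ δ)
    (hs3 : ‖(p - s).2 - (p - s).1^2‖ ≤ δ)
    (ht2 : ‖s'.2 - s'.1^2‖ ≤ δ)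
    (ht3 : ‖(p - s').1 - a₂‖ ≤ r₂) (ht4 : ‖(p - s').2 - (p - s').1^2‖ ≤ δ) :
    ‖s.1 - s'.1‖ * ‖a₁ - a₂‖ ≤ δ := by
  have hu : ‖s.1 + s'.1 - p.1‖ = ‖a₁ - a₂‖ := by
    have e : s.1 + s'.1 - p.1 = ((s.1 - a₁) + -((p - s').1 - a₂)) + (a₁ - a₂) := by
      simp only [Prod.fst_sub]; ring
    have hlt : ‖(s.1 - a₁) + -((p - s').1 - a₂)‖ < ‖a₁ - a₂‖ := by
      refine (Padic.nonarchimedean _ _).trans_lt ?_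
      rw [norm_neg]
      exact max_lt (hs1.trans_lt h1) (ht3.trans_lt h2)
    rw [e, Padic.add_eq_max_of_ne hlt.ne, max_eq_right hlt.le]
  have h2n : ‖(2:ℚ_[q])‖ = 1 := by
    have : ‖((2:ℕ):ℚ_[q])‖ = 1 := by
      rw [Padic.norm_natCast_eq_one_iff]
      exact (Nat.coprime_primes (Fact.out) Nat.prime_two).2 hq2
    exact_mod_cast this
  have e2 : 2 * ((s.1 - s'.1) * (s.1 + s'.1 - p.1)) =
      ((s'.2 - s'.1^2) + ((p - s').2 - (p - s').1^2)) + -((s.2 - s.1^2) + ((p - s).2 - (p - s).1^2)) := by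
    simp only [Prod.fst_sub, Prod.snd_sub]; ring
  have e3 : ‖2 * ((s.1 - s'.1) * (s.1 + s'.1 - p.1))‖ ≤ δ := by
    rw [e2]
    refine (Padic.nonarchimedean _ _).trans (max_le ?_ ?_)
    · exact (Padic.nonarchimedean _ _).trans (max_le ht2 ht4)
    · rw [norm_neg]
      exact (Padic.nonarchimedean _ _).trans (max_le hs2 hs3)
  rwa [norm_mul, norm_mul, h2n, one_mul, hu] at e3

lemma kappa_eq (a₁ a₂ : ℚ_[q]) {r₁ r₂ κ : ℝ} (hr₁ : 0 ≤ r₁) (hr₂ : 0 ≤ r₂) (hκ0 : 0 < κ)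
    (hκ : κ = sInf {d : ℝ | ∃ ξ₁ ∈ {ξ : ℚ_[q] | ‖ξ - a₁‖ ≤ r₁},
      ∃ ξ₂ ∈ {ξ : ℚ_[q] | ‖ξ - a₂‖ ≤ r₂}, d = ‖ξ₁ - ξ₂‖}) :
    r₁ < ‖a₁ - a₂‖ ∧ r₂ < ‖a₁ - a₂‖ ∧ κ = ‖a₁ - a₂‖ := by
  have hle : ∀ ξ₁ ξ₂ : ℚ_[q], ‖ξ₁ - a₁‖ ≤ r₁ → ‖ξ₂ - a₂‖ ≤ r₂ → κ ≤ ‖ξ₁ - ξ₂‖ := by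
    intro ξ₁ ξ₂ h1 h2
    rw [hκ]
    refine csInf_le ⟨0, ?_⟩ ⟨ξ₁, h1, ξ₂, h2, rfl⟩
    rintro d ⟨_, _, _, _, rfl⟩
    exact norm_nonneg _
  have h1 : r₁ < ‖a₁ - a₂‖ := by
    by_contra hc
    push Not at hc
    have := hle a₂ a₂ (by rwa [norm_sub_rev]) (by simpa using hr₂)
    simp at this; linarith
  have h2 : r₂ < ‖a₁ - a₂‖ := by
    by_contra hc
    push Not at hc
    have := hle a₁ a₁ (by simpa using hr₁) hc
    simp at this; linarith
  refine ⟨h1, h2, le_antisymm (hle _ _ (by simpa using hr₁) (by simpa using hr₂)) ?_⟩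
  rw [hκ]
  refine le_csInf ⟨_, a₁, by simpa using hr₁, a₂, by simpa using hr₂, rfl⟩ ?_
  rintro d ⟨x, hx, y, hy, rfl⟩
  have e : x - y = ((x - a₁) + -(y - a₂)) + (a₁ - a₂) := by ring
  have hlt : ‖(x - a₁) + -(y - a₂)‖ < ‖a₁ - a₂‖ := by
    refine (Padic.nonarchimedean _ _).trans_lt ?_
    rw [norm_neg]
    exact max_lt (lt_of_le_of_lt hx h1) (lt_of_le_of_lt hy h2)
  rw [e, Padic.add_eq_max_of_ne hlt.ne, max_eq_right hlt.le]

end BR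

/-- **Bilinear restriction for the q-adic parabola.** If `f₁, f₂` are Schwartz with Fourier
support in the `δ`-neighbourhood of the parabola over intervals `I₁, I₂ ⊂ ℤ_q` separated by a
distance `κ ≥ δ^{1/2}` (where `δ = q^{-2m}`), then
`∫ |f₁ f₂|² ≤ (δ²/κ) ∫ |f₁|² ∫ |f₂|²`. -/
theorem bilinear_restriction (q : ℕ) [Fact q.Prime] (hq2 : q ≠ 2)
    (μ : Measure ℚ_[q]) [μ.IsAddHaarMeasure] [SigmaFinite μ]
    (hμ : μ {x : ℚ_[q] | ‖x‖ ≤ 1} = 1)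
    (χ : ℚ_[q] → ℂ)
    (hχ_mul : ∀ x y : ℚ_[q], χ (x + y) = χ x * χ y)
    (hχ_norm : ∀ x : ℚ_[q], ‖χ x‖ = 1)
    (hχ_triv : ∀ x : ℚ_[q], ‖x‖ ≤ 1 → χ x = 1)
    (hχ_nontriv : ∃ x : ℚ_[q], ‖x‖ ≤ (q : ℝ) ∧ χ x ≠ 1)
    (m : ℕ) (hm : 1 ≤ m)
    (ℓ₁ ℓ₂ : ℕ) (a₁ a₂ : ℚ_[q]) (ha₁ : ‖a₁‖ ≤ 1) (ha₂ : ‖a₂‖ ≤ 1)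
    (κ : ℝ)
    (hκ : κ = sInf {d : ℝ |
      ∃ ξ₁ ∈ {ξ : ℚ_[q] | ‖ξ - a₁‖ ≤ (q : ℝ) ^ (-(ℓ₁ : ℤ))},
      ∃ ξ₂ ∈ {ξ : ℚ_[q] | ‖ξ - a₂‖ ≤ (q : ℝ) ^ (-(ℓ₂ : ℤ))},
        d = ‖ξ₁ - ξ₂‖})
    (hsep : (q : ℝ) ^ (-(m : ℤ)) ≤ κ)
    (f₁ f₂ : ℚ_[q] × ℚ_[q] → ℂ)
    (hf₁_lc : IsLocallyConstant f₁) (hf₁_supp : HasCompactSupport f₁)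
    (hf₂_lc : IsLocallyConstant f₂) (hf₂_supp : HasCompactSupport f₂)
    (hFT₁ : ∀ p : ℚ_[q] × ℚ_[q],
      ¬ (‖p.1 - a₁‖ ≤ (q : ℝ) ^ (-(ℓ₁ : ℤ)) ∧
          ‖p.2 - p.1 ^ 2‖ ≤ (q : ℝ) ^ (-((2 * m : ℕ) : ℤ))) →
      qpFourier q μ χ f₁ p = 0)
    (hFT₂ : ∀ p : ℚ_[q] × ℚ_[q],
      ¬ (‖p.1 - a₂‖ ≤ (q : ℝ) ^ (-(ℓ₂ : ℤ)) ∧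
          ‖p.2 - p.1 ^ 2‖ ≤ (q : ℝ) ^ (-((2 * m : ℕ) : ℤ))) →
      qpFourier q μ χ f₂ p = 0) :
    ∫ x, ‖f₁ x * f₂ x‖ ^ 2 ∂(μ.prod μ)
      ≤ ((q : ℝ) ^ (-((4 * m : ℕ) : ℤ)) / κ) *
          (∫ x, ‖f₁ x‖ ^ 2 ∂(μ.prod μ)) * ∫ x, ‖f₂ x‖ ^ 2 ∂(μ.prod μ) := by

  classical
  have hχ : BR.IsChar χ := ⟨hχ_mul, hχ_norm, hχ_triv, hχ_nontriv⟩
  have hq0 := BR.q_pos (q := q)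
  have hκ0 : 0 < κ := lt_of_lt_of_le (zpow_pos hq0 _) hsep
  obtain ⟨h1, h2, hκe⟩ := BR.kappa_eq a₁ a₂ (zpow_nonneg hq0.le _) (zpow_nonneg hq0.le _) hκ0 hκ
  have hne : a₁ - a₂ ≠ 0 := by
    rw [← norm_pos_iff, ← hκe]; exact hκ0
  obtain ⟨k, hk⟩ : ∃ k : ℤ, κ = (q:ℝ)^k := ⟨_, hκe.trans (Padic.norm_eq_zpow_neg_valuation hne)⟩
  obtain ⟨N₁, hN₁⟩ := BR.exists_sch hf₁_lc hf₁_supp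
  obtain ⟨N₂, hN₂⟩ := BR.exists_sch hf₂_lc hf₂_supp
  have s₁ := hN₁ (max N₁ N₂) (le_max_left _ _)
  have s₂ := hN₂ (max N₁ N₂) (le_max_right _ _)
  have t₁ := BR.four_sch (μ := μ) hχ s₁
  have t₂ := BR.four_sch (μ := μ) hχ s₂
  have hC0 : 0 ≤ (q : ℝ) ^ (-((4 * m : ℕ) : ℤ)) / κ := div_nonneg (zpow_nonneg hq0.le _) hκ0.le
  have hCe : ENNReal.ofReal ((q : ℝ) ^ (-((4 * m : ℕ) : ℤ)) / κ) =
      ENNReal.ofReal ((q:ℝ)^(-((2 * m : ℕ) : ℤ) - k)) * ENNReal.ofReal ((q:ℝ)^(-((2 * m : ℕ) : ℤ))) := by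
    rw [← ENNReal.ofReal_mul (zpow_nonneg hq0.le _), ← zpow_add₀ hq0.ne', hk, ← zpow_sub₀ hq0.ne']
    congr 2; push_cast; ring
  have hC : ∀ p, (μ.prod μ) {s | qpFourier q μ χ f₁ s ≠ 0 ∧ qpFourier q μ χ f₂ (p - s) ≠ 0} ≤
      ENNReal.ofReal ((q : ℝ) ^ (-((4 * m : ℕ) : ℤ)) / κ) := by
    intro p
    by_cases hA : ∃ c, qpFourier q μ χ f₁ c ≠ 0 ∧ qpFourier q μ χ f₂ (p - c) ≠ 0
    · obtain ⟨c, hc1, hc2⟩ := hA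
      have hc1' := not_imp_comm.1 (hFT₁ c) hc1
      have hc2' := not_imp_comm.1 (hFT₂ (p - c)) hc2
      rw [hCe, ← BR.shear_measure hμ c.1]
      refine measure_mono ?_
      rintro s ⟨hs1, hs2⟩
      have hs1' := not_imp_comm.1 (hFT₁ s) hs1
      have hs2' := not_imp_comm.1 (hFT₂ (p - s)) hs2
      refine ⟨?_, hs1'.2⟩
      have := BR.geom hq2 a₁ a₂ h1 h2 p s c hs1'.1 hs1'.2 hs2'.2 hc1'.2 hc2'.1 hc2'.2
      rw [← hκe, ← le_div_iff₀ hκ0, hk, ← zpow_sub₀ hq0.ne'] at this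
      exact this
    · push Not at hA
      have : {s | qpFourier q μ χ f₁ s ≠ 0 ∧ qpFourier q μ χ f₂ (p - s) ≠ 0} = ∅ := by
        ext s
        simp only [Set.mem_setOf_eq, Set.mem_empty_iff_false, iff_false, not_and, not_not]
        exact hA s
      rw [this, measure_empty]; exact zero_le
  have hb := BR.conv_bound (μ := μ) t₁ t₂ _ hC
  simp_rw [← BR.four_mul hμ hχ s₁ s₂] at hb
  rw [← BR.l2_eq (BR.four_sch hχ (s₁.mul s₂)), ← BR.l2_eq t₁, ← BR.l2_eq t₂,
    ← BR.parseval hμ hχ s₁, ← BR.parseval hμ hχ s₂, ← BR.parseval hμ hχ (s₁.mul s₂),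
    ← ENNReal.ofReal_mul hC0, ← ENNReal.ofReal_mul (mul_nonneg hC0 (integral_nonneg fun x => by positivity))] at hb
  refine (ENNReal.ofReal_le_ofReal_iff ?_).1 hb
  exact mul_nonneg (mul_nonneg hC0 (integral_nonneg fun x => by positivity)) (integral_nonneg fun x => by positivity)
end
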